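/- Let r = 1 (so p = 3) and N ≤ 3. There exists a constant C = C(N,B) > 0 such that for every T ∈ ℝ and every nonnegative classical solution U = (u_1,…,u_m) of (S) on ℝ^N × (−∞,T), one has u_i(x,t) ≤ C (T−t)^{−1/2} for all x ∈ ℝ^N, all t < T, and all i = 1,…,m. -/

import Mathlib

open Real Set Metric MeasureTheory

/-- The Laplacian in the space variable, as the sum of second derivatives in
the coordinate directions. -/
noncomputable def lap {N : ℕ} (f : EuclideanSpace ℝ (Fin N) → ℝ)
    (x : EuclideanSpace ℝ (Fin N)) : ℝ :=
  ∑ i, iteratedFDeriv ℝ 2 f x ![EuclideanSpace.single i 1, EuclideanSpace.single i 1]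

namespace AncientCubic

open Filter Topology

/-- Euclidean space. -/
abbrev Eu (N : ℕ) := EuclideanSpace ℝ (Fin N)

/-- The partial derivative in the `i`-th coordinate direction. -/
noncomputable def pd {N : ℕ} (i : Fin N) (f : Eu N → ℝ) (x : Eu N) : ℝ :=
  fderiv ℝ f x (EuclideanSpace.single i 1)

section calculus

variable {N : ℕ} {f g : Eu N → ℝ} {x : Eu N} {i : Fin N}

theorem pd_add (hf : DifferentiableAt ℝ f x) (hg : DifferentiableAt ℝ g x) :
    pd i (fun y => f y + g y) x = pd i f x + pd i g x := by
  simp only [pd]; rw [fderiv_fun_add hf hg]; simp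

theorem pd_mul (hf : DifferentiableAt ℝ f x) (hg : DifferentiableAt ℝ g x) :
    pd i (fun y => f y * g y) x = pd i f x * g x + f x * pd i g x := by
  simp only [pd]; rw [fderiv_fun_mul hf hg]; simp; ring

theorem pd_const (c : ℝ) : pd i (fun _ : Eu N => c) x = 0 := by
  simp [pd]

theorem pd_const_mul (c : ℝ) (hf : DifferentiableAt ℝ f x) :
    pd i (fun y => c * f y) x = c * pd i f x := by
  rw [pd_mul (by fun_prop) hf, pd_const]; ring

theorem pd_sum {ι : Type*} (s : Finset ι) {F : ι → Eu N → ℝ}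
    (hF : ∀ j ∈ s, DifferentiableAt ℝ (F j) x) :
    pd i (fun y => ∑ j ∈ s, F j y) x = ∑ j ∈ s, pd i (F j) x := by
  simp only [pd]; rw [fderiv_fun_sum hF]; simp

theorem pd_comp {Φ : ℝ → ℝ} (hΦ : DifferentiableAt ℝ Φ (f x)) (hf : DifferentiableAt ℝ f x) :
    pd i (fun y => Φ (f y)) x = deriv Φ (f x) * pd i f x := by
  have h := (hΦ.hasDerivAt.comp_hasFDerivAt x hf.hasFDerivAt).fderiv
  simp only [pd]
  change (fderiv ℝ (Φ ∘ f) x) _ = _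
  rw [h]; simp

theorem pd_comp_affine (x₀ : Eu N) (c : ℝ) (hf : DifferentiableAt ℝ f (x₀ + c • x)) :
    pd i (fun y => f (x₀ + c • y)) x = c * pd i f (x₀ + c • x) := by
  have h1 : HasFDerivAt (fun y : Eu N => x₀ + c • y) (c • ContinuousLinearMap.id ℝ (Eu N)) x :=
    ((hasFDerivAt_id x).const_smul c).const_add x₀
  have h := (hf.hasFDerivAt.comp x h1).fderiv
  simp only [pd]
  change (fderiv ℝ (f ∘ fun y : Eu N => x₀ + c • y) x) _ = _
  rw [h]; simp

theorem contDiff_pd {n k : WithTop ℕ∞} (hf : ContDiff ℝ n f) (h : k + 1 ≤ n) :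
    ContDiff ℝ k (pd i f) :=
  (hf.fderiv_right h).clm_apply contDiff_const

theorem continuous_pd (hf : ContDiff ℝ 1 f) : Continuous (pd i f) :=
  (contDiff_pd (k := 0) hf (by norm_num)).continuous

theorem contDiff_one_pd (hf : ContDiff ℝ 2 f) : ContDiff ℝ 1 (pd i f) :=
  contDiff_pd hf (by norm_num)

theorem differentiable_pd (hf : ContDiff ℝ 2 f) : Differentiable ℝ (pd i f) :=
  (contDiff_one_pd hf).differentiable (by norm_num)

theorem pd_normSq : pd i (fun y : Eu N => ‖y‖ ^ 2) x = 2 * x i := by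
  simp only [pd]
  rw [(hasStrictFDerivAt_norm_sq x).hasFDerivAt.fderiv]
  simp [EuclideanSpace.inner_single_right]

theorem pd_coord (j : Fin N) : pd i (fun y : Eu N => y j) x = if j = i then 1 else 0 := by
  have : (fun y : Eu N => y j) = (EuclideanSpace.proj j : Eu N →L[ℝ] ℝ) := rfl
  simp only [pd]
  rw [this, ContinuousLinearMap.fderiv]
  simp

theorem lap_eq (hf : ContDiff ℝ 2 f) : lap f x = ∑ i, pd i (pd i f) x := by
  unfold lap
  refine Finset.sum_congr rfl fun i _ => ?_
  rw [iteratedFDeriv_two_apply]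
  have h1 : DifferentiableAt ℝ (fderiv ℝ f) x :=
    (hf.fderiv_right (m := 1) (by norm_num)).differentiable (by norm_num) x
  have : pd i f = fun y => fderiv ℝ f y (EuclideanSpace.single i 1) := rfl
  rw [pd, this, fderiv_clm_apply h1 (by fun_prop)]
  simp

theorem continuous_lap (hf : ContDiff ℝ 2 f) : Continuous (lap f) := by
  have : lap f = fun x => ∑ i, pd i (pd i f) x := funext fun x => lap_eq hf
  rw [this]
  exact continuous_finsetSum _ fun i _ => continuous_pd (contDiff_one_pd hf)

theorem lap_add (hf : ContDiff ℝ 2 f) (hg : ContDiff ℝ 2 g) :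
    lap (fun y => f y + g y) x = lap f x + lap g x := by
  rw [lap_eq (hf.add hg), lap_eq hf, lap_eq hg, ← Finset.sum_add_distrib]
  refine Finset.sum_congr rfl fun i _ => ?_
  have : pd i (fun y => f y + g y) = fun y => pd i f y + pd i g y :=
    funext fun y => pd_add (hf.differentiable (by norm_num) y) (hg.differentiable (by norm_num) y)
  rw [this, pd_add (differentiable_pd hf x) (differentiable_pd hg x)]

theorem lap_mul (hf : ContDiff ℝ 2 f) (hg : ContDiff ℝ 2 g) :
    lap (fun y => f y * g y) x
      = lap f x * g x + f x * lap g x + 2 * ∑ i, pd i f x * pd i g x := by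
  rw [lap_eq (hf.mul hg), lap_eq hf, lap_eq hg, Finset.sum_mul, Finset.mul_sum, Finset.mul_sum,
    ← Finset.sum_add_distrib, ← Finset.sum_add_distrib]
  refine Finset.sum_congr rfl fun i _ => ?_
  have df := hf.differentiable (by norm_num)
  have dg := hg.differentiable (by norm_num)
  have : pd i (fun y => f y * g y) = fun y => pd i f y * g y + f y * pd i g y :=
    funext fun y => pd_mul (df y) (dg y)
  have pf := differentiable_pd (i := i) hf
  have pg := differentiable_pd (i := i) hg
  rw [this, pd_add (by fun_prop) (by fun_prop), pd_mul (by fun_prop) (by fun_prop),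
    pd_mul (by fun_prop) (by fun_prop)]
  ring

theorem lap_const (c : ℝ) : lap (fun _ : Eu N => c) x = 0 := by
  rw [lap_eq contDiff_const]
  refine Finset.sum_eq_zero fun i _ => ?_
  have : pd i (fun _ : Eu N => c) = fun _ => 0 := funext fun y => pd_const c
  rw [this, pd_const]

theorem lap_const_mul (c : ℝ) (hf : ContDiff ℝ 2 f) :
    lap (fun y => c * f y) x = c * lap f x := by
  rw [lap_mul contDiff_const hf, lap_const]
  simp [pd_const]

theorem lap_neg (hf : ContDiff ℝ 2 f) : lap (fun y => - f y) x = - lap f x := by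
  have := lap_const_mul (x := x) (-1) hf
  simpa using this

theorem lap_sub (hf : ContDiff ℝ 2 f) (hg : ContDiff ℝ 2 g) :
    lap (fun y => f y - g y) x = lap f x - lap g x := by
  have := lap_add (x := x) hf hg.neg
  rw [lap_neg hg] at this
  simpa [sub_eq_add_neg] using this

theorem lap_comp {Φ : ℝ → ℝ} (hΦ : ContDiff ℝ 2 Φ) (hf : ContDiff ℝ 2 f) :
    lap (fun y => Φ (f y)) x
      = deriv Φ (f x) * lap f x + deriv (deriv Φ) (f x) * ∑ i, pd i f x ^ 2 := by
  have hc : ContDiff ℝ 2 (fun y => Φ (f y)) := hΦ.comp hf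
  rw [lap_eq hc, lap_eq hf, Finset.mul_sum, Finset.mul_sum, ← Finset.sum_add_distrib]
  refine Finset.sum_congr rfl fun i _ => ?_
  have df := hf.differentiable (by norm_num)
  have dΦ := hΦ.differentiable (by norm_num)
  have ddΦ : Differentiable ℝ (deriv Φ) :=
    (hΦ.iterate_deriv' 1 1).differentiable (by norm_num)
  have : pd i (fun y => Φ (f y)) = fun y => deriv Φ (f y) * pd i f y :=
    funext fun y => pd_comp (dΦ _) (df y)
  have pf := differentiable_pd (i := i) hf
  rw [this, pd_mul (by fun_prop) (by fun_prop), pd_comp (ddΦ _) (df x)]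
  ring

theorem lap_comp_affine (x₀ : Eu N) (c : ℝ) (hf : ContDiff ℝ 2 f) :
    lap (fun y => f (x₀ + c • y)) x = c ^ 2 * lap f (x₀ + c • x) := by
  have hc : ContDiff ℝ 2 (fun y => f (x₀ + c • y)) := by fun_prop
  rw [lap_eq hc, lap_eq hf, Finset.mul_sum]
  refine Finset.sum_congr rfl fun i _ => ?_
  have df := hf.differentiable (by norm_num)
  have : pd i (fun y => f (x₀ + c • y)) = fun y => c * pd i f (x₀ + c • y) :=
    funext fun y => pd_comp_affine _ _ (df _)
  have pf := differentiable_pd (i := i) hf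
  rw [this, pd_const_mul _ (by fun_prop), pd_comp_affine _ _ (pf _)]
  ring

theorem lap_normSq : lap (fun y : Eu N => ‖y‖ ^ 2) x = 2 * N := by
  rw [lap_eq (contDiff_norm_sq ℝ)]
  have h : ∀ i : Fin N, pd i (pd i (fun y : Eu N => ‖y‖ ^ 2)) x = 2 := by
    intro i
    have : pd i (fun y : Eu N => ‖y‖ ^ 2) = fun y => 2 * y i := funext fun y => pd_normSq
    rw [this, pd_const_mul _ (by fun_prop), pd_coord]
    simp
  simp [h]; ring

theorem lap_clm (L : Eu N →L[ℝ] ℝ) : lap (fun y => L y) x = 0 := by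
  rw [lap_eq L.contDiff]
  refine Finset.sum_eq_zero fun i _ => ?_
  have : pd i (fun y => L y) = fun _ => L (EuclideanSpace.single i 1) := by
    funext y; simp only [pd]; rw [ContinuousLinearMap.fderiv]
  rw [this, pd_const]

theorem sum_coord_sq (x : Eu N) : ∑ i, x i ^ 2 = ‖x‖ ^ 2 := by
  rw [EuclideanSpace.norm_sq_eq]; simp

theorem deriv_deriv_nonneg_of_isLocalMin {g : ℝ → ℝ} {a : ℝ} (hg : IsLocalMin g a)
    (hc : ContinuousAt g a) : 0 ≤ deriv (deriv g) a := by
  by_contra! h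
  have h1 := isLocalMax_of_deriv_deriv_neg h hg.deriv_eq_zero hc
  have h2 : g =ᶠ[𝓝 a] fun _ => g a := by
    filter_upwards [hg, h1] with y hy hy'
    exact le_antisymm hy' hy
  have h3 := h2.deriv.deriv_eq
  simp at h3
  exact absurd h3 h.ne

theorem lap_nonneg_of_isLocalMin (hf : ContDiff ℝ 2 f) (h : IsLocalMin f x) :
    0 ≤ lap f x := by
  rw [lap_eq hf]
  refine Finset.sum_nonneg fun i _ => ?_
  set e : Eu N := EuclideanSpace.single i 1
  have key : ∀ {h : Eu N → ℝ}, Differentiable ℝ h →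
      ∀ s : ℝ, HasDerivAt (fun s : ℝ => h (x + s • e)) (pd i h (x + s • e)) s := by
    intro h hh s
    have h1 : HasDerivAt (fun s : ℝ => x + s • e) e s := by
      simpa using ((hasDerivAt_id s).smul_const e).const_add x
    exact (hh (x + s • e)).hasFDerivAt.comp_hasDerivAt s h1
  have d1 : deriv (fun s : ℝ => f (x + s • e)) = fun s => pd i f (x + s • e) :=
    funext fun s => (key (hf.differentiable (by norm_num)) s).deriv
  have d2 : deriv (deriv (fun s : ℝ => f (x + s • e))) 0 = pd i (pd i f) x := by
    rw [d1, (key (differentiable_pd hf) 0).deriv]; simp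
  rw [← d2]
  have hcont : Continuous fun s : ℝ => x + s • e := by fun_prop
  apply deriv_deriv_nonneg_of_isLocalMin
  · have : Tendsto (fun s : ℝ => x + s • e) (𝓝 0) (𝓝 x) := by
      simpa using hcont.tendsto 0
    have h2 := this.eventually h
    filter_upwards [h2] with s hs
    simpa using hs
  · exact (hf.continuous.comp hcont).continuousAt

/-- Divergence theorem for compactly supported functions. -/
theorem integral_pd_eq_zero (hf : ContDiff ℝ 1 f) (hs : HasCompactSupport f) :
    ∫ y, pd i f y = 0 := by
  have hs' : HasCompactSupport (pd i f) := hs.fderiv_apply ℝ _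
  have h1 : Integrable f := hf.continuous.integrable_of_hasCompactSupport hs
  have h2 : Integrable (pd i f) := (continuous_pd hf).integrable_of_hasCompactSupport hs'
  have := integral_mul_fderiv_eq_neg_fderiv_mul_of_integrable (μ := volume)
    (f := fun _ : Eu N => (1 : ℝ)) (g := f) (v := EuclideanSpace.single i 1)
    (by simp) (by simpa [pd] using! h2) (by simpa using h1) (fun y _ => by fun_prop)
    (fun y _ => hf.differentiable (by norm_num) y)
  simpa [pd] using this

theorem hasCompactSupport_pd (hs : HasCompactSupport f) : HasCompactSupport (pd i f) :=
  hs.fderiv_apply ℝ _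

theorem hasCompactSupport_lap (hs : HasCompactSupport f) (hf : ContDiff ℝ 2 f) :
    HasCompactSupport (lap f) := by
  have : lap f = ∑ i, fun y => pd i (pd i f) y := by
    funext y; rw [lap_eq hf]; simp
  rw [this]
  exact HasCompactSupport.finset_sum fun i _ => hasCompactSupport_pd (hasCompactSupport_pd hs)

theorem integral_pd_mul (hf : ContDiff ℝ 1 f) (hg : ContDiff ℝ 1 g) (hs : HasCompactSupport g) :
    ∫ y, f y * pd i g y = - ∫ y, pd i f y * g y := by
  have h := integral_pd_eq_zero (i := i) (hf.mul hg) (hs.mul_left (f := f))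
  have e : ∀ y, pd i (fun y => f y * g y) y = pd i f y * g y + f y * pd i g y := fun y =>
    pd_mul (hf.differentiable (by norm_num) y) (hg.differentiable (by norm_num) y)
  rw [integral_congr_ae (Eventually.of_forall e), integral_add] at h
  · linarith
  · exact ((continuous_pd hf).mul hg.continuous).integrable_of_hasCompactSupport hs.mul_left
  · exact (hf.continuous.mul (continuous_pd hg)).integrable_of_hasCompactSupport
      (hasCompactSupport_pd hs).mul_left

theorem integral_lap_mul (hf : ContDiff ℝ 2 f) (hg : ContDiff ℝ 2 g) (hs : HasCompactSupport g) :
    ∫ y, lap f y * g y = ∫ y, f y * lap g y := by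
  have hf1 : ContDiff ℝ 1 f := hf.of_le (by norm_num)
  have hg1 : ContDiff ℝ 1 g := hg.of_le (by norm_num)
  simp_rw [lap_eq hf, lap_eq hg, Finset.sum_mul, Finset.mul_sum]
  rw [integral_finsetSum, integral_finsetSum]
  · refine Finset.sum_congr rfl fun i _ => ?_
    have h := integral_pd_mul (i := i) (contDiff_one_pd (i := i) hf) hg1 hs
    rw [integral_pd_mul hf1 (contDiff_one_pd hg) (hasCompactSupport_pd hs),
      h, neg_neg]
  · intro i _
    exact (hf.continuous.mul (continuous_pd (contDiff_one_pd hg))).integrable_of_hasCompactSupport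
      (hasCompactSupport_pd (hasCompactSupport_pd hs)).mul_left
  · intro i _
    exact ((continuous_pd (contDiff_one_pd hf)).mul hg.continuous).integrable_of_hasCompactSupport
      hs.mul_left

end calculus

/-- Continuity in the parameter of integrals of functions supported in a fixed compact set. -/
theorem continuousOn_integral_of_support {N : ℕ} {q : Eu N → ℝ → ℝ} {K : Set (Eu N)}
    (hK : IsCompact K) {S : Set ℝ} {M : ℝ} (hm : ∀ t ∈ S, AEStronglyMeasurable (fun x => q x t))
    (hc : ∀ x, ContinuousOn (q x) S) (hb : ∀ x, ∀ t ∈ S, |q x t| ≤ M)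
    (hs : ∀ x ∉ K, ∀ t ∈ S, q x t = 0) :
    ContinuousOn (fun t => ∫ x, q x t) S := by
  intro t₀ ht₀
  refine tendsto_integral_filter_of_dominated_convergence (K.indicator fun _ => M) ?_ ?_ ?_ ?_
  · filter_upwards [self_mem_nhdsWithin] with t ht using hm t ht
  · filter_upwards [self_mem_nhdsWithin] with t ht
    refine Eventually.of_forall fun x => ?_
    by_cases hx : x ∈ K
    · simpa [hx] using hb x t ht
    · simp [hx, hs x hx t ht]
  · exact (integrable_indicator_iff hK.measurableSet).2
      (integrableOn_const (hs := hK.measure_lt_top.ne))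
  · exact Eventually.of_forall fun x => hc x t₀ ht₀

/-- Lower semicontinuity from the future at `(x, t)`. -/
def RLsc {N : ℕ} (w : Eu N → ℝ → ℝ) (x : Eu N) (t : ℝ) : Prop :=
  LowerSemicontinuousWithinAt (fun p : Eu N × ℝ => w p.1 p.2) {p | t ≤ p.2} (x, t)

/-- `w` is a regular supersolution of `∂ₜ w = Δ w + g` on `ball x₀ R × S`. -/
structure SuperOn {N : ℕ} (w g : Eu N → ℝ → ℝ) (x₀ : Eu N) (R : ℝ) (S : Set ℝ) : Prop where
  c2 : ∀ t ∈ S, ContDiff ℝ 2 (fun x => w x t)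
  dt : ∀ x, ∀ t ∈ S, DifferentiableAt ℝ (w x) t
  ineq : ∀ x ∈ ball x₀ R, ∀ t ∈ S, lap (fun y => w y t) x + g x t ≤ deriv (w x) t

theorem SuperOn.mono {N : ℕ} {w g : Eu N → ℝ → ℝ} {x₀ x₁ : Eu N} {R R' : ℝ} {S S' : Set ℝ}
    (h : SuperOn w g x₀ R S) (hR : ball x₁ R' ⊆ ball x₀ R) (hS : S' ⊆ S) :
    SuperOn w g x₁ R' S' :=
  ⟨fun t ht => h.c2 t (hS ht), fun x t ht => h.dt x t (hS ht),
    fun x hx t ht => h.ineq x (hR hx) t (hS ht)⟩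

theorem RLsc.add_continuous {N : ℕ} {w : Eu N → ℝ → ℝ} {x : Eu N} {t : ℝ} (h : RLsc w x t)
    {q : Eu N → ℝ → ℝ} (hq : Continuous fun p : Eu N × ℝ => q p.1 p.2) :
    RLsc (fun y s => w y s + q y s) x t := by
  unfold RLsc at h ⊢
  exact LowerSemicontinuousWithinAt.add h
    (hq.lowerSemicontinuous.lowerSemicontinuousWithinAt _ _)

/-- Minimum principle for functions that are only semicontinuous from the future. -/
theorem min_principle {N : ℕ} {Z : Eu N → ℝ → ℝ} {x₀ : Eu N} {R t₁ t₂ : ℝ}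
    (hC : ∀ t ∈ Icc t₁ t₂, ContDiff ℝ 2 (fun x => Z x t))
    (hT : ∀ x ∈ ball x₀ R, ∀ t ∈ Ioc t₁ t₂, DifferentiableAt ℝ (Z x) t)
    (hZ : ∀ x ∈ ball x₀ R, ∀ t ∈ Ioc t₁ t₂, lap (fun y => Z y t) x < deriv (Z x) t)
    (hL : ∀ x ∈ closedBall x₀ R, ∀ t ∈ Ico t₁ t₂, RLsc Z x t)
    (hb : ∀ x ∈ sphere x₀ R, ∀ t ∈ Icc t₁ t₂, 0 ≤ Z x t)
    (h0 : ∀ x ∈ closedBall x₀ R, 0 ≤ Z x t₁) :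
    ∀ x ∈ closedBall x₀ R, ∀ t ∈ Icc t₁ t₂, 0 ≤ Z x t := by
  intro x₁ hx₁ s₁ hs₁
  by_contra! hneg
  set c := Z x₁ s₁ with hc
  set S : Set ℝ := {t | t ∈ Icc t₁ s₁ ∧ ∃ x ∈ closedBall x₀ R, Z x t ≤ c} with hS
  have hs₁S : s₁ ∈ S := ⟨⟨hs₁.1, le_rfl⟩, x₁, hx₁, le_rfl⟩
  have hbdd : BddBelow S := ⟨t₁, fun t ht => ht.1.1⟩
  set τ := sInf S with hτ
  have hτ1 : t₁ ≤ τ := le_csInf ⟨_, hs₁S⟩ fun t ht => ht.1.1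
  have hτ2 : τ ≤ s₁ := csInf_le hbdd hs₁S
  have hKc : IsCompact (closedBall x₀ R) := isCompact_closedBall _ _
  have hτS : τ ∈ S := by
    by_contra hnot
    have hlt : τ < s₁ := lt_of_le_of_ne hτ2 fun h => hnot (h ▸ hs₁S)
    have hgt : ∀ x ∈ closedBall x₀ R, c < Z x τ := by
      intro x hx
      by_contra! h
      exact hnot ⟨⟨hτ1, hτ2⟩, x, hx, h⟩
    have hev : ∀ᶠ s in 𝓝 τ, ∀ y ∈ closedBall x₀ R, τ ≤ s → c < Z y s := by
      apply hKc.eventually_forall_of_forall_eventually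
      intro y hy
      have := hL y hy τ ⟨hτ1, hlt.trans_le hs₁.2⟩ c (hgt y hy)
      rw [eventually_nhdsWithin_iff] at this
      rw [nhds_prod_eq] at this
      rw [nhds_prod_eq]
      have h2 := Filter.tendsto_prod_swap.eventually this
      exact h2
    obtain ⟨δ, hδ, hball⟩ := Metric.eventually_nhds_iff.1 hev
    obtain ⟨s, hs, hsδ⟩ := exists_lt_of_csInf_lt ⟨_, hs₁S⟩ (show sInf S < τ + δ by linarith)
    have hs' : τ ≤ s := csInf_le hbdd hs
    obtain ⟨x, hx, hxc⟩ := hs.2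
    have := hball (y := s) (by rw [Real.dist_eq, abs_of_nonneg] <;> linarith) x hx hs'
    linarith
  obtain ⟨_, x₂, hx₂, hx₂c⟩ := hτS
  have hτI : τ ∈ Icc t₁ t₂ := ⟨hτ1, hτ2.trans hs₁.2⟩
  obtain ⟨z, hz, hzmin⟩ := hKc.exists_isMinOn ⟨x₂, hx₂⟩ (hC τ hτI).continuous.continuousOn
  have hzc : Z z τ ≤ c := (hzmin hx₂).trans hx₂c
  have hzball : z ∈ ball x₀ R := by
    rcases (mem_closedBall.1 hz).lt_or_eq with h | h
    · exact h
    · have := hb z h τ hτI; linarith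
  have hτlt : t₁ < τ := by
    rcases hτ1.lt_or_eq with h | h
    · exact h
    · have := h0 z hz; rw [h] at this; linarith
  have hmin : IsLocalMin (fun y => Z y τ) z :=
    hzmin.isLocalMin (mem_of_superset (isOpen_ball.mem_nhds hzball) ball_subset_closedBall)
  have hpos : 0 < deriv (Z z) τ :=
    (lap_nonneg_of_isLocalMin (hC τ hτI) hmin).trans_lt (hZ z hzball τ ⟨hτlt, hτI.2⟩)
  have hd := (hT z hzball τ ⟨hτlt, hτI.2⟩).hasDerivAt
  have hsl := (hasDerivAt_iff_tendsto_slope.1 hd).eventually (lt_mem_nhds hpos)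
  have hsl' : ∀ᶠ s in 𝓝[<] τ, 0 < slope (Z z) τ s :=
    hsl.filter_mono (nhdsWithin_mono _ fun s hs => ne_of_lt hs)
  obtain ⟨s, hs, hst⟩ := (hsl'.and (Ioo_mem_nhdsLT hτlt)).exists
  have : Z z s < Z z τ := by
    rw [slope_def_field] at hs
    have hneg' : s - τ < 0 := by linarith [hst.2]
    by_contra! hcon
    exact absurd hs (not_lt.2 (div_nonpos_of_nonneg_of_nonpos (by linarith) hneg'.le))
  have hsS : s ∈ S := ⟨⟨hst.1.le, hst.2.le.trans hτ2⟩, z, hz, by linarith⟩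
  have := csInf_le hbdd hsS
  linarith [hst.2]

/-- A quadratic lower Taylor bound, uniform on compact balls. -/
theorem exists_taylor_bound {N : ℕ} {f : Eu N → ℝ} (hf : ContDiff ℝ 2 f) (x₀ : Eu N) (R : ℝ) :
    ∃ B Λ : ℝ, 0 ≤ B ∧ 0 ≤ Λ ∧ (∀ x ∈ closedBall x₀ R, ‖fderiv ℝ f x‖ ≤ Λ) ∧
      ∀ x ∈ closedBall x₀ R, ∀ y ∈ closedBall x₀ R,
        |f y - f x - fderiv ℝ f x (y - x)| ≤ B * ‖y - x‖ ^ 2 := by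
  have h1 : ContDiff ℝ 1 (fderiv ℝ f) := hf.fderiv_right (by norm_num)
  have hK : IsCompact (closedBall x₀ R) := isCompact_closedBall _ _
  obtain ⟨B, hB⟩ := hK.exists_bound_of_continuousOn
    (h1.continuous_fderiv (by norm_num)).continuousOn
  obtain ⟨Λ, hΛ⟩ := hK.exists_bound_of_continuousOn h1.continuous.continuousOn
  refine ⟨max B 0, max Λ 0, le_max_right _ _, le_max_right _ _,
    fun x hx => (hΛ x hx).trans (le_max_left _ _), fun x hx y hy => ?_⟩
  have hlip : ∀ z ∈ closedBall x₀ R, ‖fderiv ℝ f z - fderiv ℝ f x‖ ≤ max B 0 * ‖z - x‖ := by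
    intro z hz
    exact (convex_closedBall x₀ R).norm_image_sub_le_of_norm_fderiv_le
      (fun w _ => h1.differentiable (by norm_num) w)
      (fun w hw => (hB w hw).trans (le_max_left _ _)) hx hz
  have hseg : segment ℝ x y ⊆ closedBall x₀ R := (convex_closedBall x₀ R).segment_subset hx hy
  have := (convex_segment (𝕜 := ℝ) x y).norm_image_sub_le_of_norm_fderiv_le' (f := f)
    (φ := fderiv ℝ f x) (C := max B 0 * ‖y - x‖)
    (fun w _ => hf.differentiable (by norm_num) w)
    (fun w hw => (hlip w (hseg hw)).trans ?_) (left_mem_segment ℝ x y) (right_mem_segment ℝ x y)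
  · rw [Real.norm_eq_abs] at this
    rw [pow_two, ← mul_assoc]; exact this
  · refine mul_le_mul_of_nonneg_left ?_ (le_max_right _ _)
    have := segment_subset_closedBall_left x y hw
    rwa [mem_closedBall, dist_eq_norm, dist_comm, dist_eq_norm] at this

theorem barrier {N : ℕ} {w g : Eu N → ℝ → ℝ} {x₀ : Eu N} {R r t₁ t₂ M G : ℝ}
    (hw : SuperOn w g x₀ R (Icc t₁ t₂)) (h12 : t₁ ≤ t₂)
    (hM : ∀ x ∈ ball x₀ R, ∀ t ∈ Icc t₁ t₂, |w x t| ≤ M)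
    (hG : ∀ x ∈ ball x₀ R, ∀ t ∈ Icc t₁ t₂, |g x t| ≤ G)
    (hL : ∀ x ∈ ball x₀ R, ∀ t ∈ Ico t₁ t₂, RLsc w x t) (hr : r < R) :
    ∃ A : ℝ, ∀ t ∈ Icc t₁ t₂, ∀ x ∈ closedBall x₀ r, w x t₁ - A * (t - t₁) ≤ w x t := by
  obtain ⟨B, Λ, hB0, hΛ0, hΛ, hB⟩ := exists_taylor_bound (hw.c2 t₁ ⟨le_rfl, h12⟩) x₀ R
  set ρ := (R - r) / 2 with hρ
  have hρ0 : 0 < ρ := by rw [hρ]; linarith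
  set A₁ := max B ((2 * M + Λ * ρ) / ρ ^ 2) with hA₁
  refine ⟨G + 2 * N * A₁ + 1, fun t ht x hx => ?_⟩
  have hsub : closedBall x ρ ⊆ ball x₀ R := by
    intro y hy
    rw [mem_closedBall] at hy hx
    rw [mem_ball]
    linarith [dist_triangle y x x₀]
  have hxR : x ∈ closedBall x₀ R := closedBall_subset_closedBall hr.le hx
  have hxb : x ∈ ball x₀ R := hsub (mem_closedBall_self hρ0.le)
  set L := fderiv ℝ (fun y => w y t₁) x with hLdef
  set A := G + 2 * N * A₁ + 1 with hA
  set P : Eu N → ℝ := fun y => - w x t₁ - L (y - x) + A₁ * ‖y - x‖ ^ 2 with hP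
  have hsm : ContDiff ℝ 2 (fun y : Eu N => ‖y - x‖ ^ 2) :=
    (contDiff_norm_sq ℝ).comp (contDiff_id.sub contDiff_const)
  have hPs : ContDiff ℝ 2 P := by
    refine ContDiff.add ?_ (contDiff_const.mul hsm)
    exact contDiff_const.sub (L.contDiff.comp (contDiff_id.sub contDiff_const))
  have hlapP : ∀ y, lap P y = 2 * N * A₁ := by
    intro y
    have e1 : P = fun y => (L x - w x t₁ + A₁ * ‖y - x‖ ^ 2) - L y := by
      funext y; simp only [hP, map_sub]; ring
    have e2 : lap (fun y : Eu N => ‖y - x‖ ^ 2) y = 2 * N := by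
      have := lap_comp_affine (x := y) (-x) 1 (contDiff_norm_sq ℝ (E := Eu N) (n := 2))
      simp only [one_smul, lap_normSq] at this
      have e : (fun y : Eu N => ‖y - x‖ ^ 2) = fun y => ‖-x + y‖ ^ 2 := by
        funext y; rw [neg_add_eq_sub]
      rw [e, this]; ring
    rw [e1, lap_sub (contDiff_const.add (contDiff_const.mul hsm)) L.contDiff, lap_clm,
      lap_add contDiff_const (contDiff_const.mul hsm), lap_const, lap_const_mul _ hsm, e2]
    ring
  have key := min_principle (Z := fun y s => w y s + (P y + A * (s - t₁))) (x₀ := x) (R := ρ)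
    (t₁ := t₁) (t₂ := t₂) ?_ ?_ ?_ ?_ ?_ ?_ x (mem_closedBall_self hρ0.le) t ht
  · simp only [hP, sub_self, map_zero, norm_zero] at key
    nlinarith [key]
  · intro s hs
    exact (hw.c2 s hs).add (hPs.add contDiff_const)
  · intro y _ s hs
    exact (hw.dt y s ⟨hs.1.le, hs.2⟩).add (by fun_prop)
  · intro y hy s hs
    have hs' : s ∈ Icc t₁ t₂ := ⟨hs.1.le, hs.2⟩
    have hyR := hsub (ball_subset_closedBall hy)
    have hd : deriv (fun s => w y s + (P y + A * (s - t₁))) s = deriv (w y) s + A := by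
      have h1 : HasDerivAt (fun s : ℝ => P y + A * (s - t₁)) A s := by
        simpa using (((hasDerivAt_id s).sub_const t₁).const_mul A).const_add (P y)
      exact ((hw.dt y s hs').hasDerivAt.add h1).deriv
    rw [hd, lap_add (hw.c2 s hs') (hPs.add contDiff_const), lap_add hPs contDiff_const,
      lap_const, hlapP]
    have h1 := hw.ineq y hyR s hs'
    have h2 := (abs_le.1 (hG y hyR s hs')).1
    rw [hA]; linarith
  · intro y hy s hs
    refine (hL y (hsub hy) s hs).add_continuous (q := fun y s => P y + A * (s - t₁)) ?_
    have := hPs.continuous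
    fun_prop
  · intro y hy s hs
    have hyρ : ‖y - x‖ = ρ := by rw [← dist_eq_norm]; exact hy
    have hyb : y ∈ ball x₀ R := hsub (sphere_subset_closedBall hy)
    have h1 := (abs_le.1 (hM y hyb s hs)).1
    have h2 := (abs_le.1 (hM x hxb t₁ ⟨le_rfl, h12⟩)).2
    have h3 : |L (y - x)| ≤ Λ * ρ := by
      have := L.le_opNorm (y - x)
      rw [hyρ, Real.norm_eq_abs] at this
      exact this.trans (mul_le_mul_of_nonneg_right (hΛ x hxR) hρ0.le)
    have h4 : 2 * M + Λ * ρ ≤ A₁ * ρ ^ 2 := by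
      have := le_max_right B ((2 * M + Λ * ρ) / ρ ^ 2)
      rwa [div_le_iff₀ (by positivity)] at this
    have hG0 : 0 ≤ G := (abs_nonneg _).trans (hG x hxb t₁ ⟨le_rfl, h12⟩)
    have hA0 : 0 ≤ A := by
      have : 0 ≤ A₁ := hB0.trans (le_max_left _ _)
      positivity
    have h5 : 0 ≤ A * (s - t₁) := mul_nonneg hA0 (by linarith [hs.1])
    simp only [hP, hyρ]
    linarith [(abs_le.1 h3).2]
  · intro y hy
    have hyR : y ∈ closedBall x₀ R := ball_subset_closedBall (hsub hy)
    have h1 := (abs_le.1 (hB x hxR y hyR)).1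
    have h2 : B * ‖y - x‖ ^ 2 ≤ A₁ * ‖y - x‖ ^ 2 :=
      mul_le_mul_of_nonneg_right (le_max_left _ _) (by positivity)
    simp only [hP, sub_self, mul_zero, add_zero]
    rw [← hLdef] at h1
    linarith

/-- Nonnegative test functions `ψ` with time derivative `ψ'`, supported in `closedBall x₀ r`. -/
structure Test {N : ℕ} (ψ ψ' : Eu N → ℝ → ℝ) (x₀ : Eu N) (r C : ℝ) (S : Set ℝ) : Prop where
  nonneg : ∀ x, ∀ t ∈ S, 0 ≤ ψ x t
  c2 : ∀ t ∈ S, ContDiff ℝ 2 (fun x => ψ x t)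
  supp : ∀ x ∉ closedBall x₀ r, ∀ t ∈ S, ψ x t = 0
  supp' : ∀ x ∉ closedBall x₀ r, ∀ t ∈ S, ψ' x t = 0
  hd : ∀ x, ∀ t ∈ S, HasDerivAt (ψ x) (ψ' x t) t
  le : ∀ x, ∀ t ∈ S, |ψ x t| ≤ C
  le' : ∀ x, ∀ t ∈ S, |ψ' x t| ≤ C
  le_lap : ∀ x, ∀ t ∈ S, |lap (fun y => ψ y t) x| ≤ C
  cont_lap : ∀ x, ContinuousOn (fun t => lap (fun y => ψ y t) x) S
  cont' : ∀ x, ContinuousOn (ψ' x) S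
  contx' : ∀ t ∈ S, Continuous fun x => ψ' x t

theorem lap_eq_zero_of_eqOn {N : ℕ} {f : Eu N → ℝ} {s : Set (Eu N)} (hs : IsClosed s)
    (h : ∀ x ∉ s, f x = 0) : ∀ x ∉ s, lap f x = 0 := by
  intro x hx
  have : f =ᶠ[𝓝 x] fun _ => (0 : ℝ) := by
    filter_upwards [hs.isOpen_compl.mem_nhds hx] with y hy using h y hy
  have h2 := lap_const (N := N) (x := x) 0
  unfold lap at h2 ⊢
  rw [this.iteratedFDeriv ℝ 2 |>.eq_of_nhds]
  exact h2

theorem integrable_of_support {N : ℕ} {f : Eu N → ℝ} {x₀ : Eu N} {r : ℝ} (hf : Continuous f)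
    (h : ∀ x ∉ closedBall x₀ r, f x = 0) : Integrable f :=
  hf.integrable_of_hasCompactSupport (HasCompactSupport.intro (isCompact_closedBall _ _) h)

/-- Continuity in time of the integral of `w * q`, for `w` bounded on a ball and `q` supported
in a smaller ball. -/
theorem continuousOn_integral_mul {N : ℕ} {w q : Eu N → ℝ → ℝ} {x₀ : Eu N} {r M C : ℝ}
    {S : Set ℝ} (hwx : ∀ t ∈ S, Continuous fun x => w x t) (hwt : ∀ x, ContinuousOn (w x) S)
    (hM : ∀ x ∈ closedBall x₀ r, ∀ t ∈ S, |w x t| ≤ M)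
    (hqx : ∀ t ∈ S, Continuous fun x => q x t) (hqt : ∀ x, ContinuousOn (q x) S)
    (hq : ∀ x, ∀ t ∈ S, |q x t| ≤ C) (hs : ∀ x ∉ closedBall x₀ r, ∀ t ∈ S, q x t = 0) :
    ContinuousOn (fun t => ∫ x, w x t * q x t) S := by
  refine continuousOn_integral_of_support (isCompact_closedBall x₀ r) (M := |M| * |C|)
    (fun t ht => ((hwx t ht).mul (hqx t ht)).aestronglyMeasurable)
    (fun x => (hwt x).mul (hqt x)) (fun x t ht => ?_) (fun x hx t ht => by simp [hs x hx t ht])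
  by_cases hx : x ∈ closedBall x₀ r
  · rw [abs_mul]
    exact mul_le_mul ((hM x hx t ht).trans (le_abs_self _)) ((hq x t ht).trans (le_abs_self _))
      (abs_nonneg _) (abs_nonneg _)
  · rw [hs x hx t ht]; simp; positivity

section weak

variable {N : ℕ} {w g ψ ψ' : Eu N → ℝ → ℝ} {x₀ : Eu N} {R r t₁ t₂ M G C : ℝ}

/-- The time density appearing in the weak formulation. -/
noncomputable def weakRate (w g ψ ψ' : Eu N → ℝ → ℝ) (t : ℝ) : ℝ :=
  (∫ x, w x t * ψ' x t) + (∫ x, w x t * lap (fun y => ψ y t) x) + ∫ x, g x t * ψ x t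

theorem continuousOn_weakRate (hw : SuperOn w g x₀ R (Icc t₁ t₂))
    (hM : ∀ x ∈ ball x₀ R, ∀ t ∈ Icc t₁ t₂, |w x t| ≤ M)
    (hG : ∀ x ∈ ball x₀ R, ∀ t ∈ Icc t₁ t₂, |g x t| ≤ G)
    (hgx : ∀ t ∈ Icc t₁ t₂, Continuous fun x => g x t) (hgt : ∀ x, ContinuousOn (g x) (Icc t₁ t₂))
    (hr : r < R) (hψ : Test ψ ψ' x₀ r C (Icc t₁ t₂)) :
    ContinuousOn (weakRate w g ψ ψ') (Icc t₁ t₂) := by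
  have hsub : closedBall x₀ r ⊆ ball x₀ R := closedBall_subset_ball hr
  have hwx : ∀ t ∈ Icc t₁ t₂, Continuous fun x => w x t := fun t ht => (hw.c2 t ht).continuous
  have hwt : ∀ x, ContinuousOn (w x) (Icc t₁ t₂) := fun x t ht =>
    (hw.dt x t ht).continuousAt.continuousWithinAt
  refine ((continuousOn_integral_mul hwx hwt (fun x hx => hM x (hsub hx)) hψ.contx' hψ.cont'
    hψ.le' hψ.supp').add (continuousOn_integral_mul hwx hwt (fun x hx => hM x (hsub hx))
      (fun t ht => continuous_lap (hψ.c2 t ht)) hψ.cont_lap hψ.le_lap ?_)).add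
        (continuousOn_integral_mul hgx hgt (fun x hx => hG x (hsub hx))
          (fun t ht => (hψ.c2 t ht).continuous)
          (fun x t ht => (hψ.hd x t ht).continuousAt.continuousWithinAt) hψ.le hψ.supp)
  exact fun x hx t ht => lap_eq_zero_of_eqOn isClosed_closedBall
    (fun y hy => hψ.supp y hy t ht) x hx

theorem weak_ineq (hw : SuperOn w g x₀ R (Icc t₁ t₂)) (h12 : t₁ ≤ t₂)
    (hM : ∀ x ∈ ball x₀ R, ∀ t ∈ Icc t₁ t₂, |w x t| ≤ M)
    (hG : ∀ x ∈ ball x₀ R, ∀ t ∈ Icc t₁ t₂, |g x t| ≤ G)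
    (hgx : ∀ t ∈ Icc t₁ t₂, Continuous fun x => g x t) (hgt : ∀ x, ContinuousOn (g x) (Icc t₁ t₂))
    (hL : ∀ x ∈ ball x₀ R, ∀ t ∈ Ico t₁ t₂, RLsc w x t) (hr : r < R)
    (hψ : Test ψ ψ' x₀ r C (Icc t₁ t₂)) :
    (∫ x, w x t₁ * ψ x t₁) + (∫ t in t₁..t₂, weakRate w g ψ ψ' t) ≤ ∫ x, w x t₂ * ψ x t₂ := by
  have hsub : closedBall x₀ r ⊆ ball x₀ R := closedBall_subset_ball hr
  have hwx : ∀ t ∈ Icc t₁ t₂, Continuous fun x => w x t := fun t ht => (hw.c2 t ht).continuous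
  have hwt : ∀ x, ContinuousOn (w x) (Icc t₁ t₂) := fun x t ht =>
    (hw.dt x t ht).continuousAt.continuousWithinAt
  have hψx : ∀ t ∈ Icc t₁ t₂, Continuous fun x => ψ x t := fun t ht => (hψ.c2 t ht).continuous
  have hψt : ∀ x, ContinuousOn (ψ x) (Icc t₁ t₂) := fun x t ht =>
    (hψ.hd x t ht).continuousAt.continuousWithinAt
  have hrc := continuousOn_weakRate hw hM hG hgx hgt hr hψ
  set h : ℝ → ℝ := fun t => ∫ x, w x t * ψ x t with hh
  have hhc : ContinuousOn h (Icc t₁ t₂) :=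
    continuousOn_integral_mul hwx hwt (fun x hx => hM x (hsub hx)) hψx hψt hψ.le hψ.supp
  have hint : ∀ t ∈ Icc t₁ t₂, Integrable fun x => w x t * ψ x t := fun t ht =>
    integrable_of_support (x₀ := x₀) (r := r) ((hwx t ht).mul (hψx t ht)) fun x hx => by
        simp [hψ.supp x hx t ht]
  -- lower right Dini derivative
  have dini : ∀ t ∈ Ico t₁ t₂, ∀ c < weakRate w g ψ ψ' t, ∀ᶠ s in 𝓝[>] t, c < slope h t s := by
    intro t ht c hc
    have htI : t ∈ Icc t₁ t₂ := ⟨ht.1, ht.2.le⟩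
    obtain ⟨A, hA⟩ := barrier (t₁ := t) (hw.mono le_rfl (Icc_subset_Icc_left ht.1)) ht.2.le
      (fun x hx s hs => hM x hx s ⟨ht.1.trans hs.1, hs.2⟩)
      (fun x hx s hs => hG x hx s ⟨ht.1.trans hs.1, hs.2⟩)
      (fun x hx s hs => hL x hx s ⟨ht.1.trans hs.1, hs.2⟩) hr
    set L : Eu N → ℝ := fun x => lap (fun y => w y t) x + g x t with hLdef
    have hLc : Continuous L := (continuous_lap (hw.c2 t htI)).add (hgx t htI)
    obtain ⟨B, hB⟩ := (isCompact_closedBall x₀ r).exists_bound_of_continuousOn hLc.continuousOn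
    have hIoo : ∀ᶠ s in 𝓝[>] t, s ∈ Ioo t t₂ := Ioo_mem_nhdsGT ht.2
    set e : ℝ → Eu N → ℝ := fun s x => min (slope (w x) t s) (L x) with he
    have hsl : ∀ s ∈ Ioo t t₂, Continuous fun x => slope (w x) t s := by
      intro s hs
      simp only [slope_def_field]
      exact ((hwx s ⟨ht.1.trans hs.1.le, hs.2.le⟩).sub (hwx t htI)).div_const _
    have hslψ : ∀ s ∈ Ioo t t₂, Continuous fun x => slope (ψ x) t s := by
      intro s hs
      simp only [slope_def_field]
      exact ((hψx s ⟨ht.1.trans hs.1.le, hs.2.le⟩).sub (hψx t htI)).div_const _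
    have hslsupp : ∀ s ∈ Ioo t t₂, ∀ x ∉ closedBall x₀ r, slope (ψ x) t s = 0 := by
      intro s hs x hx
      rw [slope_def_field, hψ.supp x hx s ⟨ht.1.trans hs.1.le, hs.2.le⟩, hψ.supp x hx t htI]
      simp
    have lim1 : Tendsto (fun s => ∫ x, e s x * ψ x s) (𝓝[>] t) (𝓝 (∫ x, L x * ψ x t)) := by
      refine tendsto_integral_filter_of_dominated_convergence
        ((closedBall x₀ r).indicator fun _ => (max |A| |B|) * C) ?_ ?_ ?_ ?_
      · filter_upwards [hIoo] with s hs
        exact (((hsl s hs).min hLc).mul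
          (hψx s ⟨ht.1.trans hs.1.le, hs.2.le⟩)).aestronglyMeasurable
      · filter_upwards [hIoo] with s hs
        have hsI : s ∈ Icc t₁ t₂ := ⟨ht.1.trans hs.1.le, hs.2.le⟩
        refine Eventually.of_forall fun x => ?_
        by_cases hx : x ∈ closedBall x₀ r
        · simp only [hx, indicator_of_mem, norm_mul, Real.norm_eq_abs]
          refine mul_le_mul ?_ (hψ.le x s hsI) (abs_nonneg _) (by positivity)
          have h1 := hA s ⟨hs.1.le, hs.2.le⟩ x hx
          have h2 : -A ≤ slope (w x) t s := by
            rw [slope_def_field, le_div_iff₀ (by linarith [hs.1])]; linarith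
          have h3 := abs_le.1 (hB x hx)
          have h4 := le_abs_self A
          have h5 := le_abs_self B
          have h6 := le_max_left |A| |B|
          have h7 := le_max_right |A| |B|
          rw [abs_le]
          exact ⟨le_min (by linarith) (by linarith), (min_le_right _ _).trans (by linarith)⟩
        · simp [hx, hψ.supp x hx s hsI]
      · exact (integrable_indicator_iff measurableSet_closedBall).2
          (integrableOn_const (hs := (isCompact_closedBall x₀ r).measure_lt_top.ne))
      · refine Eventually.of_forall fun x => ?_
        by_cases hx : x ∈ closedBall x₀ r
        · have h1 : Tendsto (slope (w x) t) (𝓝[>] t) (𝓝 (deriv (w x) t)) :=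
            (hasDerivAt_iff_tendsto_slope.1 (hw.dt x t htI).hasDerivAt).mono_left
              (nhdsWithin_mono _ fun s hs => ne_of_gt hs)
          have h2 : min (deriv (w x) t) (L x) = L x := min_eq_right (hw.ineq x (hsub hx) t htI)
          have h3 := (h1.min (tendsto_const_nhds (x := L x)))
          rw [h2] at h3
          exact h3.mul ((hψ.hd x t htI).continuousAt.mono_left nhdsWithin_le_nhds)
        · refine tendsto_const_nhds.congr' ?_
          filter_upwards [hIoo] with s hs
          simp [hψ.supp x hx s ⟨ht.1.trans hs.1.le, hs.2.le⟩, hψ.supp x hx t htI]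
    have lim2 : Tendsto (fun s => ∫ x, w x t * slope (ψ x) t s) (𝓝[>] t)
        (𝓝 (∫ x, w x t * ψ' x t)) := by
      refine tendsto_integral_filter_of_dominated_convergence
        ((closedBall x₀ r).indicator fun _ => M * C) ?_ ?_ ?_ ?_
      · filter_upwards [hIoo] with s hs
        exact ((hwx t htI).mul (hslψ s hs)).aestronglyMeasurable
      · filter_upwards [hIoo] with s hs
        refine Eventually.of_forall fun x => ?_
        by_cases hx : x ∈ closedBall x₀ r
        · simp only [hx, indicator_of_mem, norm_mul, Real.norm_eq_abs]
          have hM' := hM x (hsub hx) t htI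
          refine mul_le_mul hM' ?_ (abs_nonneg _) ((abs_nonneg _).trans hM')
          have := (convex_Icc t s).norm_image_sub_le_of_norm_hasDerivWithin_le
            (f := ψ x) (f' := ψ' x) (C := C)
            (fun z hz => (hψ.hd x z ⟨ht.1.trans hz.1, hz.2.trans hs.2.le⟩).hasDerivWithinAt)
            (fun z hz => hψ.le' x z ⟨ht.1.trans hz.1, hz.2.trans hs.2.le⟩)
            (left_mem_Icc.2 hs.1.le) (right_mem_Icc.2 hs.1.le)
          have hpos : 0 < |s - t| := abs_pos.2 (by linarith [hs.1] : 0 < s - t).ne'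
          rw [slope_def_field, abs_div, div_le_iff₀ hpos]
          exact this
        · simp [hx, hslsupp s hs x hx]
      · exact (integrable_indicator_iff measurableSet_closedBall).2
          (integrableOn_const (hs := (isCompact_closedBall x₀ r).measure_lt_top.ne))
      · refine Eventually.of_forall fun x => ?_
        exact ((hasDerivAt_iff_tendsto_slope.1 (hψ.hd x t htI)).mono_left
              (nhdsWithin_mono _ fun s hs => ne_of_gt hs)).const_mul _
    have hlim : (∫ x, L x * ψ x t) + ∫ x, w x t * ψ' x t = weakRate w g ψ ψ' t := by
      have hsψ : HasCompactSupport fun x => ψ x t :=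
        HasCompactSupport.intro (isCompact_closedBall x₀ r) fun x hx => hψ.supp x hx t htI
      have e1 : ∫ x, L x * ψ x t
          = (∫ x, lap (fun y => w y t) x * ψ x t) + ∫ x, g x t * ψ x t := by
        rw [← integral_add]
        · simp only [hLdef, add_mul]
        · exact ((continuous_lap (hw.c2 t htI)).mul
            (hψx t htI)).integrable_of_hasCompactSupport hsψ.mul_left
        · exact ((hgx t htI).mul (hψx t htI)).integrable_of_hasCompactSupport hsψ.mul_left
      rw [e1, integral_lap_mul (hw.c2 t htI) (hψ.c2 t htI) hsψ, weakRate]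
      ring
    have hev := (lim1.add lim2).eventually (lt_mem_nhds (hlim ▸ hc))
    filter_upwards [hev, hIoo] with s hs1 hs
    refine hs1.trans_le ?_
    have hsI : s ∈ Icc t₁ t₂ := ⟨ht.1.trans hs.1.le, hs.2.le⟩
    have hst : 0 < s - t := by linarith [hs.1]
    have i1 : Integrable fun x => e s x * ψ x s :=
      integrable_of_support (x₀ := x₀) (r := r) (((hsl s hs).min hLc).mul (hψx s hsI))
        fun x hx => by simp [hψ.supp x hx s hsI]
    have i2 : Integrable fun x => w x t * slope (ψ x) t s :=
      integrable_of_support (x₀ := x₀) (r := r) ((hwx t htI).mul (hslψ s hs)) fun x hx => by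
          simp [hslsupp s hs x hx]
    rw [slope_def_field, le_div_iff₀ hst, ← integral_add i1 i2, ← integral_mul_const, hh]
    simp only
    rw [← integral_sub (hint s hsI) (hint t htI)]
    refine integral_mono ((i1.add i2).mul_const _) ((hint s hsI).sub (hint t htI)) fun x => ?_
    have h1 : e s x * ψ x s ≤ slope (w x) t s * ψ x s :=
      mul_le_mul_of_nonneg_right (min_le_left _ _) (hψ.nonneg x s hsI)
    have h2 : (slope (w x) t s * ψ x s + w x t * slope (ψ x) t s) * (s - t)
        = w x s * ψ x s - w x t * ψ x t := by
      rw [slope_def_field, slope_def_field]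
      field_simp
      ring
    calc (e s x * ψ x s + w x t * slope (ψ x) t s) * (s - t)
        ≤ (slope (w x) t s * ψ x s + w x t * slope (ψ x) t s) * (s - t) := by gcongr
      _ = _ := h2
  have hB : ∀ t ∈ Ico t₁ t₂, HasDerivWithinAt
      (fun t => - h t₁ - ∫ s in t₁..t, weakRate w g ψ ψ' s) (- weakRate w g ψ ψ' t) (Ici t) t := by
    intro t ht
    have hsub2 : Icc t₁ t ⊆ Icc t₁ t₂ := Icc_subset_Icc_right ht.2.le
    have h1 : HasDerivWithinAt (fun t => ∫ s in t₁..t, weakRate w g ψ ψ' s)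
        (weakRate w g ψ ψ' t) (Ici t) t := by
      refine intervalIntegral.integral_hasDerivWithinAt_right ?_
        (s := Ici t) (t := Ioi t) ?_ ?_
      · exact ((hrc.mono hsub2).intervalIntegrable_of_Icc ht.1)
      · refine ⟨Icc t t₂, ?_, ?_⟩
        · exact mem_of_superset (Ioo_mem_nhdsGT ht.2) Ioo_subset_Icc_self
        · exact (hrc.mono (Icc_subset_Icc_left ht.1)).aestronglyMeasurable measurableSet_Icc
      · exact (hrc t ⟨ht.1, ht.2.le⟩).mono_of_mem_nhdsWithin
          (mem_of_superset (Ioo_mem_nhdsGT ht.2) fun s hs => ⟨ht.1.trans hs.1.le, hs.2.le⟩)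
    exact h1.const_sub _
  have := image_le_of_liminf_slope_right_le_deriv_boundary (f := fun t => - h t)
    (a := t₁) (b := t₂) (B := fun t => - h t₁ - ∫ s in t₁..t, weakRate w g ψ ψ' s)
    (B' := fun t => - weakRate w g ψ ψ' t)
    hhc.neg (by simp) ?_ hB ?_ (right_mem_Icc.2 h12)
  · simp only [hh] at this
    linarith
  · exact continuousOn_const.sub
      (intervalIntegral.continuousOn_primitive_interval' (hrc.intervalIntegrable_of_Icc h12)
        (left_mem_uIcc) |>.mono (by rw [uIcc_of_le h12]))
  · intro t ht c hc
    refine Eventually.frequently ?_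
    filter_upwards [dini t ht (-c) (by linarith)] with s hs
    have : slope (fun t => - h t) t s = - slope h t s := by
      simp only [slope_def_field]; ring
    rw [this]; linarith

end weak

/-- The heat kernel. -/
noncomputable def heat {N : ℕ} (τ : ℝ) (z : Eu N) : ℝ :=
  (4 * π * τ) ^ (-(N : ℝ) / 2) * rexp (-(1 / (4 * τ)) * ‖z‖ ^ 2)

/-- The time derivative of the heat kernel. -/
noncomputable def heatDot {N : ℕ} (τ : ℝ) (z : Eu N) : ℝ :=
  heat τ z * (‖z‖ ^ 2 / (4 * τ ^ 2) - N / (2 * τ))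

section heat

variable {N : ℕ} {τ : ℝ} {z : Eu N}

theorem heat_pos (hτ : 0 < τ) : 0 < heat τ z := by unfold heat; positivity

theorem hasDerivAt_heat (hτ : 0 < τ) : HasDerivAt (fun s => heat s z) (heatDot τ z) τ := by
  unfold heatDot heat
  have h1 : HasDerivAt (fun s : ℝ => 4 * π * s) (4 * π) τ := by
    simpa using (hasDerivAt_id τ).const_mul (4 * π)
  have h2 := h1.rpow_const (p := -(N : ℝ) / 2) (Or.inl (by positivity))
  have h3 : HasDerivAt (fun s : ℝ => -(1 / (4 * s)) * ‖z‖ ^ 2) (1 / (4 * τ ^ 2) * ‖z‖ ^ 2) τ := by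
    have : HasDerivAt (fun s : ℝ => -(1 / (4 * s))) (1 / (4 * τ ^ 2)) τ := by
      have h4 : HasDerivAt (fun s : ℝ => 4 * s) 4 τ := by
        simpa using (hasDerivAt_id τ).const_mul 4
      have h5 := (h4.inv (by positivity)).neg
      simp only [one_div]
      convert! h5 using 1
      field_simp
    exact this.mul_const _
  convert! h2.mul h3.exp using 1
  rw [rpow_sub_one (by positivity)]
  field_simp
  ring

theorem contDiff_heat {n : WithTop ℕ∞} : ContDiff ℝ n (fun z : Eu N => heat τ z) := by
  unfold heat
  exact contDiff_const.mul ((contDiff_const.mul (contDiff_norm_sq ℝ)).exp)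

theorem pd_heat (i : Fin N) : pd i (fun z : Eu N => heat τ z) z = -(z i / (2 * τ)) * heat τ z := by
  unfold heat
  have hd : DifferentiableAt ℝ (fun z : Eu N => -(1 / (4 * τ)) * ‖z‖ ^ 2) z :=
    ((contDiff_const.mul (contDiff_norm_sq ℝ)).differentiable (n := 1) (by norm_num)) z
  rw [pd_const_mul _ hd.exp, pd_comp (Φ := rexp) differentiableAt_exp hd,
    pd_const_mul _ ((contDiff_norm_sq ℝ).differentiable (n := 1) (by norm_num) z), pd_normSq,
    Real.deriv_exp]
  rcases eq_or_ne τ 0 with rfl | h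
  · simp
  · field_simp; ring

theorem sum_pd_heat_sq : ∑ i, pd i (fun z : Eu N => heat τ z) z ^ 2
    = heat τ z ^ 2 * (‖z‖ ^ 2 / (4 * τ ^ 2)) := by
  simp_rw [pd_heat]
  rw [← sum_coord_sq, Finset.sum_div, Finset.mul_sum]
  refine Finset.sum_congr rfl fun i _ => ?_
  ring

theorem lap_heat (hτ : 0 < τ) : lap (fun z : Eu N => heat τ z) z = heatDot τ z := by
  have hq : ContDiff ℝ 2 (fun z : Eu N => ‖z‖ ^ 2) := contDiff_norm_sq ℝ
  have hΦ : ContDiff ℝ 2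
      (fun q : ℝ => (4 * π * τ) ^ (-(N : ℝ) / 2) * rexp (-(1 / (4 * τ)) * q)) := by fun_prop
  have h := lap_comp (x := z) hΦ hq
  have d1 : deriv (fun q : ℝ => (4 * π * τ) ^ (-(N : ℝ) / 2) * rexp (-(1 / (4 * τ)) * q))
      = fun q => -(1 / (4 * τ)) * ((4 * π * τ) ^ (-(N : ℝ) / 2) * rexp (-(1 / (4 * τ)) * q)) := by
    funext q
    have h1 : HasDerivAt (fun q : ℝ => -(1 / (4 * τ)) * q) (-(1 / (4 * τ))) q := by
      simpa using (hasDerivAt_id q).const_mul (-(1 / (4 * τ)))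
    rw [(h1.exp.const_mul _).deriv]; ring
  rw [d1, deriv_const_mul_field, d1] at h
  change lap (fun y : Eu N => heat τ y) z = _ at h
  rw [h, lap_normSq]
  simp_rw [pd_normSq, mul_pow, ← Finset.mul_sum, sum_coord_sq]
  unfold heatDot heat
  field_simp
  ring

theorem integral_heat (hτ : 0 < τ) : ∫ z : Eu N, heat τ z = 1 := by
  unfold heat
  rw [integral_const_mul, GaussianFourier.integral_rexp_neg_mul_sq_norm (by positivity)]
  have : π / (1 / (4 * τ)) = 4 * π * τ := by field_simp
  rw [this, finrank_euclideanSpace_fin, ← rpow_add (by positivity)]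
  ring_nf
  simp

theorem integrable_heat (hτ : 0 < τ) : Integrable fun z : Eu N => heat τ z :=
  integrable_of_integral_eq_one (integral_heat hτ)

theorem heat_eq_scale (hτ : 0 < τ) :
    heat τ z = (√τ)⁻¹ ^ N * heat 1 ((√τ)⁻¹ • z) := by
  unfold heat
  have h1 : (4 * π * τ) ^ (-(N : ℝ) / 2) = (√τ)⁻¹ ^ N * (4 * π * 1) ^ (-(N : ℝ) / 2) := by
    rw [mul_rpow (by positivity) hτ.le, mul_one, mul_comm, ← sqrt_inv, sqrt_eq_rpow,
      ← rpow_natCast, ← rpow_mul (by positivity), inv_rpow hτ.le, ← rpow_neg hτ.le]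
    ring_nf
  have h2 : (√τ)⁻¹ ^ 2 = τ⁻¹ := by rw [inv_pow, sq_sqrt hτ.le]
  rw [h1, norm_smul, norm_inv, Real.norm_eq_abs, abs_of_nonneg (sqrt_nonneg τ),
    mul_pow (√τ)⁻¹ ‖z‖, h2, mul_assoc]
  congr 3
  field_simp

theorem mul_exp_neg_le {b x : ℝ} (hb : 0 < b) : x * rexp (-(b * x)) ≤ 1 / b := by
  have h1 := add_one_le_exp (b * x)
  rw [exp_neg, ← div_eq_mul_inv, div_le_div_iff₀ (exp_pos _) hb]
  nlinarith

/-- Off-diagonal bounds for the heat kernel, uniform in time. -/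
theorem exists_heat_bound (N : ℕ) {ρ : ℝ} (hρ : 0 < ρ) :
    ∃ C : ℝ, 0 < C ∧ ∀ τ > 0, ∀ z : Eu N, ρ ≤ ‖z‖ → heat τ z * (1 + 1 / τ) ≤ C := by
  refine ⟨4 * (1 + 1 / (ρ ^ 2 / (N + 1))) ^ (N + 1), by positivity, fun τ hτ z hz => ?_⟩
  set x := 1 / (4 * τ) with hx
  have hx0 : 0 < x := by positivity
  have h1 : heat τ z ≤ (1 + x) ^ N * rexp (-(x * ρ ^ 2)) := by
    unfold heat
    rw [← hx]
    refine mul_le_mul ?_ ?_ (exp_pos _).le (by positivity)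
    · have e : (4 * π * τ) = (x / π)⁻¹ := by rw [hx]; field_simp
      rw [e, inv_rpow (by positivity), ← rpow_neg (by positivity)]
      calc (x / π) ^ (-(-(N : ℝ) / 2)) ≤ (1 + x) ^ (-(-(N : ℝ) / 2)) := by
            refine rpow_le_rpow (by positivity) ?_ (by rw [neg_div, neg_neg]; positivity)
            have : x / π ≤ x := div_le_self hx0.le (by linarith [pi_gt_three])
            linarith
        _ ≤ (1 + x) ^ (N : ℝ) := by
            refine rpow_le_rpow_of_exponent_le (by linarith) ?_
            have : (0 : ℝ) ≤ N := Nat.cast_nonneg N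
            linarith
        _ = _ := rpow_natCast _ _
    · rw [exp_le_exp]
      have : ρ ^ 2 ≤ ‖z‖ ^ 2 := pow_le_pow_left₀ hρ.le hz 2
      nlinarith
  have h2 : 1 + 1 / τ ≤ 4 * (1 + x) := by
    have : 1 / τ = 4 * x := by rw [hx]; field_simp
    rw [this]; linarith
  have hb : 0 < ρ ^ 2 / (N + 1) := by positivity
  have h3 : (1 + x) * rexp (-(ρ ^ 2 / (N + 1) * x)) ≤ 1 + 1 / (ρ ^ 2 / (N + 1)) := by
    have := mul_exp_neg_le (x := x) hb
    have h4 : rexp (-(ρ ^ 2 / (N + 1) * x)) ≤ 1 := by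
      rw [exp_le_one_iff]; have := mul_pos hb hx0; linarith
    linarith
  have h4 : rexp (-(x * ρ ^ 2)) = rexp (-(ρ ^ 2 / (N + 1) * x)) ^ (N + 1) := by
    rw [← exp_nat_mul]; congr 1; push_cast; field_simp
  calc heat τ z * (1 + 1 / τ)
      ≤ ((1 + x) ^ N * rexp (-(x * ρ ^ 2))) * (4 * (1 + x)) := by
        gcongr
    _ = 4 * ((1 + x) * rexp (-(ρ ^ 2 / (N + 1) * x))) ^ (N + 1) := by
        rw [h4, mul_pow, pow_succ (1 + x)]; ring
    _ ≤ _ := by gcongr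

theorem heat_le {N : ℕ} {τ : ℝ} (hτ : 0 < τ) (z : Eu N) :
    heat τ z ≤ (4 * π * τ) ^ (-(N : ℝ) / 2) := by
  unfold heat
  refine mul_le_of_le_one_right (by positivity) ?_
  rw [exp_le_one_iff]
  have : 0 ≤ 1 / (4 * τ) * ‖z‖ ^ 2 := by positivity
  linarith

theorem heat_le_one {N : ℕ} {τ : ℝ} (hτ : 1 / 4 ≤ τ) (z : Eu N) : heat τ z ≤ 1 := by
  refine (heat_le (by linarith) z).trans ?_
  refine rpow_le_one_of_one_le_of_nonpos (by nlinarith [pi_gt_three]) ?_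
  have : (0 : ℝ) ≤ N := Nat.cast_nonneg N
  linarith

theorem tendsto_heat_zero {z : Eu N} (hz : z ≠ 0) :
    Tendsto (fun τ => heat τ z) (𝓝[>] 0) (𝓝 0) := by
  obtain ⟨C, hC, h⟩ := exists_heat_bound N (norm_pos_iff.2 hz)
  have h0 : Tendsto (fun τ : ℝ => C * τ) (𝓝[>] 0) (𝓝 0) := by
    have : Tendsto (fun τ : ℝ => C * τ) (𝓝 0) (𝓝 (C * 0)) := (continuous_const_mul C).tendsto 0
    simpa using this.mono_left nhdsWithin_le_nhds
  refine tendsto_of_tendsto_of_tendsto_of_le_of_le' tendsto_const_nhds h0 ?_ ?_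
  · filter_upwards [self_mem_nhdsWithin] with τ hτ using (heat_pos hτ).le
  · filter_upwards [self_mem_nhdsWithin] with τ hτ
    have hτ : 0 < τ := hτ
    have := h τ hτ z le_rfl
    have h2 : heat τ z * (1 / τ) ≤ C := by
      have := heat_pos (z := z) hτ; linarith
    rwa [mul_one_div, div_le_iff₀ hτ] at h2

theorem tendsto_integral_heat {g : Eu N → ℝ} (hg : Integrable g) (y : Eu N)
    (hc : ContinuousAt g y) :
    Tendsto (fun τ => ∫ z, heat τ (z - y) * g z) (𝓝[>] 0) (𝓝 (g y)) := by
  have hcob : Tendsto (fun x : Eu N => ‖x‖ ^ Module.finrank ℝ (Eu N) * heat 1 x)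
      (Bornology.cobounded (Eu N)) (𝓝 0) := by
    have h1 : Tendsto (fun s : ℝ => s ^ (N : ℝ) * rexp (-(1 / 4) * s)) atTop (𝓝 0) :=
      tendsto_rpow_mul_exp_neg_mul_atTop_nhds_zero _ _ (by norm_num)
    have h2 := h1.const_mul ((4 * π * 1) ^ (-(N : ℝ) / 2))
    rw [mul_zero] at h2
    have h3 := h2.comp (tendsto_norm_cobounded_atTop (E := Eu N))
    refine squeeze_zero' (Eventually.of_forall fun x => ?_) ?_ h3
    · have := heat_pos (z := x) one_pos; positivity
    · have : ∀ᶠ x : Eu N in Bornology.cobounded (Eu N), 1 ≤ ‖x‖ :=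
        (tendsto_norm_cobounded_atTop (E := Eu N)).eventually_ge_atTop 1
      filter_upwards [this] with x hx
      simp only [Function.comp, heat, finrank_euclideanSpace_fin, rpow_natCast]
      rw [mul_left_comm]
      have h5 : rexp (-(1 / (4 * 1)) * ‖x‖ ^ 2) ≤ rexp (-(1 / 4) * ‖x‖) := by
        rw [exp_le_exp]; nlinarith
      exact mul_le_mul_of_nonneg_left (mul_le_mul_of_nonneg_left h5 (by positivity))
        (by positivity)
  have h := tendsto_integral_comp_smul_smul_of_integrable' (μ := volume) (φ := heat (N := N) 1)
    (fun x => (heat_pos one_pos).le) (integral_heat one_pos) hcob hg hc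
  have hs : Tendsto (fun τ : ℝ => (√τ)⁻¹) (𝓝[>] 0) atTop := by
    refine tendsto_inv_nhdsGT_zero.comp ?_
    refine tendsto_nhdsWithin_iff.2 ⟨?_, ?_⟩
    · have : Tendsto (fun τ : ℝ => √τ) (𝓝 0) (𝓝 √0) := continuous_sqrt.tendsto 0
      rw [sqrt_zero] at this
      exact this.mono_left nhdsWithin_le_nhds
    · filter_upwards [self_mem_nhdsWithin] with τ hτ using sqrt_pos.2 hτ
  refine (h.comp hs).congr' ?_
  filter_upwards [self_mem_nhdsWithin] with τ hτ
  refine integral_congr_ae (Eventually.of_forall fun z => ?_)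
  simp only [finrank_euclideanSpace_fin, smul_eq_mul]
  rw [← heat_eq_scale hτ]
  simp only [heat, norm_sub_rev]

theorem continuousOn_heat (y : Eu N) (s₀ : ℝ) :
    ContinuousOn (fun p : Eu N × ℝ => heat (s₀ - p.2) (p.1 - y)) {p | p.2 < s₀} := by
  unfold heat
  have h : ∀ p : Eu N × ℝ, p ∈ {p : Eu N × ℝ | p.2 < s₀} → 0 < s₀ - p.2 := fun p hp => sub_pos.2 hp
  refine ContinuousOn.mul (ContinuousOn.rpow_const (by fun_prop) fun p hp => Or.inl ?_)
    (ContinuousOn.rexp (ContinuousOn.mul (ContinuousOn.neg (ContinuousOn.div (by fun_prop)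
      (by fun_prop) fun p hp => ?_)) (by fun_prop)))
  · have := h p hp; positivity
  · have := h p hp; positivity

theorem continuousOn_heatDot (y : Eu N) (s₀ : ℝ) :
    ContinuousOn (fun p : Eu N × ℝ => heatDot (s₀ - p.2) (p.1 - y)) {p | p.2 < s₀} := by
  unfold heatDot
  have h : ∀ p : Eu N × ℝ, p ∈ {p : Eu N × ℝ | p.2 < s₀} → 0 < s₀ - p.2 := fun p hp => sub_pos.2 hp
  refine (continuousOn_heat y s₀).mul (ContinuousOn.sub (ContinuousOn.div (by fun_prop)
      (by fun_prop) fun p hp => ?_) (ContinuousOn.div (by fun_prop)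
      (by fun_prop) fun p hp => ?_))
  · have := h p hp; positivity
  · have := h p hp; positivity

end heat

/-- A smooth convex approximation of `s ↦ max (s - κ) 0`. -/
noncomputable def ramp (κ s : ℝ) : ℝ := ∫ σ in (0 : ℝ)..s, Real.smoothTransition ((σ - κ) / κ)

section ramp

variable {κ s : ℝ}

theorem continuous_rampDeriv : Continuous fun σ : ℝ => Real.smoothTransition ((σ - κ) / κ) :=
  Real.smoothTransition.continuous.comp (by fun_prop)

theorem hasDerivAt_ramp : HasDerivAt (ramp κ) (Real.smoothTransition ((s - κ) / κ)) s :=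
  intervalIntegral.integral_hasDerivAt_right (continuous_rampDeriv.intervalIntegrable _ _)
    (continuous_rampDeriv.stronglyMeasurableAtFilter _ _) continuous_rampDeriv.continuousAt

theorem deriv_ramp : deriv (ramp κ) = fun s => Real.smoothTransition ((s - κ) / κ) :=
  funext fun _ => hasDerivAt_ramp.deriv

theorem contDiff_ramp : ContDiff ℝ 2 (ramp κ) := by
  rw [show (2 : WithTop ℕ∞) = 1 + 1 by norm_num, contDiff_succ_iff_deriv]
  refine ⟨fun s => hasDerivAt_ramp.differentiableAt, by simp, ?_⟩
  rw [deriv_ramp]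
  exact Real.smoothTransition.contDiff.comp (by fun_prop)

theorem deriv_deriv_ramp_nonneg (hκ : 0 < κ) : 0 ≤ deriv (deriv (ramp κ)) s := by
  have : Monotone (deriv (ramp κ)) := by
    rw [deriv_ramp]
    intro a b hab
    exact Real.smoothTransition.monotone (by gcongr)
  exact this.deriv_nonneg

theorem ramp_eq_zero (hκ : 0 < κ) (hs : s ≤ κ) : ramp κ s = 0 := by
  unfold ramp
  rw [intervalIntegral.integral_congr (g := fun _ => (0 : ℝ))]
  · simp
  · intro σ hσ
    refine Real.smoothTransition.zero_of_nonpos (div_nonpos_of_nonpos_of_nonneg ?_ hκ.le)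
    have : σ ≤ max 0 s := hσ.2
    have : max 0 s ≤ κ := max_le hκ.le hs
    linarith

theorem ramp_nonneg (hs : 0 ≤ s) : 0 ≤ ramp κ s :=
  intervalIntegral.integral_nonneg hs fun _ _ => Real.smoothTransition.nonneg _

theorem ramp_le (hs : 0 ≤ s) : ramp κ s ≤ s := by
  have := intervalIntegral.integral_mono_on (μ := volume) hs
      ((continuous_rampDeriv (κ := κ)).intervalIntegrable 0 s)
    (intervalIntegrable_const (c := (1 : ℝ))) fun _ _ => Real.smoothTransition.le_one _
  simpa [ramp] using this

theorem le_ramp (hκ : 0 < κ) (hs : 0 ≤ s) : s - 2 * κ ≤ ramp κ s := by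
  rcases le_or_gt s (2 * κ) with h | h
  · linarith [ramp_nonneg (κ := κ) hs]
  · have h1 : ramp κ s = ramp κ (2 * κ) + ∫ σ in (2 * κ)..s, Real.smoothTransition ((σ - κ) / κ) :=
      (intervalIntegral.integral_add_adjacent_intervals
        (continuous_rampDeriv.intervalIntegrable _ _)
        (continuous_rampDeriv.intervalIntegrable _ _)).symm
    have h2 : ∫ σ in (2 * κ)..s, Real.smoothTransition ((σ - κ) / κ) =
        ∫ σ in (2 * κ)..s, (1 : ℝ) := by
      refine intervalIntegral.integral_congr fun σ hσ => ?_
      rw [uIcc_of_le h.le] at hσ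
      refine Real.smoothTransition.one_of_one_le ?_
      rw [le_div_iff₀ hκ]; linarith [hσ.1]
    rw [h1, h2]
    have := ramp_nonneg (κ := κ) (s := 2 * κ) (by positivity)
    simp; linarith

end ramp

section tests

variable {N : ℕ}

/-- Continuous data vanishing outside a closed ball form a test function. -/
theorem exists_test {ψ ψ' Lp : Eu N → ℝ → ℝ} {x₀ : Eu N} {r t₁ t₂ : ℝ}
    (hψ : ContinuousOn (fun p : Eu N × ℝ => ψ p.1 p.2) (univ ×ˢ Icc t₁ t₂))
    (hψ' : ContinuousOn (fun p : Eu N × ℝ => ψ' p.1 p.2) (univ ×ˢ Icc t₁ t₂))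
    (hLp : ContinuousOn (fun p : Eu N × ℝ => Lp p.1 p.2) (univ ×ˢ Icc t₁ t₂))
    (nonneg : ∀ x, ∀ t ∈ Icc t₁ t₂, 0 ≤ ψ x t)
    (c2 : ∀ t ∈ Icc t₁ t₂, ContDiff ℝ 2 (fun x => ψ x t))
    (supp : ∀ x ∉ closedBall x₀ r, ∀ t ∈ Icc t₁ t₂, ψ x t = 0)
    (supp' : ∀ x ∉ closedBall x₀ r, ∀ t ∈ Icc t₁ t₂, ψ' x t = 0)
    (hd : ∀ x, ∀ t ∈ Icc t₁ t₂, HasDerivAt (ψ x) (ψ' x t) t)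
    (hlap : ∀ x, ∀ t ∈ Icc t₁ t₂, lap (fun y => ψ y t) x = Lp x t) :
    ∃ C, Test ψ ψ' x₀ r C (Icc t₁ t₂) := by
  have hK : IsCompact (closedBall x₀ r ×ˢ Icc t₁ t₂) :=
    (isCompact_closedBall _ _).prod isCompact_Icc
  have hsub : closedBall x₀ r ×ˢ Icc t₁ t₂ ⊆ univ ×ˢ Icc t₁ t₂ := prod_mono_left (subset_univ _)
  obtain ⟨A, hA⟩ := hK.exists_bound_of_continuousOn (hψ.mono hsub)
  obtain ⟨A', hA'⟩ := hK.exists_bound_of_continuousOn (hψ'.mono hsub)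
  obtain ⟨B, hB⟩ := hK.exists_bound_of_continuousOn (hLp.mono hsub)
  have key : ∀ q : Eu N → ℝ → ℝ, ∀ D : ℝ, |D| ≤ |A| + |A'| + |B| →
      (∀ p ∈ closedBall x₀ r ×ˢ Icc t₁ t₂, ‖q p.1 p.2‖ ≤ D) →
      (∀ x ∉ closedBall x₀ r, ∀ t ∈ Icc t₁ t₂, q x t = 0) →
      ∀ x, ∀ t ∈ Icc t₁ t₂, |q x t| ≤ |A| + |A'| + |B| := by
    intro q D hD h1 h2 x t ht
    by_cases hx : x ∈ closedBall x₀ r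
    · exact ((h1 (x, t) ⟨hx, ht⟩).trans (le_abs_self _)).trans hD
    · rw [h2 x hx t ht, abs_zero]; positivity
  have sec : ∀ q : Eu N → ℝ → ℝ, ContinuousOn (fun p : Eu N × ℝ => q p.1 p.2) (univ ×ˢ Icc t₁ t₂) →
      ∀ x, ContinuousOn (q x) (Icc t₁ t₂) := fun q hq x =>
    hq.comp (f := fun t => (x, t)) (by fun_prop) fun t ht => ⟨mem_univ _, ht⟩
  refine ⟨|A| + |A'| + |B|, nonneg, c2, supp, supp', hd, key ψ A ?_ hA supp, key ψ' A' ?_ hA' supp',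
    fun x t ht => ?_, fun x => (sec Lp hLp x).congr fun t ht => hlap x t ht, sec ψ' hψ', ?_⟩
  · linarith [abs_nonneg A', abs_nonneg B]
  · linarith [abs_nonneg A, abs_nonneg B]
  · rw [hlap x t ht]
    refine key Lp B (by linarith [abs_nonneg A, abs_nonneg A']) hB (fun y hy s hs => ?_) x t ht
    rw [← hlap y s hs]
    exact lap_eq_zero_of_eqOn isClosed_closedBall (fun z hz => supp z hz s hs) y hy
  · intro t ht
    have := hψ'.comp (f := fun x : Eu N => (x, t)) (s := univ) (by fun_prop)
      fun x _ => ⟨mem_univ _, ht⟩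
    exact continuousOn_univ.1 this

/-- Truncated heat kernels form an approximate identity. -/
theorem tendsto_truncated_heat (hN : 0 < N) {ψ : ℝ → Eu N → ℝ} {w : Eu N → ℝ} {y : Eu N} {ρ C : ℝ}
    (hρ : 0 < ρ) (h0 : ∀ δ > 0, ∀ z, 0 ≤ ψ δ z) (hle : ∀ δ > 0, ∀ z, ψ δ z ≤ heat δ (z - y))
    (hC : ∀ δ > 0, ∀ z, heat δ (z - y) - ψ δ z ≤ C)
    (hs : ∀ δ > 0, ∀ z ∉ closedBall y ρ, ψ δ z = 0) (hc : ∀ δ > 0, Continuous (ψ δ))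
    (hw : Continuous w) :
    Tendsto (fun δ => ∫ z, w z * ψ δ z) (𝓝[>] 0) (𝓝 (w y)) := by
  have : Nonempty (Fin N) := ⟨⟨0, hN⟩⟩
  have hm : MeasurableSet (closedBall y ρ) := measurableSet_closedBall
  set g : Eu N → ℝ := (closedBall y ρ).indicator w with hg
  have hgi : Integrable g := (integrable_indicator_iff hm).2
    (hw.continuousOn.integrableOn_compact (isCompact_closedBall _ _))
  have hev : g =ᶠ[𝓝 y] w := by
    filter_upwards [closedBall_mem_nhds y hρ] with z hz using indicator_of_mem hz _
  have hgc : ContinuousAt g y := hw.continuousAt.congr hev.symm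
  have hgy : g y = w y := hev.eq_of_nhds
  have h1 := tendsto_integral_heat hgi y hgc
  rw [hgy] at h1
  have hcont : ∀ δ : ℝ, Continuous fun z : Eu N => heat δ (z - y) := fun δ =>
    (contDiff_heat (n := 0)).continuous.comp (by fun_prop)
  have habs : ∀ δ > 0, ∀ z, |heat δ (z - y) - ψ δ z| ≤ C := fun δ hδ z => by
    rw [abs_of_nonneg (sub_nonneg.2 (hle δ hδ z))]; exact hC δ hδ z
  have hmeas : ∀ δ > 0, AEStronglyMeasurable (fun z => (heat δ (z - y) - ψ δ z) * g z) :=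
    fun δ hδ => ((hcont δ).sub (hc δ hδ)).aestronglyMeasurable.mul hgi.aestronglyMeasurable
  have hbd : ∀ δ > 0, ∀ z, ‖(heat δ (z - y) - ψ δ z) * g z‖ ≤ C * |g z| := fun δ hδ z => by
    rw [norm_mul]; exact mul_le_mul_of_nonneg_right (habs δ hδ z) (abs_nonneg _)
  have h2 : Tendsto (fun δ => ∫ z, (heat δ (z - y) - ψ δ z) * g z) (𝓝[>] 0)
      (𝓝 (∫ _ : Eu N, (0 : ℝ))) := by
    refine tendsto_integral_filter_of_dominated_convergence (fun z => C * |g z|) ?_ ?_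
      (hgi.abs.const_mul C) ?_
    · filter_upwards [self_mem_nhdsWithin] with δ hδ using hmeas δ hδ
    · filter_upwards [self_mem_nhdsWithin] with δ hδ using Eventually.of_forall (hbd δ hδ)
    · have : ∀ᵐ z : Eu N, z ≠ y := by simp [ae_iff]
      filter_upwards [this] with z hz
      have h3 : Tendsto (fun δ => heat δ (z - y) - ψ δ z) (𝓝[>] 0) (𝓝 0) := by
        refine squeeze_zero' ?_ ?_ (tendsto_heat_zero (sub_ne_zero.2 hz))
        · filter_upwards [self_mem_nhdsWithin] with δ hδ using sub_nonneg.2 (hle δ hδ z)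
        · filter_upwards [self_mem_nhdsWithin] with δ hδ
          linarith [h0 δ hδ z]
      simpa using h3.mul_const (g z)
  rw [integral_zero] at h2
  have h4 := h1.sub h2
  rw [sub_zero] at h4
  refine h4.congr' ?_
  filter_upwards [self_mem_nhdsWithin] with δ hδ
  have hi2 : Integrable fun z => (heat δ (z - y) - ψ δ z) * g z :=
    Integrable.mono' (hgi.abs.const_mul C) (hmeas δ hδ) (Eventually.of_forall (hbd δ hδ))
  have hi3 : Integrable fun z => ψ δ z * g z := by
    have := integrable_of_support (x₀ := y) (r := ρ) ((hc δ hδ).mul hw)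
      (fun z hz => by simp [hs δ hδ z hz])
    refine this.congr (Eventually.of_forall fun z => ?_)
    by_cases hz : z ∈ closedBall y ρ
    · simp [hg, hz]
    · simp [hs δ hδ z hz]
  have hi1 : Integrable fun z => heat δ (z - y) * g z := by
    refine (hi2.add hi3).congr (Eventually.of_forall fun z => ?_)
    simp only [Pi.add_apply]; ring
  rw [← integral_sub hi1 hi2]
  refine integral_congr_ae (Eventually.of_forall fun z => ?_)
  by_cases hz : z ∈ closedBall y ρ
  · simp [hg, hz]; ring
  · simp [hs δ hδ z hz, hg, hz]

end tests

theorem pd_comp_sub {N : ℕ} (f : Eu N → ℝ) (i : Fin N) (y z : Eu N) :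
    pd i (fun x => f (x - y)) z = pd i f (z - y) := by
  simp only [pd]; rw [fderiv_comp_sub]

theorem lap_comp_sub {N : ℕ} (f : Eu N → ℝ) (y z : Eu N) :
    lap (fun x => f (x - y)) z = lap f (z - y) := by
  simp only [lap]; rw [iteratedFDeriv_comp_sub]

section kernel

variable {N : ℕ} {w : Eu N → ℝ → ℝ} {y : Eu N} {R ρ t₁ t₂ M κ : ℝ}

theorem hasDerivAt_heat_sub {s₀ t : ℝ} (ht : t < s₀) (z : Eu N) :
    HasDerivAt (fun s => heat (s₀ - s) z) (-heatDot (s₀ - t) z) t := by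
  have := (hasDerivAt_heat (z := z) (sub_pos.2 ht)).comp t ((hasDerivAt_id t).const_sub s₀)
  simpa [Function.comp_def] using this

theorem continuousOn_heat_mul {s₀ : ℝ} (h : t₂ < s₀) (y : Eu N) :
    ContinuousOn (fun p : Eu N × ℝ => heat (s₀ - p.2) (p.1 - y)) (univ ×ˢ Icc t₁ t₂) :=
  (continuousOn_heat y s₀).mono fun _ hp => lt_of_le_of_lt hp.2.2 h

theorem continuousOn_heatDot_mul {s₀ : ℝ} (h : t₂ < s₀) (y : Eu N) :
    ContinuousOn (fun p : Eu N × ℝ => heatDot (s₀ - p.2) (p.1 - y)) (univ ×ˢ Icc t₁ t₂) :=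
  (continuousOn_heatDot y s₀).mono fun _ hp => lt_of_le_of_lt hp.2.2 h

theorem contDiff_heat_sub (τ : ℝ) (y : Eu N) {n : WithTop ℕ∞} :
    ContDiff ℝ n (fun z : Eu N => heat τ (z - y)) :=
  contDiff_heat.comp (by fun_prop)

theorem tendsto_add_heat {τ : ℝ} (hτ : 0 < τ) (z : Eu N) :
    Tendsto (fun δ => heat (τ + δ) z) (𝓝[>] 0) (𝓝 (heat τ z)) := by
  have h1 : ContinuousAt (fun δ : ℝ => heat (τ + δ) z) 0 :=
    ContinuousAt.comp (g := fun τ => heat τ z) (f := fun δ : ℝ => τ + δ)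
      (by simpa using (hasDerivAt_heat hτ).continuousAt) (by fun_prop)
  have h2 := h1.tendsto
  simp only [add_zero] at h2
  exact h2.mono_left nhdsWithin_le_nhds

/-- Truncated heat kernels bound nonnegative supersolutions from below. -/
theorem lower_bound (hN : 0 < N) (hw : SuperOn w (fun _ _ => 0) y R (Icc t₁ t₂)) (h12 : t₁ < t₂)
    (hM : ∀ x ∈ ball y R, ∀ t ∈ Icc t₁ t₂, w x t ∈ Icc 0 M)
    (hL : ∀ x ∈ ball y R, ∀ t ∈ Ico t₁ t₂, RLsc w x t) (hρ : 0 < ρ) (hρR : ρ < R) (hκ : 0 < κ)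
    (hκ' : ∀ τ > 0, ∀ z : Eu N, ρ ≤ ‖z‖ → heat τ z ≤ κ) :
    ∫ z, w z t₁ * ramp κ (heat (t₂ - t₁) (z - y)) ≤ w y t₂ := by
  have hM' : ∀ x ∈ ball y R, ∀ t ∈ Icc t₁ t₂, |w x t| ≤ M := fun x hx t ht => by
    rw [abs_of_nonneg (hM x hx t ht).1]; exact (hM x hx t ht).2
  have hout : ∀ τ > 0, ∀ z ∉ closedBall y ρ, ramp κ (heat τ (z - y)) = 0 := by
    intro τ hτ z hz
    refine ramp_eq_zero hκ (hκ' τ hτ _ ?_)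
    rw [mem_closedBall, dist_eq_norm] at hz
    exact (not_le.1 hz).le
  have hrc : ∀ τ, Continuous fun z : Eu N => ramp κ (heat τ (z - y)) := fun τ =>
    contDiff_ramp.continuous.comp (contDiff_heat_sub (n := 0) τ y).continuous
  have main : ∀ δ > 0, ∫ z, w z t₁ * ramp κ (heat (t₂ - t₁ + δ) (z - y)) ≤
      ∫ z, w z t₂ * ramp κ (heat δ (z - y)) := by
    intro δ hδ
    set s₀ := t₂ + δ with hs₀
    have h2s : t₂ < s₀ := by linarith
    have hpos : ∀ t ∈ Icc t₁ t₂, 0 < s₀ - t := fun t ht => by linarith [ht.2]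
    set ψ : Eu N → ℝ → ℝ := fun z t => ramp κ (heat (s₀ - t) (z - y)) with hψdef
    set ψ' : Eu N → ℝ → ℝ := fun z t =>
      -(deriv (ramp κ) (heat (s₀ - t) (z - y)) * heatDot (s₀ - t) (z - y)) with hψ'def
    set P : Eu N → ℝ → ℝ := fun z t => deriv (deriv (ramp κ)) (heat (s₀ - t) (z - y)) *
      (heat (s₀ - t) (z - y) ^ 2 * (‖z - y‖ ^ 2 / (4 * (s₀ - t) ^ 2))) with hP
    have hKc := continuousOn_heat_mul (t₁ := t₁) h2s y
    have hDc := continuousOn_heatDot_mul (t₁ := t₁) h2s y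
    have c1 : Continuous (deriv (ramp κ)) := by rw [deriv_ramp]; exact continuous_rampDeriv
    have c2 : Continuous (deriv (deriv (ramp κ))) := by
      have h := contDiff_ramp (κ := κ)
      rw [show (2 : WithTop ℕ∞) = 1 + 1 by norm_num, contDiff_succ_iff_deriv] at h
      exact h.2.2.continuous_deriv le_rfl
    have hψ'c : ContinuousOn (fun p : Eu N × ℝ => ψ' p.1 p.2) (univ ×ˢ Icc t₁ t₂) :=
      ((c1.comp_continuousOn hKc).mul hDc).neg
    have hPc : ContinuousOn (fun p : Eu N × ℝ => P p.1 p.2) (univ ×ˢ Icc t₁ t₂) := by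
      refine (c2.comp_continuousOn hKc).mul ((hKc.pow 2).mul
        (ContinuousOn.div (by fun_prop) (by fun_prop) fun p hp => ?_))
      have := hpos p.2 hp.2; positivity
    have hlap : ∀ x, ∀ t ∈ Icc t₁ t₂, lap (fun z => ψ z t) x = -ψ' x t + P x t := by
      intro x t ht
      simp only [hψdef]
      rw [lap_comp contDiff_ramp (contDiff_heat_sub _ y), lap_comp_sub, lap_heat (hpos t ht)]
      simp_rw [pd_comp_sub]
      rw [sum_pd_heat_sq]
      simp only [hψ'def, hP]; ring
    obtain ⟨C, hT⟩ := exists_test (ψ := ψ) (ψ' := ψ') (Lp := fun x t => -ψ' x t + P x t) (x₀ := y)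
      (r := ρ) (t₁ := t₁) (t₂ := t₂) (contDiff_ramp.continuous.comp_continuousOn hKc) hψ'c
      (hψ'c.neg.add hPc) (fun x t ht => ramp_nonneg (heat_pos (hpos t ht)).le)
      (fun t _ => contDiff_ramp.comp (contDiff_heat_sub _ y))
          (fun x hx t ht => hout _ (hpos t ht) x hx)
      (fun x hx t ht => by
        have h1 : deriv (ramp κ) (heat (s₀ - t) (x - y)) = 0 := by
          rw [deriv_ramp]
          refine Real.smoothTransition.zero_of_nonpos (div_nonpos_of_nonpos_of_nonneg ?_ hκ.le)
          rw [mem_closedBall, dist_eq_norm] at hx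
          exact sub_nonpos.2 (hκ' _ (hpos t ht) _ (not_le.1 hx).le)
        simp [hψ'def, h1])
      (fun x t ht => by
        have h1 := hasDerivAt_heat_sub (lt_of_le_of_lt ht.2 h2s) (x - y)
        have h2 := (hasDerivAt_ramp (κ := κ) (s := heat (s₀ - t) (x - y))).comp t h1
        simp only [hψ'def, deriv_ramp]
        rw [← mul_neg]
        exact h2) hlap
    have hwk := weak_ineq hw h12.le hM' (G := 0) (by simp) (fun t _ => continuous_const)
      (fun x => continuousOn_const) hL hρR hT
    have hnn : 0 ≤ ∫ t in t₁..t₂, weakRate w (fun _ _ => 0) ψ ψ' t := by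
      refine intervalIntegral.integral_nonneg h12.le fun t ht => ?_
      unfold weakRate
      have hwc := (hw.c2 t ht).continuous
      rw [← integral_add]
      · simp only [zero_mul, integral_zero, add_zero]
        refine integral_nonneg fun z => ?_
        simp only [Pi.zero_apply]
        by_cases hz : z ∈ closedBall y ρ
        · rw [← mul_add, hlap z t ht]
          have h1 := (hM z (closedBall_subset_ball hρR hz) t ht).1
          have h2 : 0 ≤ P z t :=
            mul_nonneg (deriv_deriv_ramp_nonneg hκ) (by positivity)
          have : ψ' z t + (-ψ' z t + P z t) = P z t := by ring
          rw [this]; positivity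
        · rw [hT.supp' z hz t ht, lap_eq_zero_of_eqOn isClosed_closedBall
            (fun x hx => hT.supp x hx t ht) z hz]; simp
      · exact integrable_of_support (x₀ := y) (r := ρ) (hwc.mul (hT.contx' t ht)) fun z hz => by
          simp [hT.supp' z hz t ht]
      · exact integrable_of_support (x₀ := y) (r := ρ) (hwc.mul (continuous_lap (hT.c2 t ht)))
          fun z hz => by
          simp [lap_eq_zero_of_eqOn isClosed_closedBall (fun x hx => hT.supp x hx t ht) z hz]
    have e1 : ∀ z, ψ z t₁ = ramp κ (heat (t₂ - t₁ + δ) (z - y)) := fun z => by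
      simp only [hψdef, hs₀]; congr 2; ring
    have e2 : ∀ z, ψ z t₂ = ramp κ (heat δ (z - y)) := fun z => by
      simp only [hψdef, hs₀]; congr 2; ring
    simp only [e1, e2] at hwk
    linarith
  have hlim2 := tendsto_truncated_heat (ψ := fun δ z => ramp κ (heat δ (z - y))) (C := 2 * κ) hN hρ
    (fun δ hδ z => ramp_nonneg (heat_pos hδ).le) (fun δ hδ z => ramp_le (heat_pos hδ).le)
    (fun δ hδ z => by linarith [le_ramp hκ (heat_pos (z := z - y) hδ).le])
    (fun δ hδ z hz => hout δ hδ z hz) (fun δ _ => hrc δ) (hw.c2 t₂ ⟨h12.le, le_rfl⟩).continuous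
  have hτ : 0 < t₂ - t₁ := sub_pos.2 h12
  have hw1 := (hw.c2 t₁ ⟨le_rfl, h12.le⟩).continuous
  have hlim1 : Tendsto (fun δ => ∫ z, w z t₁ * ramp κ (heat (t₂ - t₁ + δ) (z - y))) (𝓝[>] 0)
      (𝓝 (∫ z, w z t₁ * ramp κ (heat (t₂ - t₁) (z - y)))) := by
    set A := (4 * π * (t₂ - t₁)) ^ (-(N : ℝ) / 2) with hA
    have hbd : ∀ δ > 0, ∀ z, ramp κ (heat (t₂ - t₁ + δ) (z - y)) ≤ A := by
      intro δ hδ z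
      refine (ramp_le (heat_pos (by linarith)).le).trans ((heat_le (by linarith) _).trans ?_)
      exact rpow_le_rpow_of_nonpos (by positivity) (by nlinarith [pi_pos])
        (by rw [neg_div]; exact neg_nonpos.2 (by positivity))
    have hK := isCompact_closedBall y ρ
    refine tendsto_integral_filter_of_dominated_convergence
      ((closedBall y ρ).indicator fun _ => M * A) ?_ ?_ ((integrable_indicator_iff
        hK.measurableSet).2 (integrableOn_const (hs := hK.measure_lt_top.ne))) ?_
    · exact Eventually.of_forall fun δ => (hw1.mul (hrc _)).aestronglyMeasurable
    · filter_upwards [self_mem_nhdsWithin] with δ hδ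
      have hδ : 0 < δ := hδ
      refine Eventually.of_forall fun z => ?_
      by_cases hz : z ∈ closedBall y ρ
      · rw [indicator_of_mem hz, norm_mul, Real.norm_eq_abs, Real.norm_eq_abs,
          abs_of_nonneg (ramp_nonneg (heat_pos (by linarith)).le)]
        have h3 := hM' z (closedBall_subset_ball hρR hz) t₁ ⟨le_rfl, h12.le⟩
        exact mul_le_mul h3 (hbd δ hδ z) (ramp_nonneg (heat_pos (by linarith)).le)
          ((abs_nonneg _).trans h3)
      · rw [hout _ (by linarith) z hz, indicator_of_notMem hz]; simp
    · refine Eventually.of_forall fun z => Tendsto.const_mul _ ?_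
      exact (contDiff_ramp.continuous.tendsto _).comp (tendsto_add_heat hτ _)
  refine le_of_tendsto_of_tendsto hlim1 hlim2 ?_
  filter_upwards [self_mem_nhdsWithin] with δ hδ using main δ hδ

end kernel

section

variable {N : ℕ}

/-- Continuity in time of integrals over a closed ball. -/
theorem continuousOn_setIntegral {w : Eu N → ℝ → ℝ} {y : Eu N} {ρ M : ℝ} {S : Set ℝ}
    (hwx : ∀ t ∈ S, Continuous fun x => w x t) (hwt : ∀ x, ContinuousOn (w x) S)
    (hM : ∀ x ∈ closedBall y ρ, ∀ t ∈ S, |w x t| ≤ M) :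
    ContinuousOn (fun t => ∫ z in closedBall y ρ, w z t) S := by
  have hm : MeasurableSet (closedBall y ρ) := measurableSet_closedBall
  simp_rw [← integral_indicator hm]
  refine continuousOn_integral_of_support (isCompact_closedBall y ρ) (M := |M|)
    (q := fun x t => (closedBall y ρ).indicator (fun z => w z t) x)
    (fun t ht => (hwx t ht).aestronglyMeasurable.indicator hm) (fun x => ?_) (fun x t ht => ?_)
    (fun x hx t ht => by simp [hx])
  · by_cases hx : x ∈ closedBall y ρ
    · simpa [hx] using hwt x
    · simpa [hx] using continuousOn_const
  · by_cases hx : x ∈ closedBall y ρ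
    · simpa [hx] using (hM x hx t ht).trans (le_abs_self M)
    · simp [hx]

theorem integral_le_setIntegral {f g : Eu N → ℝ} {y : Eu N} {ρ : ℝ} (hf : Continuous f)
    (hg : Continuous g) (h : ∀ x ∈ closedBall y ρ, f x ≤ g x)
    (h0 : ∀ x ∉ closedBall y ρ, f x = 0) : ∫ x, f x ≤ ∫ x in closedBall y ρ, g x := by
  have hm : MeasurableSet (closedBall y ρ) := measurableSet_closedBall
  rw [← setIntegral_eq_integral_of_forall_compl_eq_zero h0]
  exact setIntegral_mono_on (hf.continuousOn.integrableOn_compact (isCompact_closedBall _ _))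
    (hg.continuousOn.integrableOn_compact (isCompact_closedBall _ _)) hm h

theorem exists_bound_of_support {f : Eu N → ℝ} (hf : Continuous f) (hs : HasCompactSupport f) :
    ∃ A, 0 ≤ A ∧ ∀ x, |f x| ≤ A := by
  obtain ⟨A, hA⟩ := hf.bounded_above_of_compact_support hs
  exact ⟨A, (norm_nonneg _).trans (hA 0), hA⟩

theorem exists_cutoff {r R : ℝ} (hr : 0 < r) (hR : r < R) :
    ∃ χ : Eu N → ℝ, ContDiff ℝ (⊤ : ℕ∞) χ ∧ HasCompactSupport χ ∧ (∀ z, 0 ≤ χ z) ∧ (∀ z, χ z ≤ 1) ∧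
      (∀ z, R ≤ ‖z‖ → χ z = 0) ∧ ∀ z, ‖z‖ ≤ r → χ z = 1 := by
  let b : ContDiffBump (0 : Eu N) := ⟨r, R, hr, hR⟩
  exact ⟨fun z => b z, b.contDiff, b.hasCompactSupport, fun z => b.nonneg, fun z => b.le_one,
    fun z hz => b.zero_of_le_dist (by simpa using hz),
    fun z hz => b.one_of_mem_closedBall (by simpa using hz)⟩

/-- Localized heat kernels bound nonnegative subsolutions from above. -/
theorem exists_upper_bound (hN : 0 < N) {ρ : ℝ} (hρ : 0 < ρ) :
    ∃ Γ : ℝ, 1 ≤ Γ ∧ ∀ (u : Eu N → ℝ → ℝ) (y : Eu N) (R G M t₁ t₂ : ℝ),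
      SuperOn (fun x t => -u x t) (fun _ _ => -G) y R (Icc t₁ t₂) → t₁ + 1 / 4 ≤ t₂ →
      (∀ x ∈ ball y R, ∀ t ∈ Icc t₁ t₂, u x t ∈ Icc 0 M) →
      (∀ x ∈ ball y R, ∀ t ∈ Ico t₁ t₂, RLsc (fun x t => -u x t) x t) → ρ < R → 0 ≤ G →
      u y t₂ ≤ Γ * (∫ z in closedBall y ρ, u z t₁) +
        Γ * (∫ t in t₁..t₂, ∫ z in closedBall y ρ, u z t) + G * (t₂ - t₁) := by
  obtain ⟨χ, hχ', hχs, hχ0, hχ1, hχo, hχi⟩ := exists_cutoff (N := N) (half_pos hρ) (half_lt_self hρ)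
  have hχc : ContDiff ℝ 2 χ := contDiff_infty.1 hχ' 2
  have hev : ∀ z : Eu N, ‖z‖ < ρ / 2 → χ =ᶠ[𝓝 z] fun _ => 1 := by
    intro z hz
    filter_upwards [isOpen_ball.mem_nhds (show z ∈ ball (0 : Eu N) (ρ / 2) by simpa using hz)]
      with x hx
    exact hχi x (by simpa using (mem_ball_zero_iff.1 hx).le)
  have hpdi : ∀ i, ∀ z : Eu N, ‖z‖ < ρ / 2 → pd i χ z = 0 := by
    intro i z hz
    have : pd i χ z = pd i (fun _ => (1 : ℝ)) z := by
      simp only [pd]; rw [(hev z hz).fderiv_eq]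
    rw [this, pd_const]
  have hlapi : ∀ z : Eu N, ‖z‖ < ρ / 2 → lap χ z = 0 := by
    intro z hz
    have : lap χ z = lap (fun _ => (1 : ℝ)) z := by
      simp only [lap]; rw [((hev z hz).iteratedFDeriv ℝ 2).eq_of_nhds]
    rw [this, lap_const]
  have hpdo : ∀ i, ∀ z : Eu N, ρ < ‖z‖ → pd i χ z = 0 := by
    intro i z hz
    have hev2 : χ =ᶠ[𝓝 z] fun _ => 0 := by
      filter_upwards [isClosed_closedBall.isOpen_compl.mem_nhds
        (show z ∈ (closedBall (0 : Eu N) ρ)ᶜ by simpa using hz)] with x hx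
      exact hχo x (by simpa using (not_le.1 (fun h => hx (mem_closedBall_zero_iff.2 h))).le)
    have : pd i χ z = pd i (fun _ => (0 : ℝ)) z := by
      simp only [pd]; rw [hev2.fderiv_eq]
    rw [this, pd_const]
  have hlapo : ∀ z : Eu N, ρ < ‖z‖ → lap χ z = 0 := fun z hz =>
    lap_eq_zero_of_eqOn (s := closedBall 0 ρ) isClosed_closedBall
      (fun x hx => hχo x (not_le.1 fun h => hx (mem_closedBall_zero_iff.2 h)).le) z
      (by simpa using hz)
  have hpc : ∀ i, Continuous (pd i χ) := fun i => continuous_pd (hχc.of_le (by norm_num)) 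
  choose A hA0 hA using fun i => exists_bound_of_support (hpc i) (hasCompactSupport_pd hχs)
  obtain ⟨B, hB0, hB⟩ := exists_bound_of_support (continuous_lap hχc)
      (hasCompactSupport_lap hχs hχc)
  obtain ⟨C₁, hC₁, hK⟩ := exists_heat_bound N (half_pos hρ)
  have hKle : ∀ τ > 0, ∀ z : Eu N, ρ / 2 ≤ ‖z‖ → heat τ z ≤ C₁ := fun τ hτ z hz => by
    refine le_trans ?_ (hK τ hτ z hz)
    exact le_mul_of_one_le_right (heat_pos hτ).le (by linarith [one_div_pos.2 hτ])
  set P : ℝ → Eu N → ℝ := fun τ z =>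
    2 * ∑ i, pd i (fun x => heat τ x) z * pd i χ z + heat τ z * lap χ z with hP
  set Γ := 1 + (2 * ∑ i, C₁ * ρ * A i + C₁ * B) with hΓ
  have hΓ1 : 1 ≤ Γ := by
    have : 0 ≤ ∑ i, C₁ * ρ * A i := Finset.sum_nonneg fun i _ => by have := hA0 i; positivity
    rw [hΓ]; nlinarith
  have hPb : ∀ τ > 0, ∀ z, |P τ z| ≤ Γ := by
    intro τ hτ z
    have triv : |(0 : ℝ)| ≤ Γ := by rw [abs_zero]; linarith
    rcases lt_or_ge ‖z‖ (ρ / 2) with h1 | h1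
    · simpa [hP, hpdi _ z h1, hlapi z h1] using triv
    rcases lt_or_ge ρ ‖z‖ with h2 | h2
    · simpa [hP, hpdo _ z h2, hlapo z h2] using triv
    have hk0 := heat_pos (z := z) hτ
    have e1 : |2 * ∑ i, pd i (fun x => heat τ x) z * pd i χ z| ≤ 2 * ∑ i, C₁ * ρ * A i := by
      rw [abs_mul, abs_two]
      refine mul_le_mul_of_nonneg_left ((Finset.abs_sum_le_sum_abs _ _).trans
        (Finset.sum_le_sum fun i _ => ?_)) (by norm_num)
      rw [abs_mul]
      refine mul_le_mul ?_ (hA i z) (abs_nonneg _) (by positivity)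
      rw [pd_heat, abs_mul, abs_neg, abs_of_pos hk0, abs_div,
          abs_of_pos (by positivity : 0 < 2 * τ)]
      have hzi : |z i| ≤ ρ := (PiLp.norm_apply_le z i).trans h2
      have h3 := hK τ hτ z h1
      have h4 : 1 / (2 * τ) * heat τ z ≤ C₁ := by
        have : 1 / (2 * τ) ≤ 1 + 1 / τ := by
          linarith [one_div_le_one_div_of_le hτ (by linarith : τ ≤ 2 * τ)]
        nlinarith
      calc |z i| / (2 * τ) * heat τ z = |z i| * (1 / (2 * τ) * heat τ z) := by ring
        _ ≤ ρ * C₁ := mul_le_mul hzi h4 (by positivity) hρ.le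
        _ = _ := mul_comm _ _
    have e2 : |heat τ z * lap χ z| ≤ C₁ * B := by
      rw [abs_mul, abs_of_pos hk0]
      exact mul_le_mul (hKle τ hτ z h1) (hB z) (abs_nonneg _) hC₁.le
    calc |P τ z| ≤ _ := abs_add_le _ _
      _ ≤ Γ := by rw [hΓ]; linarith
  have hPo : ∀ τ, ∀ z : Eu N, ρ < ‖z‖ → P τ z = 0 := fun τ z hz => by
    simp [hP, hpdo _ z hz, hlapo z hz]
  refine ⟨Γ, hΓ1, fun u y R G M t₁ t₂ hw h12' hM hL hρR hG => ?_⟩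
  have h12 : t₁ < t₂ := by linarith
  have hux : ∀ t ∈ Icc t₁ t₂, Continuous fun x => u x t := fun t ht => by
    simpa only [neg_neg] using (hw.c2 t ht).continuous.fun_neg
  have hut : ∀ x, ContinuousOn (u x) (Icc t₁ t₂) := fun x t ht => by
    simpa only [neg_neg] using (hw.dt x t ht).continuousAt.continuousWithinAt.fun_neg
  have hM' : ∀ x ∈ ball y R, ∀ t ∈ Icc t₁ t₂, |u x t| ≤ M := fun x hx t ht => by
    rw [abs_of_nonneg (hM x hx t ht).1]; exact (hM x hx t ht).2
  have hsub : closedBall y ρ ⊆ ball y R := closedBall_subset_ball hρR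
  have hout : ∀ z ∉ closedBall y ρ, ρ < ‖z - y‖ := fun z hz => by
    rw [mem_closedBall, dist_eq_norm] at hz; exact not_le.1 hz
  have hχy : ContDiff ℝ 2 fun z => χ (z - y) := hχc.comp (by fun_prop)
  have main : ∀ δ > 0, ∫ z, u z t₂ * (heat δ (z - y) * χ (z - y)) ≤
      Γ * (∫ z in closedBall y ρ, u z t₁) +
        Γ * (∫ t in t₁..t₂, ∫ z in closedBall y ρ, u z t) + G * (t₂ - t₁) := by
    intro δ hδ
    set s₀ := t₂ + δ with hs₀
    have h2s : t₂ < s₀ := by linarith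
    have hpos : ∀ t ∈ Icc t₁ t₂, 0 < s₀ - t := fun t ht => by linarith [ht.2]
    set ψ : Eu N → ℝ → ℝ := fun z t => heat (s₀ - t) (z - y) * χ (z - y) with hψdef
    set ψ' : Eu N → ℝ → ℝ := fun z t => -heatDot (s₀ - t) (z - y) * χ (z - y) with hψ'def
    have hKc := continuousOn_heat_mul (t₁ := t₁) h2s y
    have hDc := continuousOn_heatDot_mul (t₁ := t₁) h2s y
    have hχp : ContinuousOn (fun p : Eu N × ℝ => χ (p.1 - y)) (univ ×ˢ Icc t₁ t₂) :=
      (hχc.continuous.comp (by fun_prop)).continuousOn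
    have hψ'c : ContinuousOn (fun p : Eu N × ℝ => ψ' p.1 p.2) (univ ×ˢ Icc t₁ t₂) :=
      hDc.neg.mul hχp
    have hPc : ContinuousOn (fun p : Eu N × ℝ => P (s₀ - p.2) (p.1 - y)) (univ ×ˢ Icc t₁ t₂) := by
      simp only [hP]
      refine ContinuousOn.add (continuousOn_const.mul (continuousOn_finsetSum _ fun i _ => ?_))
        (hKc.mul ((continuous_lap hχc).comp (by fun_prop)).continuousOn)
      simp_rw [pd_heat]
      refine ContinuousOn.mul (ContinuousOn.mul (ContinuousOn.neg (ContinuousOn.div (by fun_prop)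
        (by fun_prop) fun p hp => ?_)) hKc) ((hpc i).comp (by fun_prop)).continuousOn
      have := hpos p.2 hp.2; positivity
    have hlap : ∀ x, ∀ t ∈ Icc t₁ t₂,
        lap (fun z => ψ z t) x = -ψ' x t + P (s₀ - t) (x - y) := by
      intro x t ht
      simp only [hψdef]
      rw [lap_comp_sub (fun z => heat (s₀ - t) z * χ z), lap_mul contDiff_heat hχc,
        lap_heat (hpos t ht)]
      simp only [hψ'def, hP]; ring
    obtain ⟨C, hT⟩ := exists_test (ψ := ψ) (ψ' := ψ') (Lp := fun x t => -ψ' x t +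
        P (s₀ - t) (x - y))
      (x₀ := y) (r := ρ) (t₁ := t₁) (t₂ := t₂) (hKc.mul hχp) hψ'c
      (hψ'c.neg.add hPc) (fun x t ht => mul_nonneg (heat_pos (hpos t ht)).le (hχ0 _))
      (fun t _ => (contDiff_heat_sub _ y).mul hχy)
      (fun x hx t ht => by simp [hψdef, hχo _ (hout x hx).le])
      (fun x hx t ht => by simp [hψ'def, hχo _ (hout x hx).le])
      (fun x t ht => (hasDerivAt_heat_sub (lt_of_le_of_lt ht.2 h2s) (x - y)).mul_const _) hlap
    have hwk := weak_ineq hw h12.le (M := M) (G := G) (fun x hx t ht => by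
      rw [abs_neg]; exact hM' x hx t ht) (by simp [abs_of_nonneg hG])
      (fun t _ => continuous_const) (fun x => continuousOn_const) hL hρR hT
    have hcI : ContinuousOn (fun t => ∫ z in closedBall y ρ, u z t) (Icc t₁ t₂) :=
      continuousOn_setIntegral hux hut fun x hx => hM' x (hsub hx)
    have hrate : ∀ t ∈ Icc t₁ t₂, -(Γ * (∫ z in closedBall y ρ, u z t) + G) ≤
        weakRate (fun x t => -u x t) (fun _ _ => -G) ψ ψ' t := by
      intro t ht
      unfold weakRate
      have i1 : Integrable fun z => -u z t * ψ' z t :=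
        integrable_of_support (x₀ := y) (r := ρ) ((hux t ht).neg.mul (hT.contx' t ht))
          fun z hz => by simp [hT.supp' z hz t ht]
      have i2 : Integrable fun z => -u z t * lap (fun y => ψ y t) z :=
        integrable_of_support (x₀ := y) (r := ρ) ((hux t ht).neg.mul (continuous_lap (hT.c2 t ht)))
          fun z hz => by
            simp [lap_eq_zero_of_eqOn isClosed_closedBall (fun x hx => hT.supp x hx t ht) z hz]
      rw [← integral_add i1 i2, integral_const_mul]
      have e1 : ∫ z, ψ z t ≤ 1 := by
        rw [← integral_heat (N := N) (hpos t ht),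
            ← integral_sub_right_eq_self (fun z => heat (s₀ - t) z) y]
        refine integral_mono (integrable_of_support (x₀ := y) (r := ρ) (hT.c2 t ht).continuous
          fun z hz => hT.supp z hz t ht) ((integrable_heat (hpos t ht)).comp_sub_right y)
          fun z => ?_
        exact mul_le_of_le_one_right (heat_pos (hpos t ht)).le (hχ1 _)
      have e2 : ∫ z, -(-u z t * ψ' z t + -u z t * lap (fun y => ψ y t) z) ≤
          ∫ z in closedBall y ρ, Γ * u z t := by
        refine integral_le_setIntegral (((hux t ht).neg.mul (hT.contx' t ht)).add
          ((hux t ht).neg.mul (continuous_lap (hT.c2 t ht)))).neg (continuous_const.mul (hux t ht))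
          (fun z hz => ?_) fun z hz => ?_
        · rw [hlap z t ht]
          have h1 := (hM z (hsub hz) t ht).1
          have h2 := (abs_le.1 (hPb _ (hpos t ht) (z - y))).2
          nlinarith [mul_le_mul_of_nonneg_left h2 h1]
        · rw [hlap z t ht, hPo _ _ (hout z hz)]; ring
      rw [integral_neg, integral_const_mul] at e2
      nlinarith
    have hint := intervalIntegral.integral_mono_on h12.le (μ := volume)
      (ContinuousOn.intervalIntegrable (by
        rw [uIcc_of_le h12.le]; exact ((continuousOn_const.mul hcI).add continuousOn_const).neg))
      (ContinuousOn.intervalIntegrable (by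
        rw [uIcc_of_le h12.le]
        exact continuousOn_weakRate hw (M := M) (G := G) (fun x hx t ht => by
          rw [abs_neg]; exact hM' x hx t ht) (by simp [abs_of_nonneg hG])
          (fun t _ => continuous_const) (fun x => continuousOn_const) hρR hT)) hrate
    rw [intervalIntegral.integral_neg, intervalIntegral.integral_add
      (ContinuousOn.intervalIntegrable (by
        rw [uIcc_of_le h12.le]; exact continuousOn_const.mul hcI)) intervalIntegrable_const,
      intervalIntegral.integral_const_mul, intervalIntegral.integral_const, smul_eq_mul] at hint
    have e1 : ∫ z, u z t₁ * ψ z t₁ ≤ ∫ z in closedBall y ρ, Γ * u z t₁ := by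
      have ht : t₁ ∈ Icc t₁ t₂ := ⟨le_rfl, h12.le⟩
      refine integral_le_setIntegral ((hux t₁ ht).mul (hT.c2 t₁ ht).continuous)
        (continuous_const.mul (hux t₁ ht)) (fun z hz => ?_) fun z hz => by
          simp [hT.supp z hz t₁ ht]
      have h1 := (hM z (hsub hz) t₁ ht).1
      have h2 : ψ z t₁ ≤ Γ := by
        refine le_trans ?_ hΓ1
        exact mul_le_one₀ (heat_le_one (by linarith) _) (hχ0 _) (hχ1 _)
      rw [mul_comm]
      exact mul_le_mul_of_nonneg_right h2 h1
    rw [integral_const_mul] at e1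
    have e2 : ∀ z, ψ z t₂ = heat δ (z - y) * χ (z - y) := fun z => by
      simp only [hψdef, hs₀]; congr 2; ring
    simp only [neg_mul, integral_neg, e2] at hwk
    linarith
  have hlim := tendsto_truncated_heat (ψ := fun δ z => heat δ (z - y) * χ (z - y)) (C := C₁) hN hρ
    (fun δ hδ z => mul_nonneg (heat_pos hδ).le (hχ0 _))
    (fun δ hδ z => mul_le_of_le_one_right (heat_pos hδ).le (hχ1 _))
    (fun δ hδ z => by
      rcases le_or_gt ‖z - y‖ (ρ / 2) with h | h
      · rw [hχi _ h]; linarith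
      · have := mul_nonneg (heat_pos (z := z - y) hδ).le (hχ0 (z - y))
        linarith [hKle δ hδ _ h.le])
    (fun δ hδ z hz => by simp [hχo _ (hout z hz).le])
    (fun δ _ => (contDiff_heat_sub (n := 0) _ y).continuous.mul hχy.continuous)
    (hux t₂ ⟨h12.le, le_rfl⟩)
  refine le_of_tendsto hlim ?_
  filter_upwards [self_mem_nhdsWithin] with δ hδ using main δ hδ

end

/-- Baire category in the form used below: some portion of the closure of `B` lies in one of the
sets of a countable cover. -/
theorem exists_portion {X : Type*} [MetricSpace X] [CompleteSpace X] {B : Set X} (hB : B.Nonempty)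
    {E : ℕ → Set X} (hE : ∀ n, IsClosed (E n ∩ closure B)) (hc : closure B ⊆ ⋃ n, E n) :
    ∃ n, ∃ O : Set X, IsOpen O ∧ (O ∩ B).Nonempty ∧ O ∩ closure B ⊆ E n := by
  have : CompleteSpace (closure B) := isClosed_closure.completeSpace_coe
  have : Nonempty (closure B) := hB.closure.to_subtype
  obtain ⟨n, x, hx⟩ := nonempty_interior_of_iUnion_of_closed
    (f := fun n => ((↑) : closure B → X) ⁻¹' (E n ∩ closure B))
    (fun n => (hE n).preimage continuous_subtype_val) (by
      refine eq_univ_of_forall fun x => ?_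
      obtain ⟨n, hn⟩ := mem_iUnion.1 (hc x.2)
      exact mem_iUnion.2 ⟨n, hn, x.2⟩)
  obtain ⟨O, hO, hOe⟩ := isOpen_induced_iff.1 (isOpen_interior
    (s := ((↑) : closure B → X) ⁻¹' (E n ∩ closure B)))
  have hxO : (x : X) ∈ O := by
    have : x ∈ ((↑) : closure B → X) ⁻¹' O := hOe ▸ hx
    exact this
  refine ⟨n, O, hO, mem_closure_iff.1 x.2 O hO hxO, fun y hy => ?_⟩
  have : (⟨y, hy.2⟩ : closure B) ∈ ((↑) : closure B → X) ⁻¹' O := hy.1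
  rw [hOe] at this
  exact (interior_subset this).1

theorem SuperOn.add_const {N : ℕ} {w g : Eu N → ℝ → ℝ} {x₀ : Eu N} {R : ℝ} {S : Set ℝ}
    (h : SuperOn w g x₀ R S) (c : ℝ) : SuperOn (fun x t => w x t + c) g x₀ R S := by
  refine ⟨fun t ht => (h.c2 t ht).add contDiff_const, fun x t ht => (h.dt x t ht).add_const c,
    fun x hx t ht => ?_⟩
  have h1 := h.ineq x hx t ht
  rw [lap_add (h.c2 t ht) contDiff_const, lap_const]
  have : deriv (fun t => w x t + c) t = deriv (w x) t := deriv_add_const c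
  rw [this]; linarith

section

variable {N : ℕ}

theorem exists_lipschitz_at {V : Type*} [NormedAddCommGroup V] [NormedSpace ℝ V] {f : V → ℝ} {x : V}
    (h : DifferentiableAt ℝ f x) :
    ∃ n₀ : ℕ, ∀ n ≥ n₀, ∀ y, dist y x < 1 / ((n : ℝ) + 1) → |f y - f x| ≤ n * dist y x := by
  obtain ⟨c, hc⟩ := h.isBigO_sub.bound
  obtain ⟨δ, hδ, hb⟩ := Metric.eventually_nhds_iff.1 hc
  obtain ⟨n₁, h1⟩ := exists_nat_ge c
  obtain ⟨n₂, h2⟩ := exists_nat_one_div_lt hδ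
  refine ⟨max n₁ n₂, fun n hn y hy => ?_⟩
  have hn1 : (n₁ : ℝ) ≤ n := by exact_mod_cast (le_max_left _ _).trans hn
  have hn2 : (n₂ : ℝ) ≤ n := by exact_mod_cast (le_max_right _ _).trans hn
  have h3 : 1 / ((n : ℝ) + 1) ≤ 1 / ((n₂ : ℝ) + 1) :=
    one_div_le_one_div_of_le (by positivity) (by linarith)
  have h4 := hb (hy.trans_le (h3.trans h2.le))
  rw [Real.norm_eq_abs, ← dist_eq_norm] at h4
  exact h4.trans (mul_le_mul_of_nonneg_right (h1.trans hn1) dist_nonneg)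

set_option maxHeartbeats 400000 in
/-- Bounded separately regular supersolutions are lower semicontinuous from the future. -/
theorem rlsc_of_bounded (hN : 0 < N) {w : Eu N → ℝ → ℝ} {x₀ : Eu N} {R a b M : ℝ}
    (hw : SuperOn w (fun _ _ => 0) x₀ R (Ioo a b))
    (hM : ∀ x ∈ ball x₀ R, ∀ t ∈ Ioo a b, |w x t| ≤ M) :
    ∀ x ∈ ball x₀ R, ∀ t ∈ Ioo a b, RLsc w x t := by
  have hwx : ∀ t ∈ Ioo a b, Continuous fun x => w x t := fun t ht => (hw.c2 t ht).continuous
  have hwt : ∀ x, ∀ t ∈ Ioo a b, ContinuousAt (w x) t := fun x t ht => (hw.dt x t ht).continuousAt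
  set U : Set (Eu N × ℝ) := ball x₀ R ×ˢ Ioo a b with hU
  have hUo : IsOpen U := isOpen_ball.prod isOpen_Ioo
  by_contra! hcon
  obtain ⟨x₁, hx₁, t₁, ht₁, hbad⟩ := hcon
  obtain ⟨r, hr, hrU⟩ := Metric.isOpen_iff.1 hUo (x₁, t₁) ⟨hx₁, ht₁⟩
  set V := ball (x₁, t₁) (r / 2) with hV
  set B : Set (Eu N × ℝ) := {p | p ∈ V ∧ ¬ RLsc w p.1 p.2} with hB
  have hBU : closure B ⊆ U := by
    refine (closure_mono fun p hp => hp.1).trans (closure_ball_subset_closedBall.trans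
      ((closedBall_subset_ball (by linarith)).trans hrU))
  set E : ℕ → Set (Eu N × ℝ) := fun n => {p |
    (∀ s ∈ Ioo a b, dist s p.2 < 1 / ((n : ℝ) + 1) → |w p.1 s - w p.1 p.2| ≤ n * dist s p.2) ∧
    ∀ y, dist y p.1 < 1 / ((n : ℝ) + 1) → |w y p.2 - w p.1 p.2| ≤ n * dist y p.1} with hE
  obtain ⟨n, O, hO, ⟨p, hpO, hpB⟩, hOE⟩ : ∃ n, ∃ O : Set (Eu N × ℝ), IsOpen O ∧ (O ∩ B).Nonempty ∧
      O ∩ closure B ⊆ E n := by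
    refine exists_portion (B := B) ⟨(x₁, t₁), mem_ball_self (half_pos hr), hbad⟩ (fun n => ?_)
        fun p hp => ?_
    · refine IsSeqClosed.isClosed fun q p hq hqp => ?_
      have hpF : p ∈ closure B := isClosed_closure.mem_of_tendsto hqp
        (Eventually.of_forall fun k => (hq k).2)
      have hpt : p.2 ∈ Ioo a b := (hBU hpF).2
      have hqt : ∀ k, (q k).2 ∈ Ioo a b := fun k => (hBU (hq k).2).2
      have hq1 : Tendsto (fun k => (q k).1) atTop (𝓝 p.1) := (continuous_fst.tendsto p).comp hqp
      have hq2 : Tendsto (fun k => (q k).2) atTop (𝓝 p.2) := (continuous_snd.tendsto p).comp hqp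
      have hn1 : 0 < 1 / ((n : ℝ) + 1) := by positivity
      have hx : ∀ s ∈ Ioo a b, Tendsto (fun k => w (q k).1 s) atTop (𝓝 (w p.1 s)) := fun s hs =>
        ((hwx s hs).tendsto p.1).comp hq1
      have hval : Tendsto (fun k => w (q k).1 (q k).2) atTop (𝓝 (w p.1 p.2)) := by
        have h1 : Tendsto (fun k => w (q k).1 p.2 - w (q k).1 (q k).2) atTop (𝓝 0) := by
          have h2 : Tendsto (fun k => n * dist p.2 (q k).2) atTop (𝓝 0) := by
            simpa using ((tendsto_const_nhds (x := p.2)).dist hq2).const_mul (n : ℝ)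
          refine squeeze_zero_norm' ?_ h2
          have h3 : ∀ᶠ k in atTop, dist p.2 (q k).2 < 1 / ((n : ℝ) + 1) := by
            filter_upwards [Metric.tendsto_nhds.1 hq2 _ hn1] with k hk
            rwa [dist_comm]
          filter_upwards [h3] with k hk
          exact (hq k).1.1 p.2 hpt hk
        have h4 := (hx p.2 hpt).sub h1
        simpa using h4
      refine ⟨⟨fun s hs hsd => ?_, fun y hyd => ?_⟩, hpF⟩
      · refine le_of_tendsto_of_tendsto ((hx s hs).sub hval).abs
          (((tendsto_const_nhds (x := s)).dist hq2).const_mul (n : ℝ)) ?_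
        filter_upwards [((tendsto_const_nhds (x := s)).dist hq2).eventually_lt_const hsd] with k hk
        exact (hq k).1.1 s hs hk
      · refine le_of_tendsto_of_tendsto ((((hwt y p.2 hpt).tendsto.comp hq2)).sub hval).abs
          (((tendsto_const_nhds (x := y)).dist hq1).const_mul (n : ℝ)) ?_
        filter_upwards [((tendsto_const_nhds (x := y)).dist hq1).eventually_lt_const hyd] with k hk
        exact (hq k).1.2 y hk
    · have hpt : p.2 ∈ Ioo a b := (hBU hp).2
      obtain ⟨n₁, h1⟩ := exists_lipschitz_at (hw.dt p.1 p.2 hpt)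
      obtain ⟨n₂, h2⟩ := exists_lipschitz_at
        ((hw.c2 p.2 hpt).differentiable (by norm_num) p.1)
      exact mem_iUnion.2 ⟨max n₁ n₂, fun s _ hs => h1 _ (le_max_left _ _) s hs,
        fun y hy => h2 _ (le_max_right _ _) y hy⟩
  apply hpB.2
  obtain ⟨xs, ss⟩ := p
  have hpF : (xs, ss) ∈ closure B := subset_closure hpB
  obtain ⟨ρ₀, hρ₀, hρO⟩ := Metric.isOpen_iff.1 (hO.inter isOpen_ball) (xs, ss) ⟨hpO, hpB.1⟩
  have hboxO : ∀ x s, dist x xs < ρ₀ → dist s ss < ρ₀ → (x, s) ∈ O ∩ V := fun x s h1 h2 =>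
    hρO (by rw [mem_ball, Prod.dist_eq]; exact max_lt h1 h2)
  have hVU : V ⊆ U := (ball_subset_ball (by linarith)).trans hrU
  intro v hv
  change v < w xs ss at hv
  have hM0 : 0 ≤ M := (abs_nonneg _).trans (hM xs (hVU hpB.1).1 ss (hVU hpB.1).2)
  set ε := w xs ss - v with hε
  have hε0 : 0 < ε := sub_pos.2 hv
  set n' : ℝ := (n : ℝ) + 1 with hn'
  have hn0 : 0 < n' := by positivity
  set ρ := min (ρ₀ / 2) (min (1 / (4 * n')) (ε / (16 * n'))) with hρdef
  have hρ : 0 < ρ := by positivity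
  have hρ1 : ρ < ρ₀ := (min_le_left _ _).trans_lt (by linarith)
  have hρ2 : 2 * ρ < 1 / n' := by
    have h : ρ ≤ 1 / (4 * n') := (min_le_right _ _).trans (min_le_left _ _)
    have : 1 / (4 * n') = 1 / n' / 4 := by field_simp
    have h3 : 0 < 1 / n' := by positivity
    linarith
  have hρ3 : 4 * (n * ρ) ≤ ε / 4 := by
    have h : ρ ≤ ε / (16 * n') := (min_le_right _ _).trans (min_le_right _ _)
    rw [le_div_iff₀ (by positivity)] at h
    have : (n : ℝ) * ρ ≤ n' * ρ := mul_le_mul_of_nonneg_right (by linarith) hρ.le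
    linarith
  obtain ⟨κ, hκ, hκb⟩ := exists_heat_bound N (ρ := ρ / 4) (by positivity)
  have hκ' : ∀ τ > 0, ∀ z : Eu N, ρ / 4 ≤ ‖z‖ → heat τ z ≤ κ := fun τ hτ z hz =>
    le_trans (le_mul_of_one_le_right (heat_pos hτ).le (by linarith [one_div_pos.2 hτ]))
        (hκb τ hτ z hz)
  have hlim := tendsto_truncated_heat (ψ := fun δ z => ramp κ (heat δ z)) (C := 2 * κ)
    (y := (0 : Eu N)) (ρ := ρ / 4) (w := fun _ => 1) hN (by positivity)
    (fun δ hδ z => ramp_nonneg (heat_pos hδ).le)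
    (fun δ hδ z => by simpa using ramp_le (heat_pos hδ).le)
    (fun δ hδ z => by simpa using (by linarith [le_ramp hκ (heat_pos (z := z) hδ).le] :
      heat δ z - ramp κ (heat δ z) ≤ 2 * κ))
    (fun δ hδ z hz => ramp_eq_zero hκ (hκ' δ hδ z (by
      simpa using (not_le.1 fun h => hz (mem_closedBall.2 h)).le)))
    (fun δ _ => contDiff_ramp.continuous.comp (contDiff_heat (n := 0)).continuous) continuous_const
  set η := ε / (8 * (M + 1)) with hη
  have hη0 : 0 < η := by positivity
  have hlim' := hlim.eventually_const_lt (show 1 - η < 1 by linarith)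
  obtain ⟨τ₀, hτ₀, hτ₀b⟩ := (mem_nhdsGT_iff_exists_Ioo_subset).1 hlim'
  have hτ₀ : 0 < τ₀ := hτ₀
  have hnb : ball xs (ρ / 2) ×ˢ ball ss (min ρ τ₀) ∈ 𝓝 (xs, ss) :=
    prod_mem_nhds (ball_mem_nhds _ (by positivity)) (ball_mem_nhds _ (by positivity))
  filter_upwards [self_mem_nhdsWithin, mem_nhdsWithin_of_mem_nhds hnb] with ⟨y, s⟩ hs hys
  have hs : ss ≤ s := hs
  have hyd : dist y xs < ρ / 2 := hys.1
  have hsd : |s - ss| < min ρ τ₀ := hys.2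
  rw [abs_of_nonneg (sub_nonneg.2 hs)] at hsd
  have hsρ : s - ss < ρ := hsd.trans_le (min_le_left _ _)
  have hsτ : s - ss < τ₀ := hsd.trans_le (min_le_right _ _)
  have hbox : ∀ x t, dist x xs ≤ ρ → t ∈ Icc ss s → (x, t) ∈ O ∩ V := fun x t hx ht =>
    hboxO x t (hx.trans_lt hρ1) (by
      rw [Real.dist_eq, abs_of_nonneg (sub_nonneg.2 ht.1)]; linarith [ht.2])
  have hbt : ∀ t ∈ Icc ss s, t ∈ Ioo a b := fun t ht =>
    (hVU (hbox xs t (by simpa using hρ.le) ht).2).2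
  set J : Set (Eu N × ℝ) := closure B ∩ (closedBall xs ρ ×ˢ Icc ss s) with hJ
  have hJc : IsCompact J := ((isCompact_closedBall _ _).prod isCompact_Icc).inter_left
    isClosed_closure
  obtain ⟨⟨x', a'⟩, ⟨hqF, hqx, hqa⟩, hmax⟩ := hJc.exists_isMaxOn
    ⟨(xs, ss), hpF, mem_closedBall_self hρ.le, le_rfl, hs⟩ continuous_snd.continuousOn
  have hqx : dist x' xs ≤ ρ := hqx
  have hqa : a' ∈ Icc ss s := hqa
  set m := w xs ss - 4 * (n * ρ) with hm
  have hEq : (x', a') ∈ E n := hOE ⟨(hbox x' a' hqx hqa).1, hqF⟩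
  have hEp : (xs, ss) ∈ E n := hOE ⟨hpO, hpF⟩
  have hn_nonneg : (0 : ℝ) ≤ n := Nat.cast_nonneg n
  have hlow : ∀ z, dist z xs ≤ ρ → m ≤ w z a' := by
    intro z hz
    have d1 : dist z x' ≤ 2 * ρ := (dist_triangle_right z x' xs).trans (by linarith)
    have d2 : dist ss a' ≤ ρ := by
      rw [dist_comm, Real.dist_eq, abs_of_nonneg (sub_nonneg.2 hqa.1)]; linarith [hqa.2]
    have h1 := (abs_le.1 (hEq.2 z (d1.trans_lt hρ2))).1
    have h2 := (abs_le.1 (hEq.1 ss (hbt ss ⟨le_rfl, hs⟩) (by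
      change dist ss a' < 1 / n'; linarith))).2
    have h3 := (abs_le.1 (hEp.2 x' (by change dist x' xs < 1 / n'; linarith))).1
    simp only at h1 h2 h3
    have e1 := mul_le_mul_of_nonneg_left d1 hn_nonneg
    have e2 := mul_le_mul_of_nonneg_left d2 hn_nonneg
    have e3 := mul_le_mul_of_nonneg_left hqx hn_nonneg
    linarith
  have hyρ : dist y xs ≤ ρ := by linarith
  have hMbox : ∀ x t, dist x xs ≤ ρ → t ∈ Icc ss s → |w x t| ≤ M := fun x t hx ht =>
    hM x (hVU (hbox x t hx ht).2).1 t (hbt t ht)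
  suffices h : m - 2 * M * η ≤ w y s by
    have h1 : 2 * M * η ≤ ε / 4 := by
      rw [hη]
      have : M / (M + 1) ≤ 1 := (div_le_one (by linarith)).2 (by linarith)
      calc 2 * M * (ε / (8 * (M + 1))) = ε / 4 * (M / (M + 1)) := by field_simp; ring
        _ ≤ ε / 4 := mul_le_of_le_one_right (by positivity) this
    change v < w y s
    linarith
  have h2Mη : 0 ≤ 2 * M * η := by positivity
  rcases hqa.2.eq_or_lt with has | has
  · have := hlow y hyρ
    rw [has] at this; linarith
  rcases lt_or_ge (m + M) 0 with hmM | hmM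
  · have := (abs_le.1 (hMbox y s hyρ ⟨hs, le_rfl⟩)).1
    linarith
  have hball : ∀ x ∈ ball y (ρ / 2), dist x xs ≤ ρ := fun x hx =>
    (dist_triangle x y xs).trans (by have := mem_ball.1 hx; linarith)
  have hgood : ∀ x ∈ ball y (ρ / 2), ∀ t ∈ Ioc a' s, RLsc w x t := by
    intro x hx t ht
    by_contra hnr
    have htI : t ∈ Icc ss s := ⟨hqa.1.trans ht.1.le, ht.2⟩
    have hbx := hbox x t (hball x hx) htI
    have : (x, t) ∈ J := ⟨subset_closure ⟨hbx.2, hnr⟩, hball x hx, htI⟩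
    exact absurd (hmax this) (not_le.2 ht.1)
  set Q : Eu N → ℝ → ℝ := fun z t => ramp κ (heat (s - t) (z - y)) with hQ
  have hQout : ∀ t < s, ∀ z ∉ closedBall y (ρ / 4), Q z t = 0 := fun t ht z hz =>
    ramp_eq_zero hκ (hκ' _ (sub_pos.2 ht) _ (by
      rw [mem_closedBall, dist_eq_norm] at hz; exact (not_le.1 hz).le))
  have hsup : SuperOn (fun x t => w x t + M) (fun _ _ => 0) x₀ R (Ioo a b) := hw.add_const M
  have hyball : ball y (ρ / 2) ⊆ ball x₀ R := fun x hx =>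
    (hVU (hbox x s (hball x hx) ⟨hs, le_rfl⟩).2).1
  have hLB : ∀ t ∈ Ioo a' s, ∫ z, (w z t + M) * Q z t ≤ w y s + M := by
    intro t ht
    have hsub : ∀ σ ∈ Icc t s, σ ∈ Icc ss s := fun σ hσ =>
      ⟨hqa.1.trans (ht.1.le.trans hσ.1), hσ.2⟩
    refine lower_bound (w := fun x t => w x t + M) (y := y) (t₁ := t) (t₂ := s) (κ := κ)
        (ρ := ρ / 4) (R := ρ / 2) (M := 2 * M) hN
      (hsup.mono hyball fun σ hσ => hbt σ (hsub σ hσ)) ht.2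
      (fun x hx σ hσ => ?_) (fun x hx σ hσ => ?_) (by positivity) (by linarith) hκ hκ'
    · have := abs_le.1 (hMbox x σ (hball x hx) (hsub σ hσ))
      exact ⟨by linarith [this.1], by linarith [this.2]⟩
    · exact (hgood x hx σ ⟨ht.1.trans_le hσ.1, hσ.2.le⟩).add_continuous
        (q := fun _ _ => M) continuous_const
  set c := (a' + s) / 2 with hc
  have hac : a' < c := by rw [hc]; linarith
  have hcs : c < s := by rw [hc]; linarith
  have hcI : ∀ t ∈ Icc a' c, t ∈ Icc ss s := fun t ht => ⟨hqa.1.trans ht.1, ht.2.trans hcs.le⟩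
  have hQc : ∀ t, Continuous fun z => Q z t := fun t =>
    contDiff_ramp.continuous.comp (contDiff_heat_sub (n := 0) _ y).continuous
  have hcont : ContinuousOn (fun t => ∫ z, (w z t + M) * Q z t) (Icc a' c) := by
    refine continuousOn_integral_mul (w := fun z t => w z t + M) (x₀ := y) (r := ρ / 4) (M := 2 * M)
      (C := (4 * π * (s - c)) ^ (-(N : ℝ) / 2))
      (fun t ht => (hwx t (hbt t (hcI t ht))).add continuous_const)
      (fun x t ht => ((hwt x t (hbt t (hcI t ht))).add continuousAt_const).continuousWithinAt)
      (fun x hx t ht => ?_) (fun t _ => hQc t) (fun z t ht => ?_) (fun z t ht => ?_)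
      (fun z hz t ht => hQout t (ht.2.trans_lt hcs) z hz)
    · have := abs_le.1 (hMbox x t (hball x (closedBall_subset_ball (by linarith) hx)) (hcI t ht))
      rw [abs_le]; constructor <;> linarith [this.1, this.2]
    · exact (ContinuousAt.comp (g := ramp κ) contDiff_ramp.continuous.continuousAt
        (hasDerivAt_heat_sub (ht.2.trans_lt hcs) (z - y)).continuousAt).continuousWithinAt
    · have hp : 0 < s - t := by linarith [ht.2]
      rw [abs_of_nonneg (ramp_nonneg (heat_pos hp).le)]
      refine (ramp_le (heat_pos hp).le).trans ((heat_le hp _).trans ?_)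
      exact rpow_le_rpow_of_nonpos (by have := sub_pos.2 hcs; positivity)
        (by nlinarith [pi_pos, ht.2]) (by rw [neg_div]; exact neg_nonpos.2 (by positivity))
  have hlimit : ∫ z, (w z a' + M) * Q z a' ≤ w y s + M := by
    have h1 : Tendsto (fun t => ∫ z, (w z t + M) * Q z t) (𝓝[Ioo a' c] a')
        (𝓝 (∫ z, (w z a' + M) * Q z a')) :=
      ((hcont a' ⟨le_rfl, hac.le⟩).mono Ioo_subset_Icc_self).tendsto
    have : (𝓝[Ioo a' c] a').NeBot := by
      rw [nhdsWithin_Ioo_eq_nhdsGT hac]; infer_instance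
    refine le_of_tendsto h1 ?_
    filter_upwards [self_mem_nhdsWithin] with t ht using hLB t ⟨ht.1, ht.2.trans hcs⟩
  have hτ : s - a' ∈ Ioo 0 τ₀ := ⟨sub_pos.2 has, by linarith [hqa.1]⟩
  have hI : 1 - η < ∫ z : Eu N, 1 * ramp κ (heat (s - a') z) := hτ₀b hτ
  simp only [one_mul] at hI
  rw [← integral_sub_right_eq_self _ y] at hI
  have hQi : Integrable fun z => Q z a' :=
    integrable_of_support (x₀ := y) (r := ρ / 4) (hQc a') (hQout a' has)
  have hge : ∫ z, (m + M) * Q z a' ≤ ∫ z, (w z a' + M) * Q z a' := by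
    refine integral_mono (hQi.const_mul _) (integrable_of_support (x₀ := y) (r := ρ / 4)
      (((hwx a' (hbt a' hqa)).add continuous_const).mul (hQc a'))
      fun z hz => by simp [hQout a' has z hz]) fun z => ?_
    by_cases hz : z ∈ closedBall y (ρ / 4)
    · refine mul_le_mul_of_nonneg_right ?_ (ramp_nonneg (heat_pos hτ.1).le)
      have := hlow z (hball z (closedBall_subset_ball (by linarith) hz))
      linarith
    · simp [hQout a' has z hz]
  rw [integral_const_mul] at hge
  have hmM2 : m + M ≤ 2 * M := by
    have := (abs_le.1 (hMbox xs ss (by simpa using hρ.le) ⟨le_rfl, hs⟩)).2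
    have : 0 ≤ n * ρ := by positivity
    linarith
  have h5 : (m + M) * (1 - η) ≤ (m + M) * ∫ z, Q z a' := mul_le_mul_of_nonneg_left hI.le hmM
  have h6 : (m + M) * η ≤ 2 * M * η := mul_le_mul_of_nonneg_right hmM2 hη0.le
  linarith

end

section young

theorem young {η : ℝ} (hη : 0 < η) (a b : ℝ) : a * b ≤ η * a ^ 2 + 1 / (4 * η) * b ^ 2 := by
  have h := sq_nonneg (2 * η * a - b)
  have : η * a ^ 2 + 1 / (4 * η) * b ^ 2 - a * b = (2 * η * a - b) ^ 2 / (4 * η) := by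
    field_simp; ring
  have h2 : 0 ≤ (2 * η * a - b) ^ 2 / (4 * η) := by positivity
  linarith

theorem sq_le_pow_six {η : ℝ} (hη : 0 < η) (t : ℝ) : t ^ 2 ≤ η * t ^ 6 + (1 + 1 / η) := by
  have h1 : 0 < 1 / η := by positivity
  rcases le_or_gt 1 (η * t ^ 4) with h | h
  · nlinarith [mul_le_mul_of_nonneg_right h (sq_nonneg t)]
  · have h2 : t ^ 4 < 1 / η := by rw [lt_div_iff₀ hη]; linarith
    have h3 : 0 ≤ η * t ^ 6 := by positivity
    nlinarith [sq_nonneg (t ^ 2 - 1)]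

theorem pow_four_le_pow_six {η : ℝ} (hη : 0 < η) (t : ℝ) : t ^ 4 ≤ η * t ^ 6 + (1 / η) ^ 2 := by
  rcases le_or_gt 1 (η * t ^ 2) with h | h
  · have : 0 ≤ (1 / η) ^ 2 := by positivity
    nlinarith [mul_le_mul_of_nonneg_right h (by positivity : 0 ≤ t ^ 4)]
  · have h2 : t ^ 2 < 1 / η := by rw [lt_div_iff₀ hη]; linarith
    have h3 : 0 ≤ η * t ^ 6 := by positivity
    have : t ^ 4 ≤ (1 / η) ^ 2 := by
      have := pow_le_pow_left₀ (sq_nonneg t) h2.le 2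
      calc t ^ 4 = (t ^ 2) ^ 2 := by ring
        _ ≤ _ := this
    linarith

theorem absorb_gradient (K : ℝ) {η : ℝ} (hη : 0 < η) :
    ∃ C, 0 ≤ C ∧ ∀ χ v X : ℝ,
      K * (χ ^ 4 * (X * v)) ≤ η * (χ ^ 6 * X ^ 2) + η * (χ ^ 6 * v ^ 6) + C := by
  set D := 1 / (4 * η) * K ^ 2 with hD
  have hD0 : 0 ≤ D := by positivity
  have hη' : 0 < η / (D + 1) := by positivity
  refine ⟨D * (1 + 1 / (η / (D + 1))), by positivity, fun χ v X => ?_⟩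
  have h1 := young hη (χ ^ 3 * X) (K * (χ * v))
  have h2 := mul_le_mul_of_nonneg_left (sq_le_pow_six hη' (χ * v)) hD0
  have h3 : D * (η / (D + 1) * (χ * v) ^ 6) ≤ η * (χ ^ 6 * v ^ 6) := by
    have : D * (η / (D + 1)) ≤ η := by
      rw [mul_div_assoc', div_le_iff₀ (by positivity)]; nlinarith
    calc D * (η / (D + 1) * (χ * v) ^ 6) = (D * (η / (D + 1))) * (χ ^ 6 * v ^ 6) := by ring
      _ ≤ _ := mul_le_mul_of_nonneg_right this (by positivity)
  have e1 : χ ^ 3 * X * (K * (χ * v)) = K * (χ ^ 4 * (X * v)) := by ring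
  have e2 : 1 / (4 * η) * (K * (χ * v)) ^ 2 = D * (χ * v) ^ 2 := by rw [hD]; ring
  rw [e1, e2] at h1
  have e3 : η * (χ ^ 3 * X) ^ 2 = η * (χ ^ 6 * X ^ 2) := by ring
  rw [e3] at h1
  linarith

theorem absorb_time_gradient (K : ℝ) (hK : 0 ≤ K) {η : ℝ} (hη : 0 < η) :
    ∃ C, 0 ≤ C ∧ ∀ θ ∈ Icc (0 : ℝ) 1, ∀ χ ∈ Icc (0 : ℝ) 1, ∀ v X : ℝ,
      K * (θ ^ 5 * χ ^ 6 * (X * v)) ≤ η * (θ ^ 6 * χ ^ 6 * X ^ 2) + η * (θ ^ 6 * χ ^ 6 * v ^ 6) +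
          C := by
  obtain ⟨C, hC, h⟩ := absorb_gradient K hη
  refine ⟨C, hC, fun θ hθ χ hχ v X => ?_⟩
  rcases le_or_gt (X * v) 0 with hX | hX
  · have : K * (θ ^ 5 * χ ^ 6 * (X * v)) ≤ 0 :=
      mul_nonpos_of_nonneg_of_nonpos hK
        (mul_nonpos_of_nonneg_of_nonpos (by have := hθ.1; have := hχ.1; positivity) hX)
    have h2 : 0 ≤ η * (θ ^ 6 * χ ^ 6 * X ^ 2) := by positivity
    have h3 : 0 ≤ η * (θ ^ 6 * χ ^ 6 * v ^ 6) := by positivity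
    linarith
  · have h1 := h (θ * χ) v X
    have h4 : θ ^ 5 * χ ^ 6 ≤ (θ * χ) ^ 4 := by
      have a1 : θ ^ 5 ≤ θ ^ 4 := pow_le_pow_of_le_one hθ.1 hθ.2 (by norm_num)
      have a2 : χ ^ 6 ≤ χ ^ 4 := pow_le_pow_of_le_one hχ.1 hχ.2 (by norm_num)
      rw [mul_pow]
      exact mul_le_mul a1 a2 (by have := hχ.1; positivity) (by have := hθ.1; positivity)
    have h5 := mul_le_mul_of_nonneg_left (mul_le_mul_of_nonneg_right h4 hX.le) hK
    calc _ ≤ _ := h5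
      _ ≤ _ := h1
      _ = _ := by ring

theorem absorb_quartic (K : ℝ) (hK : 0 ≤ K) {η : ℝ} (hη : 0 < η) :
    ∃ C, 0 ≤ C ∧ ∀ θ ∈ Icc (0 : ℝ) 1, ∀ χ ∈ Icc (0 : ℝ) 1, ∀ v : ℝ,
      K * (θ ^ 5 * χ ^ 6 * v ^ 4) ≤ η * (θ ^ 6 * χ ^ 6 * v ^ 6) + C := by
  have hη' : 0 < η / (K + 1) := by positivity
  refine ⟨K * (1 / (η / (K + 1))) ^ 2, by positivity, fun θ hθ χ hχ v => ?_⟩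
  have h1 := mul_le_mul_of_nonneg_left (pow_four_le_pow_six hη' (θ * χ * v)) hK
  have h4 : θ ^ 5 * χ ^ 6 ≤ (θ * χ) ^ 4 := by
    have a1 : θ ^ 5 ≤ θ ^ 4 := pow_le_pow_of_le_one hθ.1 hθ.2 (by norm_num)
    have a2 : χ ^ 6 ≤ χ ^ 4 := pow_le_pow_of_le_one hχ.1 hχ.2 (by norm_num)
    rw [mul_pow]
    exact mul_le_mul a1 a2 (by have := hχ.1; positivity) (by have := hθ.1; positivity)
  have h5 := mul_le_mul_of_nonneg_left
    (mul_le_mul_of_nonneg_right h4 (by positivity : 0 ≤ v ^ 4)) hK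
  have h3 : K * (η / (K + 1) * (θ * χ * v) ^ 6) ≤ η * (θ ^ 6 * χ ^ 6 * v ^ 6) := by
    have : K * (η / (K + 1)) ≤ η := by
      rw [mul_div_assoc', div_le_iff₀ (by positivity)]; nlinarith
    calc K * (η / (K + 1) * (θ * χ * v) ^ 6)
        = (K * (η / (K + 1))) * (θ ^ 6 * χ ^ 6 * v ^ 6) := by ring
      _ ≤ _ := mul_le_mul_of_nonneg_right this (by positivity)
  have e : K * ((θ * χ) ^ 4 * v ^ 4) = K * (θ * χ * v) ^ 4 := by ring
  rw [e] at h5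
  linarith

end young

/-- The divergence of the vector field behind the integral estimate, with exponents `13 / 10` and
`13 / 18`, as a function of the jet of `v`. -/
noncomputable def divField (φ s ℓ g X f L A h n : ℝ) : ℝ :=
  (-(s * L) + φ * (A - L ^ 2) - 1 / 2 * ℓ * g) -
    13 / 10 * (s * X + φ * (2 * h) + φ * (X * L) - φ * X ^ 2) -
    13 / 18 * (s * f + φ * n + φ * (f * L))

theorem divField_lower {φ s ℓ g X f L A h n q : ℝ} (hφ : 0 ≤ φ) (hL : L = q - f)
    (hA : (L - 13 / 10 * X) ^ 2 / 3 ≤ A - 13 / 5 * h + (13 / 10) ^ 2 * X ^ 2) :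
    φ * (1 / 24 * f ^ 2 + 13 / 100 * X ^ 2 - 38 * q ^ 2) - s * q + 5 / 18 * (s * f) -
      13 / 10 * (s * X) - 1 / 2 * ℓ * g ≤
    divField φ s ℓ g X f L A h n + 13 / 18 * φ * (n - 3 * (X * f)) := by
  have key : 1 / 24 * f ^ 2 + 13 / 100 * X ^ 2 - 38 * q ^ 2 ≤
      A - L ^ 2 - 13 / 10 * (2 * h + X * L - X ^ 2) - 13 / 18 * (f * L) - 13 / 6 * (X * f) := by
    subst hL
    nlinarith [sq_nonneg (f + 22 * q), sq_nonneg (X - 27 * q)]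
  have := mul_le_mul_of_nonneg_left key hφ
  unfold divField
  subst hL
  linarith

/-- The pointwise differential inequality for one component. -/
theorem exists_component_bound {Λ A₀ β₀ K : ℝ} (hΛ : 0 ≤ Λ) (hA₀ : 0 ≤ A₀) (hβ₀ : 0 < β₀)
    (hK : 0 ≤ K) :
    ∃ c C : ℝ, 0 < c ∧ 0 ≤ C ∧ ∀ θ ∈ Icc (0 : ℝ) 1, ∀ χ ∈ Icc (0 : ℝ) 1,
      ∀ τ v g X f L p e s ℓ A h n : ℝ, |τ| ≤ A₀ → 0 ≤ v → 0 ≤ X → g = X * v → β₀ * v ^ 3 ≤ f →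
      s ^ 2 ≤ Λ ^ 2 * χ ^ 10 * g → |ℓ| ≤ Λ * χ ^ 4 → L = p - e - f →
      (L - 13 / 10 * X) ^ 2 / 3 ≤ A - 13 / 5 * h + (13 / 10) ^ 2 * X ^ 2 →
      θ ^ 6 * (-(χ ^ 6 * (p ^ 2 - p * e)) - p * s) + 3 * θ ^ 5 * τ * χ ^ 6 * g +
        K * (θ ^ 5 * χ ^ 6 * v ^ 4) ≤
      θ ^ 6 * (1 / 156) * (divField (χ ^ 6) s ℓ g X f L A h n +
        13 / 18 * χ ^ 6 * (n - 3 * (X * f))) - c * (θ ^ 6 * χ ^ 6 * v ^ 6) +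
            C * (χ ^ 6 * e ^ 2 + 1) := by
  set c := β₀ ^ 2 / 40000 with hc
  have hc0 : 0 < c := by positivity
  set η := min c (1 / 40000) with hη
  have hη0 : 0 < η := lt_min hc0 (by norm_num)
  have hη1 : η ≤ c := min_le_left _ _
  have hη2 : η ≤ 1 / 40000 := min_le_right _ _
  obtain ⟨C₁, hC₁, h1⟩ := absorb_gradient (Λ ^ 2 + (1 / 156) * (Λ ^ 2 * 50 + Λ)) hη0
  obtain ⟨C₂, hC₂, h2⟩ := absorb_time_gradient (3 * A₀) (by positivity) hη0
  obtain ⟨C₃, hC₃, h3⟩ := absorb_quartic K hK hη0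
  refine ⟨c, 2 + C₁ + C₂ + C₃, hc0, by positivity,
      fun θ hθ χ hχ τ v g X f L p e s ℓ A h n hτ hv hX hg
    hf hs hℓ hL hA => ?_⟩
  have hχ0 := hχ.1
  have hθ0 := hθ.1
  have hg0 : 0 ≤ g := by rw [hg]; positivity
  set φ := χ ^ 6 with hφ
  have hφ0 : 0 ≤ φ := by positivity
  set Y := χ ^ 4 * g with hY
  have hY0 : 0 ≤ Y := by positivity
  have hs' : s ^ 2 ≤ Λ ^ 2 * Y * φ := by rw [hY, hφ]; calc _ ≤ _ := hs
                                            _ = _ := by ring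
  have sbound : ∀ ε > 0, ∀ z : ℝ, |s * z| ≤ ε * (φ * z ^ 2) + 1 / (4 * ε) * (Λ ^ 2 * Y) := by
    intro ε hε z
    refine abs_le_of_sq_le_sq ?_ (by positivity)
    have : (s * z) ^ 2 ≤ (Λ ^ 2 * Y) * (φ * z ^ 2) := by
      rw [mul_pow]
      calc s ^ 2 * z ^ 2 ≤ (Λ ^ 2 * Y * φ) * z ^ 2 := mul_le_mul_of_nonneg_right hs' (sq_nonneg z)
        _ = _ := by ring
    refine this.trans ?_
    have h4 := sq_nonneg (ε * (φ * z ^ 2) - 1 / (4 * ε) * (Λ ^ 2 * Y))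
    have e4 : (ε * (φ * z ^ 2)) * (1 / (4 * ε) * (Λ ^ 2 * Y)) = (Λ ^ 2 * Y) * (φ * z ^ 2) / 4 := by
      field_simp
    linarith only [h4, e4]
  have hlow := divField_lower (s := s) (ℓ := ℓ) (g := g) (n := n) (q := p - e) hφ0 hL hA
  have s1 := (abs_le.1 (sbound 1 one_pos (p - e))).2
  have s2 := (abs_le.1 (sbound (1 / 100) (by norm_num) f)).1
  have s3 := (abs_le.1 (sbound (1 / 100) (by norm_num) X)).2
  have s4 := (abs_le.1 (sbound (1 / 4) (by norm_num) p)).1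
  have s5 : ℓ * g ≤ Λ * Y := by
    calc ℓ * g ≤ (Λ * χ ^ 4) * g := mul_le_mul_of_nonneg_right ((le_abs_self _).trans hℓ) hg0
      _ = _ := by rw [hY]; ring
  have hΛY : 0 ≤ Λ ^ 2 * Y := by positivity
  have hΛY' : 0 ≤ Λ * Y := by positivity
  set D := divField φ s ℓ g X f L A h n + 13 / 18 * φ * (n - 3 * (X * f)) with hD
  have hDlow : φ * (1 / 32 * f ^ 2 + 11 / 100 * X ^ 2 - 39 * (p - e) ^ 2) -
      (50 * Λ ^ 2 + Λ) * Y ≤ D := by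
    have a1 : 0 ≤ φ * f ^ 2 := by positivity
    have a2 : 0 ≤ φ * X ^ 2 := by positivity
    norm_num at s1 s2 s3
    linarith only [s1, s2, s3, s5, hlow, a1, a2, hΛY, hΛY']
  have hpe : (p - e) ^ 2 ≤ 2 * p ^ 2 + 2 * e ^ 2 := by linarith only [sq_nonneg (p + e)]
  have hpe2 : p * e ≤ 1 / 4 * p ^ 2 + e ^ 2 := by linarith only [sq_nonneg (p / 2 - e)]
  have b1 := mul_le_mul_of_nonneg_left hpe hφ0
  have b2 := mul_le_mul_of_nonneg_left hpe2 hφ0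
  have slice : -(φ * (p ^ 2 - p * e)) - p * s ≤ 1 / 156 * D -
      1 / 156 * (φ * (1 / 32 * f ^ 2 + 11 / 100 * X ^ 2)) + 2 * (φ * e ^ 2) +
      (Λ ^ 2 + (1 / 156) * (Λ ^ 2 * 50 + Λ)) * Y := by
    have a1 : 0 ≤ φ * e ^ 2 := by positivity
    norm_num at s4
    linarith only [s4, hDlow, b1, b2, a1, hΛY, hΛY']
  have hf2 : β₀ ^ 2 * v ^ 6 ≤ f ^ 2 := by
    have := pow_le_pow_left₀ (by positivity) hf 2
    calc _ = (β₀ * v ^ 3) ^ 2 := by ring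
      _ ≤ _ := this
  have hY2 := h1 χ v X
  rw [← hg, ← hY] at hY2
  have slice2 : -(φ * (p ^ 2 - p * e)) - p * s ≤ 1 / 156 * D - 4 * c * (φ * v ^ 6) -
      1 / 2000 * (φ * X ^ 2) + 2 * (φ * e ^ 2) + C₁ := by
    have a1 := mul_le_mul_of_nonneg_left hf2 hφ0
    have a2 : η * (φ * v ^ 6) ≤ c * (φ * v ^ 6) := mul_le_mul_of_nonneg_right hη1 (by positivity)
    have a3 : η * (φ * X ^ 2) ≤ 1 / 40000 * (φ * X ^ 2) :=
      mul_le_mul_of_nonneg_right hη2 (by positivity)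
    have a4 : φ * (β₀ ^ 2 * v ^ 6) = 40000 * (c * (φ * v ^ 6)) := by rw [hc]; ring
    have a5 : 0 ≤ c * (φ * v ^ 6) := by positivity
    have a6 : 0 ≤ φ * X ^ 2 := by positivity
    linarith only [slice, a1, a2, a3, a4, a5, a6, hY2]
  have hθ6 : 0 ≤ θ ^ 6 := by positivity
  have hθ61 : θ ^ 6 ≤ 1 := pow_le_one₀ hθ0 hθ.2
  have t1 := mul_le_mul_of_nonneg_left slice2 hθ6
  have t2 : 3 * θ ^ 5 * τ * φ * g ≤ 3 * A₀ * (θ ^ 5 * φ * (X * v)) := by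
    rw [← hg]
    have := mul_le_mul_of_nonneg_right ((le_abs_self τ).trans hτ)
      (by positivity : 0 ≤ 3 * (θ ^ 5 * φ * g))
    linarith only [this]
  have t3 := h2 θ hθ χ hχ v X
  have t4 := h3 θ hθ χ hχ v
  have a2 : η * (θ ^ 6 * φ * v ^ 6) ≤ c * (θ ^ 6 * φ * v ^ 6) :=
    mul_le_mul_of_nonneg_right hη1 (by positivity)
  have a3 : η * (θ ^ 6 * φ * X ^ 2) ≤ 1 / 40000 * (θ ^ 6 * φ * X ^ 2) :=
    mul_le_mul_of_nonneg_right hη2 (by positivity)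
  have a5 : 0 ≤ c * (θ ^ 6 * φ * v ^ 6) := by positivity
  have a6 : 0 ≤ θ ^ 6 * φ * X ^ 2 := by positivity
  have a7 : θ ^ 6 * (φ * e ^ 2) ≤ φ * e ^ 2 := mul_le_of_le_one_left (by positivity) hθ61
  have a8 : θ ^ 6 * C₁ ≤ C₁ := mul_le_of_le_one_left hC₁ hθ61
  have hφe : 0 ≤ φ * e ^ 2 := by positivity
  have a9 : 0 ≤ (C₁ + C₂ + C₃) * (φ * e ^ 2) := by positivity
  linarith only [t1, t2, t3, t4, a2, a3, a5, a6, a7, a8, a9, hφe]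

section slice

variable {N : ℕ} {a b f g v φ : Eu N → ℝ} {x : Eu N}

/-- The inner product of the gradients. -/
noncomputable def gdot (f g : Eu N → ℝ) (x : Eu N) : ℝ := ∑ k, pd k f x * pd k g x

theorem gdot_self_nonneg (f : Eu N → ℝ) (x : Eu N) : 0 ≤ gdot f f x :=
  Finset.sum_nonneg fun _ _ => mul_self_nonneg _

theorem gdot_sq_le (f g : Eu N → ℝ) (x : Eu N) :
    gdot f g x ^ 2 ≤ gdot f f x * gdot g g x := by
  have := Finset.sum_mul_sq_le_sq_mul_sq Finset.univ (fun k => pd k f x) (fun k => pd k g x)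
  simpa only [gdot, sq] using this

theorem gdot_mul (hf : DifferentiableAt ℝ f x) (hg : DifferentiableAt ℝ g x) (h : Eu N → ℝ) :
    gdot (fun y => f y * g y) h x = f x * gdot g h x + g x * gdot f h x := by
  simp only [gdot, Finset.mul_sum, ← Finset.sum_add_distrib]
  exact Finset.sum_congr rfl fun k _ => by rw [pd_mul hf hg]; ring

theorem gdot_comm (f g : Eu N → ℝ) (x : Eu N) : gdot f g x = gdot g f x :=
  Finset.sum_congr rfl fun _ _ => mul_comm _ _

theorem gdot_inv (hf : DifferentiableAt ℝ f x) (h0 : f x ≠ 0) (h : Eu N → ℝ) :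
    gdot (fun y => (f y)⁻¹) h x = -gdot f h x / f x ^ 2 := by
  simp only [gdot, Finset.sum_div, ← Finset.sum_neg_distrib]
  refine Finset.sum_congr rfl fun k _ => ?_
  have := pd_comp (i := k) (Φ := fun s => s⁻¹) (differentiableAt_inv h0) hf
  rw [this, deriv_inv]
  ring

theorem contDiff_gdot {n : WithTop ℕ∞} (hf : ContDiff ℝ (n + 1) f) (hg : ContDiff ℝ (n + 1) g) :
    ContDiff ℝ n (gdot f g) :=
  ContDiff.sum fun _ _ => (contDiff_pd hf le_rfl).mul (contDiff_pd hg le_rfl)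

theorem contDiff_lap (hf : ContDiff ℝ 3 f) : ContDiff ℝ 1 (lap f) := by
  have : lap f = fun x => ∑ i, pd i (pd i f) x := funext fun x => lap_eq (hf.of_le (by norm_num))
  rw [this]
  exact ContDiff.sum fun i _ => contDiff_one_pd (contDiff_pd hf (by norm_num))

theorem pd_comm (hf : ContDiff ℝ 2 f) (i j : Fin N) (x : Eu N) :
    pd i (pd j f) x = pd j (pd i f) x := by
  have h1 : DifferentiableAt ℝ (fderiv ℝ f) x :=
    (hf.fderiv_right (m := 1) (by norm_num)).differentiable (by norm_num) x
  have h2 : ∀ k l : Fin N, pd k (pd l f) x =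
      fderiv ℝ (fderiv ℝ f) x (EuclideanSpace.single k 1) (EuclideanSpace.single l 1) := by
    intro k l
    have : pd l f = fun y => fderiv ℝ f y (EuclideanSpace.single l 1) := rfl
    rw [pd, this, fderiv_clm_apply h1 (by fun_prop)]
    simp
  rw [h2, h2]
  exact (hf.contDiffAt.isSymmSndFDerivAt (by simp)).eq _ _

/-- The divergence of `a ∇b`. -/
theorem sum_pd_mul_pd (ha : Differentiable ℝ a) (hb : ContDiff ℝ 2 b) (x : Eu N) :
    ∑ k, pd k (fun y => a y * pd k b y) x = gdot a b x + a x * lap b x := by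
  rw [lap_eq hb, gdot, Finset.mul_sum, ← Finset.sum_add_distrib]
  exact Finset.sum_congr rfl fun k _ => pd_mul (ha x) (differentiable_pd hb x)

/-- Compactly supported divergences. -/
def IsDiv (D : Eu N → ℝ) : Prop := Continuous D ∧ HasCompactSupport D ∧ ∫ x, D x = 0

theorem IsDiv.integrable {D : Eu N → ℝ} (h : IsDiv D) : Integrable D :=
  h.1.integrable_of_hasCompactSupport h.2.1

theorem IsDiv.add {D D' : Eu N → ℝ} (h : IsDiv D) (h' : IsDiv D') :
    IsDiv fun x => D x + D' x :=
  ⟨h.1.add h'.1, h.2.1.add h'.2.1, by rw [integral_add h.integrable h'.integrable, h.2.2, h'.2.2,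
      add_zero]⟩

theorem IsDiv.const_mul {D : Eu N → ℝ} (h : IsDiv D) (c : ℝ) : IsDiv fun x => c * D x :=
  ⟨h.1.const_mul c, h.2.1.mul_left, by rw [integral_const_mul, h.2.2, mul_zero]⟩

theorem IsDiv.sum {ι : Type*} (s : Finset ι) {D : ι → Eu N → ℝ} (h : ∀ i ∈ s, IsDiv (D i)) :
    IsDiv fun x => ∑ i ∈ s, D i x := by
  classical
  induction s using Finset.induction_on with
  | empty => simpa using ⟨continuous_const, HasCompactSupport.zero, by simp⟩
  | insert i s hi ih =>
    simp only [Finset.sum_insert hi]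
    exact (h i (Finset.mem_insert_self _ _)).add
      (ih fun j hj => h j (Finset.mem_insert_of_mem hj))

theorem isDiv_pd {i : Fin N} (hf : ContDiff ℝ 1 f) (hs : HasCompactSupport f) : IsDiv (pd i f) :=
  ⟨continuous_pd hf, hasCompactSupport_pd hs, integral_pd_eq_zero hf hs⟩

theorem isDiv_mul_grad (ha : ContDiff ℝ 1 a) (hb : ContDiff ℝ 2 b)
    (hs : HasCompactSupport a ∨ HasCompactSupport b) :
    IsDiv fun x => gdot a b x + a x * lap b x := by
  have e : (fun x => gdot a b x + a x * lap b x) =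
      fun x => ∑ k, pd k (fun y => a y * pd k b y) x :=
    funext fun x => (sum_pd_mul_pd (ha.differentiable (by norm_num)) hb x).symm
  rw [e]
  refine IsDiv.sum _ fun k _ => isDiv_pd (ha.mul (contDiff_one_pd hb)) ?_
  exact hs.elim (fun h => h.mul_right) fun h => (hasCompactSupport_pd h).mul_left

theorem lap_pd (hv : ContDiff ℝ 3 v) (l : Fin N) (x : Eu N) : lap (pd l v) x = pd l (lap v) x := by
  have hv2 : ContDiff ℝ 2 v := hv.of_le (by norm_num)
  have hp : ∀ k, ContDiff ℝ 2 (pd k v) := fun k => contDiff_pd hv (by norm_num)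
  have : lap v = fun x => ∑ i, pd i (pd i v) x := funext fun x => lap_eq hv2
  rw [lap_eq (hp l), this, pd_sum _ fun k _ => differentiable_pd (hp k) x]
  refine Finset.sum_congr rfl fun k _ => ?_
  have e : pd k (pd l v) = pd l (pd k v) := funext fun y => pd_comm hv2 k l y
  rw [e, pd_comm (hp k)]

/-- Bochner's formula. -/
theorem bochner (hv : ContDiff ℝ 3 v) (x : Eu N) :
    1 / 2 * lap (gdot v v) x - gdot v (lap v) x = ∑ k, ∑ l, pd k (pd l v) x ^ 2 := by
  have hp : ∀ k, ContDiff ℝ 2 (pd k v) := fun k => contDiff_pd hv (by norm_num)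
  have hg : ContDiff ℝ 2 (gdot v v) := contDiff_gdot hv hv
  have h1 : lap (gdot v v) x = ∑ l, lap (fun y => pd l v y * pd l v y) x := by
    have : ∀ k y, pd k (gdot v v) y = ∑ l, pd k (fun z => pd l v z * pd l v z) y := fun k y => by
      unfold gdot
      exact pd_sum _ fun l _ => ((hp l).mul (hp l)).differentiable (by norm_num) y
    rw [lap_eq hg]
    simp only [lap_eq ((hp _).mul (hp _))]
    rw [Finset.sum_comm]
    refine Finset.sum_congr rfl fun k _ => ?_
    rw [funext (this k)]
    exact pd_sum _ fun l _ => differentiable_pd ((hp l).mul (hp l)) x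
  rw [h1, Finset.sum_comm, gdot, Finset.mul_sum, ← Finset.sum_sub_distrib]
  refine Finset.sum_congr rfl fun l _ => ?_
  rw [lap_mul (hp l) (hp l), lap_pd hv]
  simp only [← sq]
  ring

theorem sum_gdot_pd (hv : ContDiff ℝ 3 v) (x : Eu N) :
    gdot (gdot v v) v x = 2 * ∑ k, ∑ l, pd k (pd l v) x * (pd k v x * pd l v x) := by
  have hp : ∀ k, ContDiff ℝ 2 (pd k v) := fun k => contDiff_pd hv (by norm_num)
  rw [gdot, Finset.mul_sum]
  refine Finset.sum_congr rfl fun k _ => ?_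
  have : pd k (gdot v v) x = ∑ l, 2 * (pd k (pd l v) x * pd l v x) := by
    unfold gdot
    rw [pd_sum _ fun l _ => ((hp l).mul (hp l)).differentiable (by norm_num) x]
    refine Finset.sum_congr rfl fun l _ => ?_
    have := (hp l).differentiable (by norm_num) x
    rw [pd_mul this this]; ring
  rw [this, Finset.sum_mul, Finset.mul_sum]
  exact Finset.sum_congr rfl fun l _ => by ring

/-- The trace inequality for the Hessian of `v` corrected by a rank one term. -/
theorem trace_ineq (hN3 : N ≤ 3) (hv : ContDiff ℝ 3 v) (x : Eu N) (μ : ℝ) :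
    (lap v x - μ * (gdot v v x / v x)) ^ 2 / 3 ≤
      (1 / 2 * lap (gdot v v) x - gdot v (lap v) x) -
        2 * μ * (1 / 2 * gdot (gdot v v) v x / v x) + μ ^ 2 * (gdot v v x / v x) ^ 2 := by
  set M : Fin N → Fin N → ℝ := fun k l => pd k (pd l v) x - μ * (pd k v x * pd l v x / v x) with hM
  have e1 : lap v x - μ * (gdot v v x / v x) = ∑ k, M k k := by
    rw [lap_eq (hv.of_le (by norm_num)), gdot, Finset.sum_div, Finset.mul_sum,
      ← Finset.sum_sub_distrib]
  have e2 : (gdot v v x) ^ 2 = ∑ k, ∑ l, (pd k v x * pd l v x) ^ 2 := by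
    rw [gdot, sq, Finset.sum_mul_sum]
    exact Finset.sum_congr rfl fun k _ => Finset.sum_congr rfl fun l _ => by ring
  have e3 : ∑ k, ∑ l, M k l ^ 2 = (1 / 2 * lap (gdot v v) x - gdot v (lap v) x) -
        2 * μ * (1 / 2 * gdot (gdot v v) v x / v x) + μ ^ 2 * (gdot v v x / v x) ^ 2 := by
    rw [bochner hv, sum_gdot_pd hv, div_pow, e2]
    have : ∀ S T : ℝ, 2 * μ * (1 / 2 * (2 * S) / v x) = (2 * μ / v x) * S ∧
      μ ^ 2 * (T / v x ^ 2) = (μ ^ 2 / v x ^ 2) * T := fun S T => ⟨by ring, by ring⟩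
    rw [(this _ 0).1, (this 0 _).2]
    simp only [Finset.mul_sum, ← Finset.sum_sub_distrib, ← Finset.sum_add_distrib, hM]
    exact Finset.sum_congr rfl fun k _ => Finset.sum_congr rfl fun l _ => by ring
  rw [e1, ← e3]
  have h1 : (∑ k, M k k) ^ 2 ≤ N * ∑ k, M k k ^ 2 := by
    simpa using sq_sum_le_card_mul_sum_sq (s := Finset.univ) (f := fun k => M k k)
  have h2 : ∑ k, M k k ^ 2 ≤ ∑ k, ∑ l, M k l ^ 2 := Finset.sum_le_sum fun k _ =>
    Finset.single_le_sum (f := fun l => M k l ^ 2) (fun l _ => sq_nonneg _) (Finset.mem_univ k)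
  have h3 : 0 ≤ ∑ k, M k k ^ 2 := Finset.sum_nonneg fun k _ => sq_nonneg _
  have h4 : (N : ℝ) ≤ 3 := by exact_mod_cast hN3
  nlinarith

theorem isDiv_divField (hv : ContDiff ℝ 3 v) (h0 : ∀ x, v x ≠ 0) (hφ : ContDiff ℝ 2 φ)
    (hs : HasCompactSupport φ) (hf : ContDiff ℝ 1 f) :
    IsDiv fun x => divField (φ x) (gdot φ v x) (lap φ x) (gdot v v x) (gdot v v x / v x) (f x)
      (lap v x) (1 / 2 * lap (gdot v v) x - gdot v (lap v) x)
      (1 / 2 * gdot (gdot v v) v x / v x) (gdot f v x) := by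
  have hv2 : ContDiff ℝ 2 v := hv.of_le (by norm_num)
  have hv1 : ContDiff ℝ 1 v := hv.of_le (by norm_num)
  have hφ1 : ContDiff ℝ 1 φ := hφ.of_le (by norm_num)
  have hg : ContDiff ℝ 2 (gdot v v) := contDiff_gdot hv hv
  have hg1 : ContDiff ℝ 1 (gdot v v) := hg.of_le (by norm_num)
  have hL := contDiff_lap hv
  have hi : ContDiff ℝ 1 fun x => (v x)⁻¹ := hv1.inv h0
  have hX := hg1.mul hi
  have d1 : ∀ {w : Eu N → ℝ}, ContDiff ℝ 1 w → Differentiable ℝ w :=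
    fun h => h.differentiable (by norm_num)
  have i1 := isDiv_mul_grad hφ1 hg (Or.inl hs)
  have i2 := isDiv_mul_grad (hφ1.mul hL) hv2 (Or.inl hs.mul_right)
  have i3 := isDiv_mul_grad hg1 hφ (Or.inr hs)
  have i4 := isDiv_mul_grad (hφ1.mul hX) hv2 (Or.inl hs.mul_right)
  have i5 := isDiv_mul_grad (hφ1.mul hf) hv2 (Or.inl hs.mul_right)
  have := ((((i1.const_mul (1 / 2)).add (i2.const_mul (-1))).add (i3.const_mul (-1 / 2))).add
    (i4.const_mul (-13 / 10))).add (i5.const_mul (-13 / 18))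
  convert this using 2 with x
  rw [gdot_mul (d1 hφ1 x) (d1 hL x), gdot_mul (d1 hφ1 x) (d1 hX x), gdot_mul (d1 hφ1 x) (d1 hf x),
    gdot_mul (d1 hg1 x) (d1 hi x), gdot_inv (d1 hv1 x) (h0 x), gdot_comm (lap v) v,
    gdot_comm (gdot v v) φ]
  unfold divField
  have := h0 x
  field_simp
  ring

end slice

section system

variable {N m : ℕ} {β : Fin m → Fin m → ℝ}

/-- The cubic nonlinearity. -/
def cubic (β : Fin m → Fin m → ℝ) (a : Fin m → ℝ) (i : Fin m) : ℝ :=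
  ∑ j, β i j * a i * a j ^ 2

/-- The potential of the cubic nonlinearity. -/
noncomputable def potential (β : Fin m → Fin m → ℝ) (a : Fin m → ℝ) : ℝ :=
  1 / 4 * ∑ i, ∑ j, β i j * a i ^ 2 * a j ^ 2

theorem cubic_nonneg (hβ : ∀ i j, 0 ≤ β i j) {a : Fin m → ℝ} (ha : ∀ i, 0 ≤ a i) (i : Fin m) :
    0 ≤ cubic β a i :=
  Finset.sum_nonneg fun j _ => by have := hβ i j; have := ha i; positivity

theorem mul_pow_three_le_cubic (hβ : ∀ i j, 0 ≤ β i j) {a : Fin m → ℝ} (ha : ∀ i, 0 ≤ a i)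
    (i : Fin m) : β i i * a i ^ 3 ≤ cubic β a i := by
  have := Finset.single_le_sum (f := fun j => β i j * a i * a j ^ 2)
    (fun j _ => by have := hβ i j; have := ha i; positivity) (Finset.mem_univ i)
  calc β i i * a i ^ 3 = β i i * a i * a i ^ 2 := by ring
    _ ≤ _ := this

theorem potential_nonneg (hβ : ∀ i j, 0 ≤ β i j) (a : Fin m → ℝ) : 0 ≤ potential β a :=
  mul_nonneg (by norm_num) (Finset.sum_nonneg fun i _ => Finset.sum_nonneg fun j _ => by
    have := hβ i j; positivity)

theorem potential_le (hβ : ∀ i j, 0 ≤ β i j) (a : Fin m → ℝ) :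
    potential β a ≤ 1 / 4 * (∑ i, ∑ j, β i j) * ∑ k, a k ^ 4 := by
  have hk : ∀ i, a i ^ 4 ≤ ∑ k, a k ^ 4 := fun i =>
    Finset.single_le_sum (f := fun k => a k ^ 4) (fun k _ => by positivity) (Finset.mem_univ i)
  rw [potential, mul_assoc, Finset.sum_mul]
  refine mul_le_mul_of_nonneg_left (Finset.sum_le_sum fun i _ => ?_) (by norm_num)
  rw [Finset.sum_mul]
  refine Finset.sum_le_sum fun j _ => ?_
  rw [mul_assoc]
  refine mul_le_mul_of_nonneg_left ?_ (hβ i j)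
  nlinarith [hk i, hk j, sq_nonneg (a i ^ 2 - a j ^ 2)]

theorem contDiff_cubic {n : WithTop ℕ∞} {v : Fin m → Eu N → ℝ} (hv : ∀ i, ContDiff ℝ n (v i))
    (i : Fin m) : ContDiff ℝ n fun x => cubic β (fun j => v j x) i :=
  ContDiff.sum fun j _ => ((contDiff_const.mul (hv i)).mul ((hv j).pow 2))

theorem gdot_cubic {v : Fin m → Eu N → ℝ} (hv : ∀ i, Differentiable ℝ (v i)) (i : Fin m)
    (x : Eu N) :
    gdot (fun y => cubic β (fun j => v j y) i) (v i) x =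
      ∑ j, β i j * (gdot (v i) (v i) x * v j x ^ 2 + 2 * (v i x * v j x * gdot (v j) (v i) x)) := by
  have h : ∀ k, pd k (fun y => cubic β (fun j => v j y) i) x =
      ∑ j, β i j * (pd k (v i) x * v j x ^ 2 + 2 * (v i x * v j x * pd k (v j) x)) := by
    intro k
    unfold cubic
    rw [pd_sum _ fun j _ => by have := hv i x; have := hv j x; fun_prop]
    refine Finset.sum_congr rfl fun j _ => ?_
    have h1 := hv i x
    have h2 := hv j x
    have e : (fun y => β i j * v i y * v j y ^ 2) = fun y => β i j * (v i y * (v j y * v j y)) := by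
      funext y; ring
    rw [e, pd_const_mul _ (by fun_prop), pd_mul h1 (by fun_prop), pd_mul h2 h2]
    ring
  simp only [gdot, h, Finset.sum_mul, Finset.mul_sum]
  rw [Finset.sum_comm]
  refine Finset.sum_congr rfl fun j _ => ?_
  rw [← Finset.sum_add_distrib, Finset.mul_sum]
  exact Finset.sum_congr rfl fun k _ => by ring

/-- The gradients of the nonlinearity are controlled because the system is variational. -/
theorem sum_gdot_cubic_le (hβ : ∀ i j, 0 ≤ β i j) (hsym : ∀ i j, β i j = β j i)
    {v : Fin m → Eu N → ℝ} (hv : ∀ i, Differentiable ℝ (v i)) {x : Eu N} (h0 : ∀ i, 0 < v i x) :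
    ∑ i, gdot (fun y => cubic β (fun j => v j y) i) (v i) x ≤
      ∑ i, 3 * (gdot (v i) (v i) x / v i x * cubic β (fun j => v j x) i) := by
  have e1 : ∀ i, gdot (v i) (v i) x / v i x * cubic β (fun j => v j x) i =
      ∑ j, β i j * (gdot (v i) (v i) x * v j x ^ 2) := by
    intro i
    rw [cubic, Finset.mul_sum]
    refine Finset.sum_congr rfl fun j _ => ?_
    have := (h0 i).ne'
    field_simp
  have e2 : ∀ i j, 2 * (v i x * v j x * gdot (v j) (v i) x) ≤
      gdot (v i) (v i) x * v j x ^ 2 + gdot (v j) (v j) x * v i x ^ 2 := by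
    intro i j
    simp only [gdot, Finset.mul_sum, Finset.sum_mul, ← Finset.sum_add_distrib]
    refine Finset.sum_le_sum fun k _ => ?_
    nlinarith [sq_nonneg (v j x * pd k (v i) x - v i x * pd k (v j) x)]
  have e3 : ∑ i, ∑ j, β i j * (gdot (v j) (v j) x * v i x ^ 2) =
      ∑ i, ∑ j, β i j * (gdot (v i) (v i) x * v j x ^ 2) := by
    rw [Finset.sum_comm]
    exact Finset.sum_congr rfl fun i _ => Finset.sum_congr rfl fun j _ => by rw [hsym]
  calc _ ≤ ∑ i, ∑ j, (2 * (β i j * (gdot (v i) (v i) x * v j x ^ 2)) +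
        β i j * (gdot (v j) (v j) x * v i x ^ 2)) := by
        refine Finset.sum_le_sum fun i _ => ?_
        rw [gdot_cubic hv]
        refine Finset.sum_le_sum fun j _ => ?_
        have := mul_le_mul_of_nonneg_left (e2 i j) (hβ i j)
        linarith
    _ = _ := by
        simp only [e1, Finset.sum_add_distrib, ← Finset.mul_sum, e3]
        ring

end system

section system

variable {N m : ℕ} {β : Fin m → Fin m → ℝ}

/-- A cutoff whose sixth power has controlled derivatives. -/
structure Cutoff (Λ : ℝ) (χ : Eu N → ℝ) : Prop where
  c2 : ContDiff ℝ 2 χ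
  mem : ∀ x, χ x ∈ Icc (0 : ℝ) 1
  supp : ∀ x ∉ closedBall 0 (3 / 4), χ x = 0
  grad : ∀ x, gdot (fun y => χ y ^ 6) (fun y => χ y ^ 6) x ≤ Λ ^ 2 * χ x ^ 10
  lap : ∀ x, |lap (fun y => χ y ^ 6) x| ≤ Λ * χ x ^ 4

theorem Cutoff.hasCompactSupport {Λ : ℝ} {χ : Eu N → ℝ} (h : Cutoff Λ χ) :
    HasCompactSupport fun y => χ y ^ 6 :=
  HasCompactSupport.intro (isCompact_closedBall (0 : Eu N) (3 / 4)) fun x hx => by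
      simp [h.supp x hx]

theorem Cutoff.contDiff {Λ : ℝ} {χ : Eu N → ℝ} (h : Cutoff Λ χ) :
    ContDiff ℝ 2 fun y => χ y ^ 6 := h.c2.pow 6

/-- The residual `p - Δv - f(v)` of the system. -/
noncomputable def residual (β : Fin m → Fin m → ℝ) (v p : Fin m → Eu N → ℝ) (i : Fin m)
    (x : Eu N) : ℝ :=
  p i x - lap (v i) x - cubic β (fun j => v j x) i

/-- The density of the time derivative of the localized energy, when `p` is the time derivative of
`v`. -/
noncomputable def energyRate (β : Fin m → Fin m → ℝ) (v p : Fin m → Eu N → ℝ) (x : Eu N) : ℝ :=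
  ∑ i, (gdot (v i) (p i) x - cubic β (fun j => v j x) i * p i x)

/-- The energy density. -/
noncomputable def energy (β : Fin m → Fin m → ℝ) (v : Fin m → Eu N → ℝ) (x : Eu N) : ℝ :=
  1 / 2 * ∑ i, gdot (v i) (v i) x - potential β fun j => v j x

theorem integral_combine_mono {α : Type*} [MeasurableSpace α] {μ : Measure α}
    {f₁ f₂ g₁ g₂ g₃ g₄ : α → ℝ} {a b c d : ℝ} (h₁ : Integrable f₁ μ) (h₂ : Integrable f₂ μ)
    (k₁ : Integrable g₁ μ) (k₂ : Integrable g₂ μ) (k₃ : Integrable g₃ μ) (k₄ : Integrable g₄ μ)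
    (h : ∀ x, a * f₁ x + b * f₂ x ≤ g₁ x - c * g₂ x + d * g₃ x + g₄ x) :
    a * ∫ x, f₁ x ∂μ + b * ∫ x, f₂ x ∂μ ≤
      ∫ x, g₁ x ∂μ - c * ∫ x, g₂ x ∂μ + d * ∫ x, g₃ x ∂μ + ∫ x, g₄ x ∂μ := by
  have l₁ : Integrable (fun x => a * f₁ x + b * f₂ x) μ := (h₁.const_mul a).add (h₂.const_mul b)
  have l₂ : Integrable (fun x => g₁ x - c * g₂ x) μ := k₁.sub (k₂.const_mul c)
  have l₃ : Integrable (fun x => g₁ x - c * g₂ x + d * g₃ x) μ := l₂.add (k₃.const_mul d)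
  have := integral_mono l₁ (l₃.add k₄) h
  rw [integral_add (h₁.const_mul a) (h₂.const_mul b), integral_add' l₃ k₄,
    integral_add l₂ (k₃.const_mul d), integral_sub k₁ (k₂.const_mul c)] at this
  simpa only [integral_const_mul] using this

theorem exists_slice_bound (hN3 : N ≤ 3) (hβ : ∀ i j, 0 ≤ β i j) (hsym : ∀ i j, β i j = β j i)
    (hdiag : ∀ i, 0 < β i i) {Λ A₀ : ℝ} (hΛ : 0 ≤ Λ) (hA₀ : 0 ≤ A₀) :
    ∃ c C : ℝ, 0 < c ∧ 0 ≤ C ∧ ∀ θ ∈ Icc (0 : ℝ) 1, ∀ τ : ℝ, |τ| ≤ A₀ →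
      ∀ χ : Eu N → ℝ, Cutoff Λ χ → ∀ v p : Fin m → Eu N → ℝ, (∀ i, ContDiff ℝ 3 (v i)) →
      (∀ i x, 0 < v i x) → (∀ i, ContDiff ℝ 1 (p i)) →
      θ ^ 6 * (∫ x, χ x ^ 6 * energyRate β v p x) +
        6 * θ ^ 5 * τ * (∫ x, χ x ^ 6 * energy β v x) ≤
      -(c * θ ^ 6 * ∫ x, χ x ^ 6 * ∑ i, v i x ^ 6) +
        C * ((∫ x, χ x ^ 6 * ∑ i, residual β v p i x ^ 2) + 1) := by
  obtain ⟨β₀, hβ₀, hβ₀'⟩ : ∃ β₀ > 0, ∀ i, β₀ ≤ β i i := by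
    rcases isEmpty_or_nonempty (Fin m) with h | h
    · exact ⟨1, one_pos, fun i => h.elim i⟩
    · obtain ⟨i, hi⟩ := Finite.exists_min fun i => β i i
      exact ⟨β i i, hdiag i, hi⟩
  set B := ∑ i, ∑ j, β i j with hB
  have hB0 : 0 ≤ B := Finset.sum_nonneg fun i _ => Finset.sum_nonneg fun j _ => hβ i j
  set K := 6 * A₀ * (1 / 4 * B) with hK
  obtain ⟨c, C, hc, hC, key⟩ := exists_component_bound (K := K) hΛ hA₀ hβ₀ (by positivity)
  set V := (volume (closedBall (0 : Eu N) (3 / 4))).toReal with hV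
  have hV0 : 0 ≤ V := ENNReal.toReal_nonneg
  refine ⟨c, C + C * m * V, hc, by positivity, fun θ hθ τ hτ χ hχ v p hv h0 hp => ?_⟩
  have hθ0 := hθ.1
  have hs := hχ.hasCompactSupport
  have hφ := hχ.contDiff
  have hφ1 : ContDiff ℝ 1 fun y => χ y ^ 6 := hφ.of_le (by norm_num)
  have hv2 : ∀ i, ContDiff ℝ 2 (v i) := fun i => (hv i).of_le (by norm_num)
  have hv1 : ∀ i, ContDiff ℝ 1 (v i) := fun i => (hv i).of_le (by norm_num)
  have hd : ∀ i, Differentiable ℝ (v i) := fun i => (hv1 i).differentiable (by norm_num)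
  have hf : ∀ i, ContDiff ℝ 1 fun x => cubic β (fun j => v j x) i := contDiff_cubic hv1
  set D : Fin m → Eu N → ℝ := fun i x => divField (χ x ^ 6) (gdot (fun y => χ y ^ 6) (v i) x)
    (lap (fun y => χ y ^ 6) x) (gdot (v i) (v i) x) (gdot (v i) (v i) x / v i x)
    (cubic β (fun j => v j x) i) (lap (v i) x)
    (1 / 2 * lap (gdot (v i) (v i)) x - gdot (v i) (lap (v i)) x)
    (1 / 2 * gdot (gdot (v i) (v i)) (v i) x / v i x)
    (gdot (fun y => cubic β (fun j => v j y) i) (v i) x) with hD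
  have iD : ∀ i, IsDiv (D i) := fun i =>
    isDiv_divField (hv i) (fun x => (h0 i x).ne') hφ hs (hf i)
  set P : Fin m → Eu N → ℝ := fun i x => gdot (fun y => χ y ^ 6 * p i y) (v i) x +
    χ x ^ 6 * p i x * lap (v i) x with hP
  have iP : ∀ i, IsDiv (P i) := fun i =>
    isDiv_mul_grad (hφ1.mul (hp i)) (hv2 i) (Or.inl hs.mul_right)
  have iT : IsDiv fun x => ∑ i, (θ ^ 6 * P i x + θ ^ 6 * (1 / 156) * D i x) :=
    IsDiv.sum _ fun i _ => ((iP i).const_mul _).add ((iD i).const_mul _)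
  have hPx : ∀ i x, P i x = p i x * gdot (fun y => χ y ^ 6) (v i) x +
      χ x ^ 6 * gdot (v i) (p i) x + χ x ^ 6 * p i x * lap (v i) x := by
    intro i x
    simp only [hP]
    rw [gdot_mul (hφ1.differentiable (by norm_num) x) ((hp i).differentiable (by norm_num) x),
      gdot_comm (p i)]
    ring
  have hgr : ∀ i x, gdot (fun y => χ y ^ 6) (v i) x ^ 2 ≤ Λ ^ 2 * χ x ^ 10 * gdot (v i) (v i) x :=
    fun i x => (gdot_sq_le _ _ x).trans
      (mul_le_mul_of_nonneg_right (hχ.grad x) (gdot_self_nonneg _ x))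
  have point : ∀ x, θ ^ 6 * (χ x ^ 6 * energyRate β v p x) +
      6 * θ ^ 5 * τ * (χ x ^ 6 * energy β v x) ≤
      (∑ i, (θ ^ 6 * P i x + θ ^ 6 * (1 / 156) * D i x)) -
        c * θ ^ 6 * (χ x ^ 6 * ∑ i, v i x ^ 6) +
        C * (χ x ^ 6 * ∑ i, residual β v p i x ^ 2) +
        (closedBall (0 : Eu N) (3 / 4)).indicator (fun _ => C * m) x := by
    intro x
    by_cases hx : x ∈ closedBall (0 : Eu N) (3 / 4)
    swap
    · have hχ0 := hχ.supp x hx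
      have e1 : ∀ i, gdot (fun y => χ y ^ 6) (v i) x = 0 := fun i => by
        have := hgr i x
        rw [hχ0] at this
        simpa using this
      have e2 : lap (fun y => χ y ^ 6) x = 0 := by
        have := hχ.lap x
        rw [hχ0] at this
        simpa using this
      simp [hx, hPx, hD, e1, e2, hχ0, divField]
    rw [indicator_of_mem hx]
    have hcomp : ∀ i, θ ^ 6 * (χ x ^ 6 * (gdot (v i) (p i) x - cubic β (fun j => v j x) i *
        p i x)) +
        3 * θ ^ 5 * τ * χ x ^ 6 * gdot (v i) (v i) x + K * (θ ^ 5 * χ x ^ 6 * v i x ^ 4) ≤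
        θ ^ 6 * P i x + θ ^ 6 * (1 / 156) * D i x +
        θ ^ 6 * (1 / 156) * (13 / 18 * χ x ^ 6) *
          (gdot (fun y => cubic β (fun j => v j y) i) (v i) x -
            3 * (gdot (v i) (v i) x / v i x * cubic β (fun j => v j x) i)) -
        c * θ ^ 6 * (χ x ^ 6 * v i x ^ 6) + C * (χ x ^ 6 * residual β v p i x ^ 2) + C := by
      intro i
      have hpos := h0 i x
      have := key θ hθ (χ x) (hχ.mem x) τ (v i x) (gdot (v i) (v i) x)
        (gdot (v i) (v i) x / v i x) (cubic β (fun j => v j x) i) (lap (v i) x) (p i x)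
        (residual β v p i x) (gdot (fun y => χ y ^ 6) (v i) x) (lap (fun y => χ y ^ 6) x)
        (1 / 2 * lap (gdot (v i) (v i)) x - gdot (v i) (lap (v i)) x)
        (1 / 2 * gdot (gdot (v i) (v i)) (v i) x / v i x)
        (gdot (fun y => cubic β (fun j => v j y) i) (v i) x) hτ hpos.le
        (div_nonneg (gdot_self_nonneg _ _) hpos.le) (div_mul_cancel₀ _ hpos.ne').symm
        ((mul_le_mul_of_nonneg_right (hβ₀' i) (by positivity)).trans
          (mul_pow_three_le_cubic hβ (fun j => (h0 j x).le) i)) (hgr i x) (hχ.lap x)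
        (by unfold residual; ring) ?_
      · rw [hPx]
        simp only [hD]
        have e : p i x ^ 2 - p i x * residual β v p i x =
          p i x * lap (v i) x + p i x * cubic β (fun j => v j x) i := by unfold residual; ring
        rw [e] at this
        linarith only [this]
      · have := trace_ineq hN3 (hv i) x (13 / 10)
        linarith only [this]
    have hsum := Finset.sum_le_sum fun i (_ : i ∈ Finset.univ) => hcomp i
    have hn := sum_gdot_cubic_le hβ hsym hd fun i => h0 i x
    have hcoef : 0 ≤ θ ^ 6 * (1 / 156) * (13 / 18 * χ x ^ 6) := by positivity
    have hn2 := mul_nonpos_of_nonneg_of_nonpos hcoef (sub_nonpos.2 hn)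
    have hG0 := potential_nonneg hβ fun j => v j x
    have hG := potential_le hβ fun j => v j x
    have hθχ : 0 ≤ θ ^ 5 * χ x ^ 6 := by positivity
    have hτG : -(6 * θ ^ 5 * τ * (χ x ^ 6 * potential β fun j => v j x)) ≤
        K * (θ ^ 5 * χ x ^ 6 * ∑ i, v i x ^ 4) := by
      have a1 : -τ * potential β (fun j => v j x) ≤ A₀ * (1 / 4 * B * ∑ k, v k x ^ 4) :=
        mul_le_mul ((neg_le_abs τ).trans hτ) hG hG0 hA₀
      have := mul_le_mul_of_nonneg_left a1 hθχ
      rw [hK]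
      linarith only [this]
    simp only [Finset.sum_add_distrib, Finset.sum_sub_distrib, ← Finset.mul_sum] at hsum hn2 ⊢
    simp only [energyRate, energy, Finset.sum_sub_distrib]
    simp only [Finset.sum_const, Finset.card_univ, Fintype.card_fin, nsmul_eq_mul] at hsum
    linarith only [hsum, hn2, hτG]
  have hcont : ∀ {q : Eu N → ℝ}, Continuous q → Integrable fun x => χ x ^ 6 * q x := fun hq =>
    (hφ.continuous.mul hq).integrable_of_hasCompactSupport hs.mul_right
  have c1 : Continuous (energyRate β v p) := by
    unfold energyRate
    refine continuous_finsetSum _ fun i _ => ?_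
    exact (contDiff_gdot (n := 0) (by simpa using hv1 i) (by simpa using hp i)).continuous.sub
      ((hf i).continuous.mul (hp i).continuous)
  have hvc := fun i => (hv1 i).continuous
  have c2 : Continuous (energy β v) := by
    unfold energy potential
    refine (continuous_const.mul (continuous_finsetSum _ fun i _ => ?_)).sub (by fun_prop)
    exact (contDiff_gdot (n := 0) (by simpa using hv1 i) (by simpa using hv1 i)).continuous
  have c3 : Continuous fun x => ∑ i, v i x ^ 6 := by fun_prop
  have c4 : Continuous fun x => ∑ i, residual β v p i x ^ 2 := by
    unfold residual
    refine continuous_finsetSum _ fun i _ => ?_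
    exact (((hp i).continuous.sub (continuous_lap (hv2 i))).sub (hf i).continuous).pow 2
  have iI : Integrable ((closedBall (0 : Eu N) (3 / 4)).indicator fun _ => C * m) :=
    (integrable_indicator_iff measurableSet_closedBall).2
      (integrableOn_const (hs := (isCompact_closedBall (0 : Eu N) (3 / 4)).measure_lt_top.ne))
  have j1 := hcont c1
  have j2 := hcont c2
  have j3 := hcont c3
  have j4 := hcont c4
  have := integral_combine_mono j1 j2 iT.integrable j3 j4 iI point
  rw [iT.2.2] at this
  rw [integral_indicator measurableSet_closedBall] at this
  simp only [integral_const, smul_eq_mul, MeasurableSet.univ, Measure.real, Measure.restrict_apply,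
    univ_inter] at this
  have h4 : 0 ≤ ∫ x, χ x ^ 6 * ∑ i, residual β v p i x ^ 2 :=
    integral_nonneg fun x => mul_nonneg (by positivity) (Finset.sum_nonneg fun i _ => sq_nonneg _)
  have h5 : 0 ≤ C * m * V * ∫ x, χ x ^ 6 * ∑ i, residual β v p i x ^ 2 := by positivity
  linarith only [this, h5, hC]

end system

section mollify

variable {N : ℕ} {η w : Eu N → ℝ}

/-- Convolution in the space variable. -/
noncomputable def mollify (η w : Eu N → ℝ) (x : Eu N) : ℝ := ∫ y, w y * η (x - y)

theorem mollify_eq (η w : Eu N → ℝ) :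
    mollify η w = MeasureTheory.convolution w η (ContinuousLinearMap.mul ℝ ℝ) volume := by
  funext x; rfl

theorem contDiff_mollify (hη : ContDiff ℝ (⊤ : ℕ∞) η) (hs : HasCompactSupport η)
    (hw : Continuous w) (n : ℕ∞) : ContDiff ℝ n (mollify η w) := by
  rw [mollify_eq]
  exact hs.contDiff_convolution_right _ hw.locallyIntegrable (hη.of_le (by exact_mod_cast le_top))

theorem pd_mollify (hη : ContDiff ℝ (⊤ : ℕ∞) η) (hs : HasCompactSupport η)
    (hw : Continuous w) (k : Fin N) : pd k (mollify η w) = mollify (pd k η) w := by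
  have hη1 : ContDiff ℝ 1 η := hη.of_le (by exact_mod_cast le_top)
  funext x
  rw [mollify_eq, mollify_eq, pd,
    (hs.hasFDerivAt_convolution_right _ hw.locallyIntegrable hη1 x).fderiv]
  exact convolution_precompR_apply _ hw.locallyIntegrable (hs.fderiv ℝ)
    (hη1.continuous_fderiv (by norm_num)) x _

theorem contDiff_pd_top (hη : ContDiff ℝ (⊤ : ℕ∞) η) (k : Fin N) :
    ContDiff ℝ (⊤ : ℕ∞) (pd k η) :=
  contDiff_pd hη (by exact_mod_cast le_top)

theorem contDiff_lap_top (hη : ContDiff ℝ (⊤ : ℕ∞) η) : ContDiff ℝ (⊤ : ℕ∞) (lap η) := by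
  have : lap η = fun x => ∑ i, pd i (pd i η) x :=
    funext fun x => lap_eq (contDiff_infty.1 hη 2)
  rw [this]
  exact ContDiff.sum fun i _ => contDiff_pd_top (contDiff_pd_top hη i) i

theorem integrable_mollify (hη : Continuous η) (hs : HasCompactSupport η) (hw : Continuous w)
    (x : Eu N) : Integrable fun y => w y * η (x - y) :=
  (hs.convolutionExists_right (ContinuousLinearMap.mul ℝ ℝ) hw.locallyIntegrable hη) x

theorem lap_mollify (hη : ContDiff ℝ (⊤ : ℕ∞) η) (hs : HasCompactSupport η)
    (hw : Continuous w) : lap (mollify η w) = mollify (lap η) w := by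
  funext x
  rw [lap_eq (contDiff_mollify hη hs hw 2)]
  have h2 : ∀ y, lap η y = ∑ k, pd k (pd k η) y := fun y =>
    lap_eq (contDiff_infty.1 hη 2)
  simp only [mollify, h2, Finset.mul_sum]
  rw [integral_finsetSum]
  · refine Finset.sum_congr rfl fun k _ => ?_
    rw [pd_mollify hη hs hw, pd_mollify (contDiff_pd_top hη k) (hasCompactSupport_pd hs) hw]
    rfl
  · exact fun k _ => integrable_mollify (contDiff_pd_top (contDiff_pd_top hη k) k).continuous
      (hasCompactSupport_pd (hasCompactSupport_pd hs)) hw x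

theorem abs_mollify_le {ε R M : ℝ} (hη : Continuous η) (hs : ∀ z ∉ closedBall (0 : Eu N) ε, η z = 0)
    {x : Eu N} (hx : closedBall x ε ⊆ ball 0 R)
    (hM : ∀ y ∈ ball (0 : Eu N) R, |w y| ≤ M) : |mollify η w x| ≤ M * ∫ z, |η z| := by
  have hi : Integrable fun z => |η z| := (integrable_of_support hη hs).abs
  have e : ∫ z, |η z| = ∫ y, |η (x - y)| :=
      (integral_sub_left_eq_self (fun z => |η z|) volume x).symm
  rw [e, ← integral_const_mul, mollify, ← Real.norm_eq_abs]
  refine norm_integral_le_of_norm_le ((hi.comp_sub_left x).const_mul M)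
      (Eventually.of_forall fun y => ?_)
  rw [norm_mul, Real.norm_eq_abs, Real.norm_eq_abs]
  by_cases hy : x - y ∈ closedBall (0 : Eu N) ε
  · refine mul_le_mul_of_nonneg_right (hM y (hx ?_)) (abs_nonneg _)
    rw [mem_closedBall, dist_eq_norm, ← norm_neg, neg_sub]
    simpa using hy
  · simp [hs _ hy]

end mollify

section weak

variable {N m : ℕ} {β : Fin m → Fin m → ℝ} {u : Fin m → Eu N → ℝ → ℝ}

/-- Nonnegative solutions of the system at the times in `S`. -/
structure IsSol (β : Fin m → Fin m → ℝ) (u : Fin m → Eu N → ℝ → ℝ) (S : Set ℝ) : Prop where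
  c2 : ∀ i, ∀ t ∈ S, ContDiff ℝ 2 fun x => u i x t
  dt : ∀ i x, ∀ t ∈ S, DifferentiableAt ℝ (u i x) t
  nonneg : ∀ i x, ∀ t ∈ S, 0 ≤ u i x t
  eq : ∀ i x, ∀ t ∈ S, deriv (u i x) t = lap (fun y => u i y t) x + cubic β (fun j => u j x t) i

/-- The nonlinearity evaluated along a solution. -/
def source (β : Fin m → Fin m → ℝ) (u : Fin m → Eu N → ℝ → ℝ) (i : Fin m) (x : Eu N) (t : ℝ) : ℝ :=
  cubic β (fun j => u j x t) i

theorem IsSol.continuous {S : Set ℝ} (h : IsSol β u S) {t : ℝ} (ht : t ∈ S) (i : Fin m) :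
    Continuous fun x => u i x t := (h.c2 i t ht).continuous

theorem IsSol.continuousAt {S : Set ℝ} (h : IsSol β u S) {t : ℝ} (ht : t ∈ S) (i : Fin m)
    (x : Eu N) : ContinuousAt (u i x) t := (h.dt i x t ht).continuousAt

theorem IsSol.continuous_source {S : Set ℝ} (h : IsSol β u S) {t : ℝ} (ht : t ∈ S) (i : Fin m) :
    Continuous fun x => source β u i x t := by
  unfold source cubic
  exact continuous_finsetSum _ fun j _ =>
    (continuous_const.mul (h.continuous ht i)).mul ((h.continuous ht j).pow 2)

theorem IsSol.continuousAt_source {S : Set ℝ} (h : IsSol β u S) {t : ℝ} (ht : t ∈ S) (i : Fin m)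
    (x : Eu N) : ContinuousAt (source β u i x) t := by
  unfold source cubic
  exact tendsto_finsetSum _ fun j _ =>
    (continuousAt_const.mul (h.continuousAt ht i x)).mul ((h.continuousAt ht j x).pow 2)

theorem cubic_le (hβ : ∀ i j, 0 ≤ β i j) {a : Fin m → ℝ} {M : ℝ} (ha : ∀ i, a i ∈ Icc 0 M)
    (i : Fin m) : cubic β a i ≤ (∑ k, ∑ j, β k j) * M ^ 3 := by
  have h1 : cubic β a i ≤ (∑ j, β i j) * M ^ 3 := by
    rw [cubic, Finset.sum_mul]
    refine Finset.sum_le_sum fun j _ => ?_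
    rw [mul_assoc]
    refine mul_le_mul_of_nonneg_left ?_ (hβ i j)
    have := ha i
    have := ha j
    have hM : 0 ≤ M := (ha i).1.trans (ha i).2
    calc a i * a j ^ 2 ≤ M * M ^ 2 :=
          mul_le_mul (ha i).2 (pow_le_pow_left₀ (ha j).1 (ha j).2 2) (sq_nonneg _) hM
      _ = _ := by ring
  have hM : 0 ≤ M := (ha i).1.trans (ha i).2
  exact h1.trans (mul_le_mul_of_nonneg_right (Finset.single_le_sum (f := fun k => ∑ j, β k j)
    (fun k _ => Finset.sum_nonneg fun j _ => hβ k j) (Finset.mem_univ i)) (by positivity))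

theorem IsSol.superOn {S : Set ℝ} (h : IsSol β u S) (i : Fin m) (x₀ : Eu N) (R : ℝ) :
    SuperOn (u i) (source β u i) x₀ R S :=
  ⟨h.c2 i, h.dt i, fun x _ t ht => (h.eq i x t ht).ge⟩

theorem IsSol.superOn_neg {S : Set ℝ} (h : IsSol β u S) (i : Fin m) (x₀ : Eu N) (R : ℝ) :
    SuperOn (fun x t => -u i x t) (fun x t => -source β u i x t) x₀ R S := by
  refine ⟨fun t ht => (h.c2 i t ht).neg, fun x t ht => (h.dt i x t ht).neg, fun x _ t ht => ?_⟩
  have e : deriv (fun s => -u i x s) t = -deriv (u i x) t := deriv.fun_neg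
  rw [e, lap_neg (h.c2 i t ht), h.eq i x t ht]
  simp [source]

/-- Bounded solutions are right lower semicontinuous, and so are their negatives. -/
theorem IsSol.rlsc (hN : 0 < N) (hβ : ∀ i j, 0 ≤ β i j) {x₀ : Eu N} {R a b M : ℝ}
    (h : IsSol β u (Ioo a b)) (hM : ∀ i, ∀ x ∈ ball x₀ R, ∀ t ∈ Ioo a b, u i x t ≤ M) (i : Fin m) :
    ∀ x ∈ ball x₀ R, ∀ t ∈ Ioo a b, RLsc (u i) x t ∧ RLsc (fun x t => -u i x t) x t := by
  have hf0 : ∀ x, ∀ t ∈ Ioo a b, 0 ≤ source β u i x t := fun x t ht =>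
    cubic_nonneg hβ (fun j => h.nonneg j x t ht) i
  have hMa : ∀ x ∈ ball x₀ R, ∀ t ∈ Ioo a b, |u i x t| ≤ M := fun x hx t ht => by
    rw [abs_of_nonneg (h.nonneg i x t ht)]; exact hM i x hx t ht
  set G := (∑ k, ∑ j, β k j) * M ^ 3 with hG
  have hfG : ∀ x ∈ ball x₀ R, ∀ t ∈ Ioo a b, source β u i x t ≤ G := fun x hx t ht =>
    cubic_le hβ (fun j => ⟨h.nonneg j x t ht, hM j x hx t ht⟩) i
  have s1 : SuperOn (u i) (fun _ _ => 0) x₀ R (Ioo a b) :=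
    ⟨h.c2 i, h.dt i, fun x hx t ht => by
      have := h.eq i x t ht; have := hf0 x t ht; unfold source at this; linarith⟩
  have s2 : SuperOn (fun x t => -u i x t + G * t) (fun _ _ => 0) x₀ R (Ioo a b) := by
    refine ⟨fun t ht => (h.c2 i t ht).neg.add contDiff_const,
      fun x t ht => (h.dt i x t ht).neg.add (by fun_prop), fun x hx t ht => ?_⟩
    have e : deriv (fun s => -u i x s + G * s) t = -deriv (u i x) t + G := by
      have : HasDerivAt (fun s => -u i x s + G * s) (-deriv (u i x) t + G * 1) t :=
        (h.dt i x t ht).hasDerivAt.neg.add ((hasDerivAt_id t).const_mul G)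
      simpa using this.deriv
    rw [e, lap_add (h.c2 i t ht).neg contDiff_const, lap_neg (h.c2 i t ht), lap_const,
      h.eq i x t ht]
    have := hfG x hx t ht
    unfold source at this
    linarith
  have r1 := rlsc_of_bounded hN s1 hMa
  have r2 := rlsc_of_bounded hN (M := M + |G| * (|a| + |b|)) s2 fun x hx t ht => by
    refine (abs_add_le _ _).trans (add_le_add (by rw [abs_neg]; exact hMa x hx t ht) ?_)
    rw [abs_mul]
    refine mul_le_mul_of_nonneg_left ?_ (abs_nonneg _)
    refine abs_le.2 ⟨?_, ?_⟩
    · linarith [neg_abs_le a, abs_nonneg b, ht.1]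
    · linarith [le_abs_self b, abs_nonneg a, ht.2]
  intro x hx t ht
  refine ⟨r1 x hx t ht, ?_⟩
  have := (r2 x hx t ht).add_continuous (q := fun _ s => -(G * s)) (by fun_prop)
  simpa using this

end weak

section weakform

variable {N m : ℕ} {β : Fin m → Fin m → ℝ} {u : Fin m → Eu N → ℝ → ℝ} {x₀ : Eu N} {a b R M r : ℝ}

/-- The derivative of the pairing of a solution with a test function. -/
noncomputable def pairRate (β : Fin m → Fin m → ℝ) (u : Fin m → Eu N → ℝ → ℝ) (i : Fin m)
    (η : Eu N → ℝ) (t : ℝ) : ℝ :=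
  (∫ x, u i x t * lap η x) + ∫ x, source β u i x t * η x

theorem IsSol.mono {S S' : Set ℝ} (h : IsSol β u S) (hS : S' ⊆ S) : IsSol β u S' :=
  ⟨fun i t ht => h.c2 i t (hS ht), fun i x t ht => h.dt i x t (hS ht),
    fun i x t ht => h.nonneg i x t (hS ht), fun i x t ht => h.eq i x t (hS ht)⟩

theorem IsSol.abs_source_le (hβ : ∀ i j, 0 ≤ β i j) {S : Set ℝ} (h : IsSol β u S)
    (hM : ∀ i, ∀ x ∈ ball x₀ R, ∀ t ∈ S, u i x t ≤ M) (i : Fin m) :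
    ∀ x ∈ ball x₀ R, ∀ t ∈ S, |source β u i x t| ≤ (∑ k, ∑ j, β k j) * M ^ 3 := fun x hx t ht => by
  unfold source
  rw [abs_of_nonneg (cubic_nonneg hβ (fun j => h.nonneg j x t ht) i)]
  exact cubic_le hβ (fun j => ⟨h.nonneg j x t ht, hM j x hx t ht⟩) i

theorem IsSol.weak_eq (hN : 0 < N) (hβ : ∀ i j, 0 ≤ β i j) (h : IsSol β u (Ioo a b))
    (hM : ∀ i, ∀ x ∈ ball x₀ R, ∀ t ∈ Ioo a b, u i x t ≤ M) (hr : r < R) {η : Eu N → ℝ}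
    (hη : ContDiff ℝ 2 η) (hs : ∀ x ∉ closedBall x₀ r, η x = 0) (hη0 : ∀ x, 0 ≤ η x) (i : Fin m)
    {t₁ t₂ : ℝ} (h₁ : t₁ ∈ Ioo a b) (h₂ : t₂ ∈ Ioo a b) (h12 : t₁ ≤ t₂) :
    (∫ x, u i x t₁ * η x) + (∫ t in t₁..t₂, pairRate β u i η t) = ∫ x, u i x t₂ * η x := by
  have hS : Icc t₁ t₂ ⊆ Ioo a b := fun t ht => ⟨h₁.1.trans_le ht.1, ht.2.trans_lt h₂.2⟩
  have hS' := h.mono hS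
  obtain ⟨C, hC⟩ := exists_test (ψ := fun x (_ : ℝ) => η x) (ψ' := fun _ _ => 0)
    (Lp := fun x _ => lap η x) (x₀ := x₀) (r := r) (t₁ := t₁) (t₂ := t₂)
    (hη.continuous.comp continuous_fst).continuousOn continuousOn_const
    ((continuous_lap hη).comp continuous_fst).continuousOn (fun x _ _ => hη0 x) (fun _ _ => hη)
    (fun x hx _ _ => hs x hx) (fun _ _ _ _ => rfl) (fun x t _ => hasDerivAt_const t (η x))
    (fun _ _ _ => rfl)
  have hMa : ∀ x ∈ ball x₀ R, ∀ t ∈ Icc t₁ t₂, |u i x t| ≤ M := fun x hx t ht => by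
    rw [abs_of_nonneg (hS'.nonneg i x t ht)]; exact hM i x hx t (hS ht)
  have hG := hS'.abs_source_le hβ (fun i x hx t ht => hM i x hx t (hS ht)) i
  have hL := h.rlsc hN hβ hM i
  have hI : Ico t₁ t₂ ⊆ Ioo a b := Ico_subset_Icc_self.trans hS
  have k1 := weak_ineq (hS'.superOn i x₀ R) h12 hMa hG (fun t ht => hS'.continuous_source ht i)
    (fun x t ht => (hS'.continuousAt_source ht i x).continuousWithinAt)
    (fun x hx t ht => (hL x hx t (hI ht)).1) hr hC
  have k2 := weak_ineq (M := M) (hS'.superOn_neg i x₀ R) h12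
    (fun x hx t ht => by rw [abs_neg]; exact hMa x hx t ht)
    (fun x hx t ht => by rw [abs_neg]; exact hG x hx t ht)
    (fun t ht => (hS'.continuous_source ht i).neg)
    (fun x t ht => (hS'.continuousAt_source ht i x).neg.continuousWithinAt)
    (fun x hx t ht => (hL x hx t (hI ht)).2) hr hC
  have e1 : weakRate (u i) (source β u i) (fun x _ => η x) (fun _ _ => 0) = pairRate β u i η := by
    funext t; simp [weakRate, pairRate]
  have e2 : weakRate (fun x t => -u i x t) (fun x t => -source β u i x t) (fun x _ => η x)
      (fun _ _ => 0) = fun t => -pairRate β u i η t := by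
    funext t; simp [weakRate, pairRate, integral_neg]; ring
  rw [e1] at k1
  rw [e2] at k2
  simp only [neg_mul, integral_neg, intervalIntegral.integral_neg] at k2
  linarith

theorem IsSol.continuousOn_pairRate (hβ : ∀ i j, 0 ≤ β i j) {S : Set ℝ} (h : IsSol β u S)
    (hM : ∀ i, ∀ x ∈ ball x₀ R, ∀ t ∈ S, u i x t ≤ M) (hr : r < R) {η : Eu N → ℝ}
    (hη : ContDiff ℝ 2 η) (hs : ∀ x ∉ closedBall x₀ r, η x = 0) (i : Fin m) :
    ContinuousOn (pairRate β u i η) S := by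
  have hsub : closedBall x₀ r ⊆ ball x₀ R := closedBall_subset_ball hr
  have hl := lap_eq_zero_of_eqOn isClosed_closedBall hs
  obtain ⟨A, -, hA⟩ := exists_bound_of_support hη.continuous
    (.intro (isCompact_closedBall _ _) hs)
  obtain ⟨A', -, hA'⟩ := exists_bound_of_support (continuous_lap hη)
    (.intro (isCompact_closedBall _ _) hl)
  refine (continuousOn_integral_mul (x₀ := x₀) (r := r) (M := M) (fun t ht => h.continuous ht i)
    (fun x t ht => (h.continuousAt ht i x).continuousWithinAt) (fun x hx t ht => ?_)
    (fun t _ => continuous_lap hη) (fun x => continuousOn_const) (fun x t _ => hA' x)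
    (fun x hx t _ => hl x hx)).add
    (continuousOn_integral_mul (x₀ := x₀) (r := r) (fun t ht => h.continuous_source ht i)
    (fun x t ht => (h.continuousAt_source ht i x).continuousWithinAt)
    (fun x hx => h.abs_source_le hβ hM i x (hsub hx))
    (fun t _ => hη.continuous) (fun x => continuousOn_const) (fun x t _ => hA x)
    (fun x hx t _ => hs x hx))
  rw [abs_of_nonneg (h.nonneg i x t ht)]
  exact hM i x (hsub hx) t ht

theorem IsSol.hasDerivAt_of_nonneg (hN : 0 < N) (hβ : ∀ i j, 0 ≤ β i j) (h : IsSol β u (Ioo a b))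
    (hM : ∀ i, ∀ x ∈ ball x₀ R, ∀ t ∈ Ioo a b, u i x t ≤ M) (hr : r < R) {η : Eu N → ℝ}
    (hη : ContDiff ℝ 2 η) (hs : ∀ x ∉ closedBall x₀ r, η x = 0) (hη0 : ∀ x, 0 ≤ η x) (i : Fin m)
    {t : ℝ} (ht : t ∈ Ioo a b) :
    HasDerivAt (fun s => ∫ x, u i x s * η x) (pairRate β u i η t) t := by
  have hc := h.continuousOn_pairRate hβ hM hr hη hs i
  obtain ⟨c, hac, hct⟩ := exists_between ht.1
  have hcI : c ∈ Ioo a b := ⟨hac, hct.trans ht.2⟩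
  have hint : IntervalIntegrable (pairRate β u i η) volume c t :=
    (hc.mono (by rw [uIcc_of_le hct.le]; exact fun s hs =>
        ⟨hac.trans_le hs.1, hs.2.trans_lt ht.2⟩)).intervalIntegrable
  have hd := (intervalIntegral.integral_hasDerivAt_right hint
    (hc.stronglyMeasurableAtFilter isOpen_Ioo t ht)
        (hc.continuousAt (isOpen_Ioo.mem_nhds ht))).const_add
      (∫ x, u i x c * η x)
  refine hd.congr_of_eventuallyEq ?_
  filter_upwards [isOpen_Ioo.mem_nhds (show t ∈ Ioo c b from ⟨hct, ht.2⟩)] with s hs'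
  exact (h.weak_eq hN hβ hM hr hη hs hη0 i hcI ⟨hac.trans hs'.1, hs'.2⟩ hs'.1.le).symm

/-- The weak form of the equation for `i`, tested with a function of the space variable. -/
theorem IsSol.hasDerivAt_integral (hN : 0 < N) (hβ : ∀ i j, 0 ≤ β i j) (h : IsSol β u (Ioo a b))
    (hM : ∀ i, ∀ x ∈ ball 0 R, ∀ t ∈ Ioo a b, u i x t ≤ M) (hr0 : 0 < r) (hr : r < R)
    {η : Eu N → ℝ} (hη : ContDiff ℝ 2 η) (hs : ∀ x ∉ closedBall 0 r, η x = 0) (i : Fin m)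
    {t : ℝ} (ht : t ∈ Ioo a b) :
    HasDerivAt (fun s => ∫ x, u i x s * η x) (pairRate β u i η t) t := by
  obtain ⟨r', hrr, hr'⟩ := exists_between hr
  obtain ⟨χ, hχ, -, hχ0, -, hχs, hχ1⟩ := exists_cutoff (N := N) hr0 hrr
  have hχ2 : ContDiff ℝ 2 χ := contDiff_infty.1 hχ 2
  have hχz : ∀ x ∉ closedBall 0 r', χ x = 0 := fun x hx => hχs x (by simp at hx; exact hx.le)
  have hs' : ∀ x ∉ closedBall 0 r', η x = 0 := fun x hx =>
      hs x (fun k => hx (closedBall_subset_closedBall hrr.le k))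
  obtain ⟨A, hA0, hA⟩ := exists_bound_of_support hη.continuous
    (.intro (isCompact_closedBall _ _) hs)
  have hζ2 : ContDiff ℝ 2 fun x => η x + A * χ x := hη.add (contDiff_const.mul hχ2)
  have k1 := h.hasDerivAt_of_nonneg hN hβ hM hr' hζ2 (fun x hx => by simp [hs' x hx, hχz x hx])
    (fun x => by
      by_cases hx : x ∈ closedBall (0 : Eu N) r
      · rw [hχ1 x (by simpa using hx)]; linarith [neg_abs_le (η x), hA x]
      · rw [hs x hx]; have := mul_nonneg hA0 (hχ0 x); linarith) i ht
  have k2 := h.hasDerivAt_of_nonneg hN hβ hM hr' hχ2 hχz hχ0 i ht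
  have split : ∀ (w f g : Eu N → ℝ), Continuous w → Continuous f → Continuous g →
      (∀ x ∉ closedBall 0 r', f x = 0) → (∀ x ∉ closedBall 0 r', g x = 0) →
      ∫ x, w x * f x = (∫ x, w x * (f x + A * g x)) - A * ∫ x, w x * g x := by
    intro w f g hw hf hg hfs hgs
    rw [← integral_const_mul, ← integral_sub]
    · congr 1; funext x; ring
    · exact integrable_of_support (x₀ := 0) (r := r') (by fun_prop) fun x hx => by
        simp [hfs x hx, hgs x hx]
    · exact integrable_of_support (x₀ := 0) (r := r') (by fun_prop) fun x hx => by simp [hgs x hx]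
  have e : pairRate β u i η t
      = pairRate β u i (fun x => η x + A * χ x) t - A * pairRate β u i χ t := by
    have l : lap (fun x => η x + A * χ x) = fun x => lap η x + A * lap χ x := by
      funext x
      rw [lap_add hη (contDiff_const.mul hχ2), lap_const_mul _ hχ2]
    rw [pairRate, pairRate, pairRate, l, split _ _ _ (h.continuous ht i) (continuous_lap hη)
      (continuous_lap hχ2) (lap_eq_zero_of_eqOn isClosed_closedBall hs')
      (lap_eq_zero_of_eqOn isClosed_closedBall hχz), split _ _ _ (h.continuous_source ht i)
      hη.continuous hχ2.continuous hs' hχz]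
    ring
  rw [e]
  refine (k1.sub (k2.const_mul A)).congr_of_eventuallyEq ?_
  filter_upwards [isOpen_Ioo.mem_nhds ht] with s hs''
  exact split _ _ _ (h.continuous hs'' i) hη.continuous hχ2.continuous hs' hχz

/-- The time derivative of a mollified solution. -/
theorem IsSol.hasDerivAt_mollify (hN : 0 < N) (hβ : ∀ i j, 0 ≤ β i j) (h : IsSol β u (Ioo a b))
    (hM : ∀ i, ∀ x ∈ ball 0 R, ∀ t ∈ Ioo a b, u i x t ≤ M) {η : Eu N → ℝ} (hη : ContDiff ℝ 2 η)
    {ε : ℝ} (hs : ∀ x ∉ closedBall 0 ε, η x = 0) {x : Eu N} (hx : ‖x‖ + ε < R) (hR : 0 < R)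
        (i : Fin m)
    {t : ℝ} (ht : t ∈ Ioo a b) :
    HasDerivAt (fun s => mollify η (fun y => u i y s) x)
      (mollify (lap η) (fun y => u i y t) x + mollify η (fun y => source β u i y t) x) t := by
  obtain ⟨r, hr1, hr⟩ := exists_between (max_lt hx hR)
  have hr0 : 0 < r := (le_max_right _ _).trans_lt hr1
  have hr2 : ‖x‖ + ε < r := (le_max_left _ _).trans_lt hr1
  have e : (fun y => η (x - y)) = fun y => η (x + (-1 : ℝ) • y) := by
    funext y; simp [sub_eq_add_neg]
  have hη' : ContDiff ℝ 2 fun y => η (x - y) := hη.comp (contDiff_const.sub contDiff_id)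
  have k := h.hasDerivAt_integral hN hβ hM hr0 hr hη' (fun y hy => hs _ fun hy' => hy (by
    simp only [mem_closedBall_zero_iff] at hy' ⊢
    have := norm_le_norm_add_norm_sub x y
    linarith)) i ht
  have l : ∀ y, lap (fun y => η (x - y)) y = lap η (x - y) := fun y => by
    rw [e, lap_comp_affine _ _ hη]; simp [sub_eq_add_neg]
  refine k.congr_deriv ?_
  simp only [pairRate, l, mollify]

end weakform

section energy

variable {N m : ℕ} {β : Fin m → Fin m → ℝ}

theorem abs_sum_le {n : ℕ} {f : Fin n → ℝ} {A : ℝ} (h : ∀ i, |f i| ≤ A) :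
    |∑ i, f i| ≤ n * A := by
  refine (Finset.abs_sum_le_sum_abs _ _).trans
      ((Finset.sum_le_card_nsmul _ _ A fun i _ => h i).trans ?_)
  simp

theorem hasDerivAt_potential (hsym : ∀ i j, β i j = β j i) {a : Fin m → ℝ → ℝ} {a' : Fin m → ℝ}
    {t : ℝ} (h : ∀ i, HasDerivAt (a i) (a' i) t) :
    HasDerivAt (fun s => potential β fun j => a j s)
      (∑ i, cubic β (fun j => a j t) i * a' i) t := by
  have h1 : HasDerivAt (fun s => potential β fun j => a j s)
      (1 / 4 * ∑ i, ∑ j, (β i j * (2 * a i t * a' i) * a j t ^ 2 +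
        β i j * a i t ^ 2 * (2 * a j t * a' j))) t := by
    refine HasDerivAt.const_mul _ (HasDerivAt.fun_sum fun i _ => HasDerivAt.fun_sum fun j _ => ?_)
    exact ((((h i).fun_pow 2).const_mul (β i j)).mul ((h j).fun_pow 2)).congr_deriv (by norm_num)
  refine h1.congr_deriv ?_
  simp only [Finset.sum_add_distrib]
  have e : ∑ i, ∑ j, β i j * a i t ^ 2 * (2 * a j t * a' j) =
      ∑ i, ∑ j, β i j * (2 * a i t * a' i) * a j t ^ 2 := by
    rw [Finset.sum_comm]
    refine Finset.sum_congr rfl fun i _ => Finset.sum_congr rfl fun j _ => ?_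
    rw [hsym j i]; ring
  rw [e, ← two_mul, ← mul_assoc, Finset.mul_sum]
  refine Finset.sum_congr rfl fun i _ => ?_
  rw [cubic, Finset.mul_sum, Finset.sum_mul]
  exact Finset.sum_congr rfl fun j _ => by ring

/-- A positive smooth approximate solution `v` on the times in `S`, with time derivative `p`, both
bounded with their gradients on the support of the cutoffs. -/
structure Flow (β : Fin m → Fin m → ℝ) (v p : Fin m → Eu N → ℝ → ℝ) (A : ℝ) (S : Set ℝ) : Prop where
  c3 : ∀ i, ∀ t ∈ S, ContDiff ℝ 3 fun x => v i x t
  c1 : ∀ i, ∀ t ∈ S, ContDiff ℝ 1 fun x => p i x t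
  pos : ∀ i x, ∀ t ∈ S, 0 < v i x t
  hd : ∀ i, ∀ x ∈ closedBall 0 (3 / 4), ∀ t ∈ S, HasDerivAt (v i x) (p i x t) t
  hd' : ∀ i k, ∀ x ∈ closedBall 0 (3 / 4), ∀ t ∈ S,
    HasDerivAt (fun s => pd k (fun y => v i y s) x) (pd k (fun y => p i y t) x) t
  le : ∀ i, ∀ x ∈ closedBall 0 (3 / 4), ∀ t ∈ S, |v i x t| ≤ A
  le' : ∀ i, ∀ x ∈ closedBall 0 (3 / 4), ∀ t ∈ S, |p i x t| ≤ A
  le_pd : ∀ i k, ∀ x ∈ closedBall 0 (3 / 4), ∀ t ∈ S, |pd k (fun y => v i y t) x| ≤ A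
  le_pd' : ∀ i k, ∀ x ∈ closedBall 0 (3 / 4), ∀ t ∈ S, |pd k (fun y => p i y t) x| ≤ A
  cont_res : ∀ i, ∀ x ∈ closedBall 0 (3 / 4),
    ContinuousOn (fun t => residual β (fun j y => v j y t) (fun j y => p j y t) i x) S
  le_res : ∀ i, ∀ x ∈ closedBall 0 (3 / 4), ∀ t ∈ S,
    |residual β (fun j y => v j y t) (fun j y => p j y t) i x| ≤ A

theorem continuous_energy {v : Fin m → Eu N → ℝ} (hv : ∀ i, ContDiff ℝ 3 (v i)) :
    Continuous (energy β v) := by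
  have h1 : ∀ i k, Continuous (pd k (v i)) := fun i k => continuous_pd ((hv i).of_le (by norm_num))
  have h2 : ∀ i, Continuous (v i) := fun i => (hv i).continuous
  unfold energy gdot potential
  fun_prop

theorem continuous_energyRate {v p : Fin m → Eu N → ℝ} (hv : ∀ i, ContDiff ℝ 3 (v i))
    (hp : ∀ i, ContDiff ℝ 1 (p i)) : Continuous (energyRate β v p) := by
  have h1 : ∀ i k, Continuous (pd k (v i)) := fun i k => continuous_pd ((hv i).of_le (by norm_num))
  have h2 : ∀ i, Continuous (v i) := fun i => (hv i).continuous
  have h3 : ∀ i k, Continuous (pd k (p i)) := fun i k => continuous_pd (hp i)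
  have h4 : ∀ i, Continuous (p i) := fun i => (hp i).continuous
  unfold energyRate gdot cubic
  fun_prop

theorem continuous_residual {v p : Fin m → Eu N → ℝ} (hv : ∀ i, ContDiff ℝ 3 (v i))
    (hp : ∀ i, ContDiff ℝ 1 (p i)) (i : Fin m) : Continuous (residual β v p i) := by
  have h1 : Continuous (lap (v i)) := continuous_lap ((hv i).of_le (by norm_num))
  have h2 : ∀ i, Continuous (v i) := fun i => (hv i).continuous
  have h4 : ∀ i, Continuous (p i) := fun i => (hp i).continuous
  unfold residual cubic
  fun_prop

variable {v p : Fin m → Eu N → ℝ → ℝ} {A Λ a b : ℝ} {χ : Eu N → ℝ}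

theorem Flow.hasDerivAt_energy (hβ : ∀ i j, 0 ≤ β i j) (hsym : ∀ i j, β i j = β j i)
    (h : Flow β v p A (Ioo a b)) (hχ : Cutoff Λ χ) {t : ℝ} (ht : t ∈ Ioo a b) :
    HasDerivAt (fun s => ∫ x, χ x ^ 6 * energy β (fun j y => v j y s) x)
      (∫ x, χ x ^ 6 * energyRate β (fun j y => v j y t) (fun j y => p j y t) x) t := by
  have hχc : Continuous fun x => χ x ^ 6 := hχ.contDiff.continuous
  set D : ℝ := m * (N * (A * A) + m * ((∑ k, ∑ j, β k j) * A * A ^ 2) * A) with hD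
  have hK : IsCompact (closedBall (0 : Eu N) (3 / 4)) := isCompact_closedBall _ _
  refine (hasDerivAt_integral_of_dominated_loc_of_deriv_le
    (bound := (closedBall (0 : Eu N) (3 / 4)).indicator fun _ => D)
    (F := fun s x => χ x ^ 6 * energy β (fun j y => v j y s) x)
    (F' := fun s x => χ x ^ 6 * energyRate β (fun j y => v j y s) (fun j y => p j y s) x)
    (isOpen_Ioo.mem_nhds ht) ?_ ?_ ?_ (Eventually.of_forall fun x s hs => ?_) ?_
    (Eventually.of_forall fun x s hs => ?_)).2
  · filter_upwards [isOpen_Ioo.mem_nhds ht] with s hs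
    exact (hχc.mul (continuous_energy fun i => h.c3 i s hs)).aestronglyMeasurable
  · exact integrable_of_support (x₀ := 0) (r := 3 / 4)
      (hχc.mul (continuous_energy fun i => h.c3 i t ht)) fun x hx => by simp [hχ.supp x hx]
  · exact (hχc.mul (continuous_energyRate (fun i => h.c3 i t ht)
      fun i => h.c1 i t ht)).aestronglyMeasurable
  · by_cases hx : x ∈ closedBall (0 : Eu N) (3 / 4)
    · rw [indicator_of_mem hx, Real.norm_eq_abs, abs_mul]
      have hA : 0 ≤ A ∨ IsEmpty (Fin m) := by
        rcases isEmpty_or_nonempty (Fin m) with hm | ⟨⟨i⟩⟩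
        · exact .inr hm
        · exact .inl ((abs_nonneg _).trans (h.le i x hx s hs))
      have h1 : |energyRate β (fun j y => v j y s) (fun j y => p j y s) x| ≤ D := by
        rcases hA with hA | hm
        · have hB : 0 ≤ ∑ k, ∑ j, β k j := Finset.sum_nonneg fun k _ => Finset.sum_nonneg fun j _ =>
            hβ k j
          have hb : ∀ i j, β i j ≤ ∑ k, ∑ j, β k j := fun i j =>
            (Finset.single_le_sum (f := fun j => β i j) (fun j _ => hβ i j)
                (Finset.mem_univ j)).trans
            (Finset.single_le_sum (f := fun k => ∑ j, β k j)
              (fun k _ => Finset.sum_nonneg fun j _ => hβ k j) (Finset.mem_univ i))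
          rw [hD]
          refine abs_sum_le fun i => (abs_sub _ _).trans (add_le_add ?_ ?_)
          · refine abs_sum_le fun k => ?_
            rw [abs_mul]
            exact mul_le_mul (h.le_pd i k x hx s hs) (h.le_pd' i k x hx s hs) (abs_nonneg _) hA
          · rw [abs_mul]
            refine mul_le_mul (abs_sum_le fun j => ?_) (h.le' i x hx s hs) (abs_nonneg _)
                (by positivity)
            rw [abs_mul, abs_mul, abs_pow, abs_of_nonneg (hβ i j)]
            exact mul_le_mul (mul_le_mul (hb i j) (h.le i x hx s hs) (abs_nonneg _) hB)
              (pow_le_pow_left₀ (abs_nonneg _) (h.le j x hx s hs) 2) (by positivity) (by positivity)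
        · have : m = 0 := by_contra fun h0 => hm.false ⟨0, Nat.pos_of_ne_zero h0⟩
          subst this
          simp [energyRate, hD]
      have h2 : |χ x ^ 6| ≤ 1 := by
        rw [abs_of_nonneg (by have := (hχ.mem x).1; positivity)]
        exact pow_le_one₀ (hχ.mem x).1 (hχ.mem x).2
      calc _ ≤ 1 * D := mul_le_mul h2 h1 (abs_nonneg _) zero_le_one
        _ = D := one_mul D
    · simp [hχ.supp x hx, hx]
  · exact (integrable_indicator_iff hK.measurableSet).2
      (integrableOn_const (hs := hK.measure_lt_top.ne))
  · by_cases hx : x ∈ closedBall (0 : Eu N) (3 / 4)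
    · refine HasDerivAt.const_mul _ ?_
      have e1 : HasDerivAt (fun r => 1 / 2 * ∑ i, gdot (fun y => v i y r) (fun y => v i y r) x)
          (1 / 2 * ∑ i, ∑ k, (pd k (fun y => p i y s) x * pd k (fun y => v i y s) x +
            pd k (fun y => v i y s) x * pd k (fun y => p i y s) x)) s :=
        HasDerivAt.const_mul _ (HasDerivAt.fun_sum fun i _ => HasDerivAt.fun_sum fun k _ =>
          (h.hd' i k x hx s hs).mul (h.hd' i k x hx s hs))
      refine (e1.sub (hasDerivAt_potential hsym fun i => h.hd i x hx s hs)).congr_deriv ?_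
      rw [energyRate, Finset.sum_sub_distrib, Finset.mul_sum]
      congr 1
      refine Finset.sum_congr rfl fun i _ => ?_
      rw [gdot, Finset.mul_sum]
      exact Finset.sum_congr rfl fun k _ => by ring
    · simp only [hχ.supp x hx]
      simpa using hasDerivAt_const s (0 : ℝ)

theorem exists_time_cutoff : ∃ (θ : ℝ → ℝ) (θ' : ℝ → ℝ) (A₀ : ℝ), 0 ≤ A₀ ∧
    (∀ t, HasDerivAt θ (θ' t) t) ∧
    (∀ t, |θ' t| ≤ A₀) ∧ (∀ t, θ t ∈ Icc (0 : ℝ) 1) ∧ (∀ t ∈ Icc (-(1 / 4) : ℝ) (1 / 4), θ t = 1) ∧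
    θ (-(1 / 2)) = 0 ∧ θ (1 / 2) = 0 := by
  let f : ContDiffBump (0 : ℝ) := ⟨1 / 4, 1 / 2, by norm_num, by norm_num⟩
  have hf : ContDiff ℝ 1 f := f.contDiff
  have hs : HasCompactSupport (deriv f) := f.hasCompactSupport.deriv
  obtain ⟨A, hA⟩ := hs.exists_bound_of_continuous (hf.continuous_deriv le_rfl)
  refine ⟨f, deriv f, A, (norm_nonneg _).trans (hA 0), fun t =>
    ((hf.differentiable (by norm_num)) t).hasDerivAt, hA, fun t => ⟨f.nonneg, f.le_one⟩, fun t ht =>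
    f.one_of_mem_closedBall ?_, f.zero_of_le_dist ?_, f.zero_of_le_dist ?_⟩
  · rw [Real.closedBall_eq_Icc]; simpa [f] using ht
  · norm_num [f]
  · norm_num [f]

theorem Flow.continuousOn_density (h : Flow β v p A (Ioo a b)) (hχ : Cutoff Λ χ) :
    ContinuousOn (fun t => ∫ x, χ x ^ 6 * ∑ i, v i x t ^ 6) (Ioo a b) := by
  refine continuousOn_integral_of_support (isCompact_closedBall (0 : Eu N) (3 / 4))
    (M := m * A ^ 6) (fun t ht => ?_) (fun x => ?_)
    (fun x t ht => ?_) fun x hx t ht => by simp [hχ.supp x hx]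
  · have hχc : Continuous fun x => χ x ^ 6 := hχ.contDiff.continuous
    have : ∀ i, Continuous fun x => v i x t := fun i => (h.c3 i t ht).continuous
    exact (hχc.mul (by fun_prop)).aestronglyMeasurable
  · by_cases hx : x ∈ closedBall (0 : Eu N) (3 / 4)
    · have : ∀ i, ContinuousOn (v i x) (Ioo a b) := fun i t ht =>
        (h.hd i x hx t ht).continuousAt.continuousWithinAt
      fun_prop
    · simp only [hχ.supp x hx]; simpa using continuousOn_const
  · by_cases hx : x ∈ closedBall (0 : Eu N) (3 / 4)
    · have h2 : |χ x ^ 6| ≤ 1 := by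
        rw [abs_of_nonneg (by have := (hχ.mem x).1; positivity)]
        exact pow_le_one₀ (hχ.mem x).1 (hχ.mem x).2
      rw [abs_mul]
      have h1 : |∑ i, v i x t ^ 6| ≤ m * A ^ 6 := by
        exact abs_sum_le fun i => by
          rw [abs_pow]; exact pow_le_pow_left₀ (abs_nonneg _) (h.le i x hx t ht) 6
      calc _ ≤ 1 * (m * A ^ 6) := mul_le_mul h2 h1 (abs_nonneg _) zero_le_one
        _ = _ := one_mul _
    · simp only [hχ.supp x hx]; simp; positivity

theorem Flow.continuousOn_residual (h : Flow β v p A (Ioo a b)) (hχ : Cutoff Λ χ) :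
    ContinuousOn (fun t => ∫ x, χ x ^ 6 * ∑ i, residual β (fun j y => v j y t)
      (fun j y => p j y t) i x ^ 2) (Ioo a b) := by
  refine continuousOn_integral_of_support (isCompact_closedBall (0 : Eu N) (3 / 4))
    (M := m * A ^ 2) (fun t ht => ?_) (fun x => ?_)
    (fun x t ht => ?_) fun x hx t ht => by simp [hχ.supp x hx]
  · have hχc : Continuous fun x => χ x ^ 6 := hχ.contDiff.continuous
    have := continuous_residual (β := β) (fun i => h.c3 i t ht) (fun i => h.c1 i t ht)
    exact (hχc.mul (by fun_prop)).aestronglyMeasurable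
  · by_cases hx : x ∈ closedBall (0 : Eu N) (3 / 4)
    · have := fun i => h.cont_res i x hx
      exact continuousOn_const.mul (continuousOn_finsetSum _ fun i _ => (this i).pow 2)
    · simp only [hχ.supp x hx]; simpa using continuousOn_const
  · by_cases hx : x ∈ closedBall (0 : Eu N) (3 / 4)
    · have h2 : |χ x ^ 6| ≤ 1 := by
        rw [abs_of_nonneg (by have := (hχ.mem x).1; positivity)]
        exact pow_le_one₀ (hχ.mem x).1 (hχ.mem x).2
      rw [abs_mul]
      have h1 : |∑ i, residual β (fun j y => v j y t) (fun j y => p j y t) i x ^ 2| ≤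
          m * A ^ 2 := by
        exact abs_sum_le fun i => by
          rw [abs_pow]; exact pow_le_pow_left₀ (abs_nonneg _) (h.le_res i x hx t ht) 2
      calc _ ≤ 1 * (m * A ^ 2) := mul_le_mul h2 h1 (abs_nonneg _) zero_le_one
        _ = _ := one_mul _
    · simp only [hχ.supp x hx]; simp; positivity

/-- The space-time integral of the sixth power is controlled by the residual. -/
theorem exists_flow_bound (hN3 : N ≤ 3) (hβ : ∀ i j, 0 ≤ β i j) (hsym : ∀ i j, β i j = β j i)
    (hdiag : ∀ i, 0 < β i i) (hΛ : 0 ≤ Λ) :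
    ∃ C : ℝ, 0 ≤ C ∧ ∀ χ : Eu N → ℝ, Cutoff Λ χ → ∀ (v p : Fin m → Eu N → ℝ → ℝ) (A : ℝ),
      Flow β v p A (Ioo (-1) 1) →
      ∫ t in (-(1 / 4) : ℝ)..(1 / 4), ∫ x, χ x ^ 6 * ∑ i, v i x t ^ 6 ≤
        C * ∫ t in (-(1 / 2) : ℝ)..(1 / 2), ((∫ x, χ x ^ 6 * ∑ i,
          residual β (fun j y => v j y t) (fun j y => p j y t) i x ^ 2) + 1) := by
  obtain ⟨θ, θ', A₀, hA₀, hθ', hθA, hθ, hθ1, hθa, hθb⟩ := exists_time_cutoff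
  obtain ⟨c, C, hc, hC, H⟩ := exists_slice_bound (N := N) hN3 hβ hsym hdiag hΛ hA₀
  refine ⟨C / c, by positivity, fun χ hχ v p A h => ?_⟩
  have hS : Icc (-(1 / 2) : ℝ) (1 / 2) ⊆ Ioo (-1) 1 := fun t ht =>
    ⟨by linarith [ht.1], by linarith [ht.2]⟩
  set D : ℝ → ℝ := fun t => ∫ x, χ x ^ 6 * ∑ i, v i x t ^ 6 with hD
  set e : ℝ → ℝ := fun t => (∫ x, χ x ^ 6 * ∑ i,
          residual β (fun j y => v j y t) (fun j y => p j y t) i x ^ 2) + 1 with he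
  have hDc : ContinuousOn D (Icc (-(1 / 2)) (1 / 2)) := (h.continuousOn_density hχ).mono hS
  have hec : ContinuousOn e (Icc (-(1 / 2)) (1 / 2)) :=
    ((h.continuousOn_residual hχ).mono hS).add continuousOn_const
  have hθc : Continuous θ := continuous_iff_continuousAt.2 fun t => (hθ' t).continuousAt
  have hder : ∀ t ∈ Ioo (-1 : ℝ) 1, HasDerivAt (fun s => θ s ^ 6 *
      ∫ x, χ x ^ 6 * energy β (fun j y => v j y s) x)
      (6 * θ t ^ 5 * θ' t * (∫ x, χ x ^ 6 * energy β (fun j y => v j y t) x) + θ t ^ 6 *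
      ∫ x, χ x ^ 6 * energyRate β (fun j y => v j y t) (fun j y => p j y t) x) t := fun t ht => by
    have := ((hθ' t).fun_pow 6).mul (h.hasDerivAt_energy hβ hsym hχ ht)
    exact this.congr_deriv (by norm_num)
  have hφ : ContinuousOn (fun t => C * e t - c * θ t ^ 6 * D t) (Icc (-(1 / 2)) (1 / 2)) := by
    fun_prop
  have key := intervalIntegral.sub_le_integral_of_hasDeriv_right_of_le (by norm_num)
    (fun t ht => (hder t (hS ht)).continuousAt.continuousWithinAt)
    (fun t ht => (hder t (hS (Ioo_subset_Icc_self ht))).hasDerivWithinAt)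
    hφ.integrableOn_Icc (fun t ht => by
      have ht' := hS (Ioo_subset_Icc_self ht)
      have := H (θ t) (hθ t) (θ' t) (hθA t) χ hχ (fun j y => v j y t) (fun j y => p j y t)
        (fun i => h.c3 i t ht') (fun i x => h.pos i x t ht') fun i => h.c1 i t ht'
      linarith)
  have hu : uIcc (-(1 / 2) : ℝ) (1 / 2) = Icc (-(1 / 2)) (1 / 2) := uIcc_of_le (by norm_num)
  have i1 : IntervalIntegrable (fun t => c * θ t ^ 6 * D t) volume (-(1 / 2)) (1 / 2) :=
    ContinuousOn.intervalIntegrable (by rw [hu]; fun_prop)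
  have i2 : IntervalIntegrable (fun t => C * e t) volume (-(1 / 2)) (1 / 2) :=
    ContinuousOn.intervalIntegrable (by rw [hu]; fun_prop)
  rw [hθa, hθb, intervalIntegral.integral_sub i2 i1,
    intervalIntegral.integral_const_mul] at key
  have hD0 : ∀ t, 0 ≤ D t := fun t => integral_nonneg fun x =>
    mul_nonneg (pow_nonneg (hχ.mem x).1 6) (Finset.sum_nonneg fun i _ => by positivity)
  have k2 : ∫ t in (-(1 / 4) : ℝ)..(1 / 4), c * D t ≤
      ∫ t in (-(1 / 2) : ℝ)..(1 / 2), c * θ t ^ 6 * D t := by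
    have e1 : ∫ t in (-(1 / 4) : ℝ)..(1 / 4), c * D t =
        ∫ t in (-(1 / 4) : ℝ)..(1 / 4), c * θ t ^ 6 * D t :=
      intervalIntegral.integral_congr fun t ht => by
        rw [uIcc_of_le (by norm_num)] at ht
        simp [hθ1 t ht]
    rw [e1]
    exact intervalIntegral.integral_mono_interval (by norm_num) (by norm_num) (by norm_num)
      (Eventually.of_forall fun t =>
        mul_nonneg (mul_nonneg hc.le (pow_nonneg (hθ t).1 6)) (hD0 t)) i1
  rw [intervalIntegral.integral_const_mul] at k2
  rw [div_mul_eq_mul_div, le_div_iff₀ hc]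
  norm_num at key
  norm_num at k2 ⊢
  linarith

end energy

section cutoff

variable {N : ℕ}

theorem exists_cutoff_pow (N : ℕ) : ∃ (χ : Eu N → ℝ) (Λ : ℝ), 0 ≤ Λ ∧ Cutoff Λ χ ∧
    ∀ x ∈ closedBall 0 (1 / 2), χ x = 1 := by
  obtain ⟨χ, hχ, hc, h0, h1, hs, he⟩ := exists_cutoff (N := N) (r := 1 / 2) (R := 3 / 4)
    (by norm_num) (by norm_num)
  have hχ2 : ContDiff ℝ 2 χ := contDiff_infty.1 hχ 2
  have hs' : ∀ x ∉ closedBall (0 : Eu N) (3 / 4), χ x = 0 := fun x hx =>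
    hs x (by simp at hx; exact hx.le)
  have hg : Continuous (gdot χ χ) := by
    have : ∀ k, Continuous (pd k χ) := fun k => continuous_pd (hχ2.of_le (by norm_num))
    unfold gdot; fun_prop
  have hgs : HasCompactSupport (gdot χ χ) := by
    refine HasCompactSupport.intro (isCompact_closedBall (0 : Eu N) (3 / 4)) fun x hx => ?_
    have : ∀ k, pd k χ x = 0 := fun k => by
      have e : χ =ᶠ[𝓝 x] fun _ => 0 := by
        filter_upwards [isClosed_closedBall.isOpen_compl.mem_nhds hx] with y hy using hs' y hy
      rw [pd, e.fderiv_eq]; simp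
    simp [gdot, this]
  obtain ⟨G, hG0, hG⟩ := exists_bound_of_support hg hgs
  obtain ⟨L, hL0, hL⟩ := exists_bound_of_support (continuous_lap hχ2) (hasCompactSupport_lap hc hχ2)
  set Λ := 6 * L + 36 * G + 1 with hΛ
  have hpow : ∀ x, deriv (fun s : ℝ => s ^ 6) x = 6 * x ^ 5 := fun x => by simp
  have hpow2 : ∀ x, deriv (deriv fun s : ℝ => s ^ 6) x = 30 * x ^ 4 := fun x => by
    have : (deriv fun s : ℝ => s ^ 6) = fun s => 6 * s ^ 5 := funext hpow
    rw [this]; simp; ring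
  have hdχ := hχ2.differentiable (by norm_num)
  refine ⟨χ, Λ, by positivity, ⟨hχ2, fun x => ⟨h0 x, h1 x⟩, hs', fun x => ?_, fun x => ?_⟩,
    fun x hx => he x (by simpa using hx)⟩
  · have hp : ∀ k, pd k (fun y => χ y ^ 6) x = 6 * χ x ^ 5 * pd k χ x := fun k => by
      rw [pd_comp (Φ := fun s : ℝ => s ^ 6) (by fun_prop) (hdχ x), hpow]
    have e : gdot (fun y => χ y ^ 6) (fun y => χ y ^ 6) x = 36 * gdot χ χ x * χ x ^ 10 := by
      simp only [gdot, hp, Finset.mul_sum, Finset.sum_mul]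
      exact Finset.sum_congr rfl fun k _ => by ring
    rw [e]
    refine mul_le_mul_of_nonneg_right ?_ (by have := h0 x; positivity)
    have := (le_abs_self _).trans (hG x)
    nlinarith
  · have e : lap (fun y => χ y ^ 6) x = χ x ^ 4 * (6 * (χ x * lap χ x) + 30 * gdot χ χ x) := by
      rw [lap_comp (Φ := fun s : ℝ => s ^ 6) (by fun_prop) hχ2, hpow, hpow2]
      simp only [gdot, sq]; ring
    rw [e, abs_mul, abs_of_nonneg (by have := h0 x; positivity), mul_comm]
    refine mul_le_mul_of_nonneg_right ?_ (by have := h0 x; positivity)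
    have k1 : |χ x * lap χ x| ≤ L := by
      rw [abs_mul, abs_of_nonneg (h0 x)]
      calc χ x * |lap χ x| ≤ 1 * L := mul_le_mul (h1 x) (hL x) (abs_nonneg _) zero_le_one
        _ = L := one_mul L
    have k2 := hG x
    rw [abs_le] at k1 k2 ⊢
    constructor <;> linarith

end cutoff

section flow

variable {N m : ℕ} {β : Fin m → Fin m → ℝ} {u : Fin m → Eu N → ℝ → ℝ} {η : Eu N → ℝ} {ε δ M : ℝ}

/-- The mollified solution, shifted to be positive. -/
noncomputable def smooth (η : Eu N → ℝ) (δ : ℝ) (u : Fin m → Eu N → ℝ → ℝ) (i : Fin m) (x : Eu N)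
    (t : ℝ) : ℝ := mollify η (fun y => u i y t) x + δ

/-- The time derivative of the mollified solution. -/
noncomputable def smoothDot (β : Fin m → Fin m → ℝ) (η : Eu N → ℝ) (u : Fin m → Eu N → ℝ → ℝ)
    (i : Fin m) (x : Eu N) (t : ℝ) : ℝ :=
  mollify (lap η) (fun y => u i y t) x + mollify η (fun y => source β u i y t) x

theorem pd_add_const (k : Fin N) (f : Eu N → ℝ) (c : ℝ) (x : Eu N) :
    pd k (fun y => f y + c) x = pd k f x := by
  simp [pd]

theorem residual_smooth (h : IsSol β u (Ioo (-1) 1)) (hη : ContDiff ℝ (⊤ : ℕ∞) η)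
    (hs : HasCompactSupport η) {t : ℝ} (ht : t ∈ Ioo (-1) 1) (i : Fin m) (x : Eu N) :
    residual β (fun j y => smooth η δ u j y t) (fun j y => smoothDot β η u j y t) i x =
      mollify η (fun y => source β u i y t) x - cubic β (fun j => smooth η δ u j x t) i := by
  have e : lap (fun y => smooth η δ u i y t) x = mollify (lap η) (fun y => u i y t) x := by
    unfold smooth
    rw [lap_add (contDiff_mollify hη hs (h.continuous ht i) 2) contDiff_const, lap_const,
      lap_mollify hη hs (h.continuous ht i), add_zero]
  rw [residual, e, smoothDot]
  ring

theorem abs_cubic_le (hβ : ∀ i j, 0 ≤ β i j) {a : Fin m → ℝ} {A : ℝ} (ha : ∀ i, |a i| ≤ A)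
    (i : Fin m) : |cubic β a i| ≤ (∑ k, ∑ j, β k j) * A ^ 3 := by
  refine le_trans ?_ (cubic_le hβ (a := fun i => |a i|) (fun i => ⟨abs_nonneg _, ha i⟩) i)
  refine (Finset.abs_sum_le_sum_abs _ _).trans (Finset.sum_le_sum fun j _ => ?_)
  rw [abs_mul, abs_mul, abs_pow, abs_of_nonneg (hβ i j)]

theorem IsSol.flow (hN : 0 < N) (hβ : ∀ i j, 0 ≤ β i j) (h : IsSol β u (Ioo (-1) 1)) (hM0 : 0 ≤ M)
    (hM : ∀ i, ∀ x ∈ ball 0 1, ∀ t ∈ Ioo (-1) 1, u i x t ≤ M) (hη : ContDiff ℝ (⊤ : ℕ∞) η)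
    (hη0 : ∀ x, 0 ≤ η x) (hs : ∀ x ∉ closedBall 0 ε, η x = 0) (hε : ε < 1 / 4) (hδ : 0 < δ) :
    ∃ A, Flow β (smooth η δ u) (smoothDot β η u) A (Ioo (-1) 1) := by
  have hc : HasCompactSupport η := .intro (isCompact_closedBall _ _) hs
  have hη2 : ContDiff ℝ 2 η := contDiff_infty.1 hη 2
  have hlη := contDiff_lap_top hη
  have hls := lap_eq_zero_of_eqOn isClosed_closedBall hs
  have hlc : HasCompactSupport (lap η) := .intro (isCompact_closedBall _ _) hls
  have hps : ∀ {f : Eu N → ℝ}, (∀ x ∉ closedBall 0 ε, f x = 0) → ∀ k, ∀ x ∉ closedBall 0 ε,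
      pd k f x = 0 := by
    intro f hf k x hx
    have e : f =ᶠ[𝓝 x] fun _ => 0 := by
      filter_upwards [isClosed_closedBall.isOpen_compl.mem_nhds hx] with y hy using hf y hy
    rw [pd, e.fderiv_eq]; simp
  have hball : ∀ x ∈ closedBall (0 : Eu N) (3 / 4), closedBall x ε ⊆ ball 0 1 := fun x hx y hy => by
    rw [mem_closedBall] at hx hy
    rw [mem_ball]
    linarith [dist_triangle y x 0]
  set G := (∑ k, ∑ j, β k j) * M ^ 3 with hG
  have hB : 0 ≤ ∑ k, ∑ j, β k j := Finset.sum_nonneg fun k _ => Finset.sum_nonneg fun j _ => hβ k j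
  have hG0 : 0 ≤ G := by positivity
  have hMa : ∀ i, ∀ t ∈ Ioo (-1 : ℝ) 1, ∀ x ∈ ball 0 1, |u i x t| ≤ M := fun i t ht x hx => by
    rw [abs_of_nonneg (h.nonneg i x t ht)]; exact hM i x hx t ht
  have hGa : ∀ i, ∀ t ∈ Ioo (-1 : ℝ) 1, ∀ x ∈ ball 0 1, |source β u i x t| ≤ G := fun i t ht x hx =>
    h.abs_source_le hβ hM i x hx t ht
  have hb : ∀ {f : Eu N → ℝ}, Continuous f → (∀ x ∉ closedBall 0 ε, f x = 0) → ∀ i,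
      ∀ x ∈ closedBall 0 (3 / 4), ∀ t ∈ Ioo (-1 : ℝ) 1,
      |mollify f (fun y => u i y t) x| ≤ M * ∫ z, |f z| := fun hf hfs i x hx t ht =>
    abs_mollify_le hf hfs (hball x hx) (hMa i t ht)
  have hb' : ∀ {f : Eu N → ℝ}, Continuous f → (∀ x ∉ closedBall 0 ε, f x = 0) → ∀ i,
      ∀ x ∈ closedBall 0 (3 / 4), ∀ t ∈ Ioo (-1 : ℝ) 1,
      |mollify f (fun y => source β u i y t) x| ≤ G * ∫ z, |f z| := fun hf hfs i x hx t ht =>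
    abs_mollify_le hf hfs (hball x hx) (hGa i t ht)
  have hI : ∀ f : Eu N → ℝ, 0 ≤ ∫ z, |f z| := fun f => integral_nonneg fun z => abs_nonneg _
  set A₁ := M * (∫ z, |η z|) + δ with hA₁
  set A₂ := M * (∫ z, |lap η z|) + G * ∫ z, |η z| with hA₂
  set A₃ := ∑ k, M * ∫ z, |pd k η z| with hA₃
  set A₄ := ∑ k, (M * (∫ z, |pd k (lap η) z|) + G * ∫ z, |pd k η z|) with hA₄
  set A₅ := G * (∫ z, |η z|) + (∑ k, ∑ j, β k j) * A₁ ^ 3 with hA₅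
  have n₁ : 0 ≤ A₁ := by have := hI η; positivity
  have n₂ : 0 ≤ A₂ := by have := hI η; have := hI (lap η); positivity
  have n₃ : 0 ≤ A₃ := Finset.sum_nonneg fun k _ => mul_nonneg hM0 (hI _)
  have n₄ : 0 ≤ A₄ := Finset.sum_nonneg fun k _ =>
      add_nonneg (mul_nonneg hM0 (hI _)) (mul_nonneg hG0 (hI _))
  have n₅ : 0 ≤ A₅ := by have := hI η; positivity
  have hpv : ∀ i k t x, t ∈ Ioo (-1 : ℝ) 1 → pd k (fun y => smooth η δ u i y t) x =
      mollify (pd k η) (fun y => u i y t) x := fun i k t x ht => by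
    unfold smooth
    rw [pd_add_const, pd_mollify hη hc (h.continuous ht i)]
  have hpp : ∀ i k t x, t ∈ Ioo (-1 : ℝ) 1 → pd k (fun y => smoothDot β η u i y t) x =
      mollify (pd k (lap η)) (fun y => u i y t) x +
        mollify (pd k η) (fun y => source β u i y t) x :=
    fun i k t x ht => by
    unfold smoothDot
    rw [pd_add ((contDiff_mollify hlη hlc (h.continuous ht i) 1).differentiable (by norm_num) x)
      ((contDiff_mollify hη hc (h.continuous_source ht i) 1).differentiable (by norm_num) x),
      pd_mollify hlη hlc (h.continuous ht i), pd_mollify hη hc (h.continuous_source ht i)]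
  have hv : ∀ i, ∀ x ∈ closedBall 0 (3 / 4), ∀ t ∈ Ioo (-1) 1, |smooth η δ u i x t| ≤ A₁ :=
    fun i x hx t ht => (abs_add_le _ _).trans
      (add_le_add (hb hη.continuous hs i x hx t ht) (abs_of_pos hδ).le)
  have hder : ∀ {f : Eu N → ℝ}, ContDiff ℝ 2 f → (∀ x ∉ closedBall 0 ε, f x = 0) → ∀ i,
      ∀ x ∈ closedBall 0 (3 / 4), ∀ t ∈ Ioo (-1 : ℝ) 1,
      HasDerivAt (fun s => mollify f (fun y => u i y s) x)
      (mollify (lap f) (fun y => u i y t) x + mollify f (fun y => source β u i y t) x) t :=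
    fun hf hfs i x hx t ht => h.hasDerivAt_mollify hN hβ hM hf hfs (by
      rw [mem_closedBall_zero_iff] at hx; linarith) one_pos i ht
  refine ⟨A₁ + A₂ + A₃ + A₄ + A₅, fun i t ht => ?_, fun i t ht => ?_, fun i x t ht => ?_,
    fun i x hx t ht => ?_, fun i k x hx t ht => ?_, fun i x hx t ht => ?_, fun i x hx t ht => ?_,
    fun i k x hx t ht => ?_, fun i k x hx t ht => ?_, fun i x hx => ?_, fun i x hx t ht => ?_⟩
  · exact (contDiff_mollify hη hc (h.continuous ht i) 3).add contDiff_const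
  · exact (contDiff_mollify hlη hlc (h.continuous ht i) 1).add
      (contDiff_mollify hη hc (h.continuous_source ht i) 1)
  · exact add_pos_of_nonneg_of_pos (integral_nonneg fun y =>
      mul_nonneg (h.nonneg i y t ht) (hη0 _)) hδ
  · exact (hder hη2 hs i x hx t ht).add_const δ
  · have e := hder (contDiff_infty.1 (contDiff_pd_top hη k) 2) (hps hs k) i x hx t ht
    have l : lap (pd k η) = pd k (lap η) := funext fun y => lap_pd (contDiff_infty.1 hη 3) k y
    rw [l, ← hpp i k t x ht] at e
    refine e.congr_of_eventuallyEq ?_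
    filter_upwards [isOpen_Ioo.mem_nhds ht] with s hs' using hpv i k s x hs'
  · linarith [hv i x hx t ht]
  · have := (abs_add_le _ _).trans (add_le_add (hb hlη.continuous hls i x hx t ht)
      (hb' hη.continuous hs i x hx t ht))
    rw [← hA₂] at this
    exact this.trans (by linarith)
  · rw [hpv i k t x ht]
    have k1 := hb (contDiff_pd_top hη k).continuous (hps hs k) i x hx t ht
    have k2 := Finset.single_le_sum (f := fun k => M * ∫ z, |pd k η z|)
      (fun k _ => mul_nonneg hM0 (hI _)) (Finset.mem_univ k)
    rw [← hA₃] at k2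
    exact (k1.trans k2).trans (by linarith)
  · rw [hpp i k t x ht]
    have k1 := (abs_add_le _ _).trans (add_le_add
      (hb (contDiff_pd_top hlη k).continuous (hps hls k) i x hx t ht)
      (hb' (contDiff_pd_top hη k).continuous (hps hs k) i x hx t ht))
    have k2 := Finset.single_le_sum
        (f := fun k => M * (∫ z, |pd k (lap η) z|) + G * ∫ z, |pd k η z|)
      (fun k _ => add_nonneg (mul_nonneg hM0 (hI _)) (mul_nonneg hG0 (hI _))) (Finset.mem_univ k)
    rw [← hA₄] at k2
    exact (k1.trans k2).trans (by linarith)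
  · have k1 : ContinuousOn (fun t => mollify η (fun y => source β u i y t) x) (Ioo (-1) 1) := by
      refine continuousOn_integral_mul (x₀ := x) (r := ε) (M := G) (C := _)
        (fun t ht => h.continuous_source ht i)
        (fun y t ht => (h.continuousAt_source ht i y).continuousWithinAt)
        (fun y hy t ht => hGa i t ht y (hball x hx hy))
        (fun t _ => hη.continuous.comp (continuous_const.sub continuous_id))
        (fun y => continuousOn_const)
        (fun y t _ => (exists_bound_of_support hη.continuous hc).choose_spec.2 (x - y))
        (fun y hy t _ => hs _ fun hy' => hy ?_)
      rw [mem_closedBall, dist_eq_norm, ← norm_neg, neg_sub]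
      simpa using hy'
    have k2 : ∀ j, ContinuousOn (fun t => smooth η δ u j x t) (Ioo (-1) 1) := fun j t ht =>
      ((hder hη2 hs j x hx t ht).add_const δ).continuousAt.continuousWithinAt
    refine ContinuousOn.congr (f := fun t => mollify η (fun y => source β u i y t) x -
      cubic β (fun j => smooth η δ u j x t) i) ?_ fun t ht => residual_smooth h hη hc ht i x
    refine k1.sub ?_
    unfold cubic
    exact continuousOn_finsetSum _ fun j _ => (continuousOn_const.mul (k2 i)).mul ((k2 j).pow 2)
  · rw [residual_smooth h hη hc ht i x]
    have := (abs_sub _ _).trans (add_le_add (hb' hη.continuous hs i x hx t ht)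
      (abs_cubic_le hβ (fun j => hv j x hx t ht) i))
    rw [← hA₅] at this
    exact this.trans (by linarith)

end flow

section limit

variable {N m : ℕ} {β : Fin m → Fin m → ℝ}

theorem exists_mollifier (N : ℕ) : ∃ η : ℕ → Eu N → ℝ, (∀ n, ContDiff ℝ (⊤ : ℕ∞) (η n)) ∧
    (∀ n x, 0 ≤ η n x) ∧ (∀ n, ∀ x ∉ closedBall 0 (1 / 5), η n x = 0) ∧ (∀ n, ∫ x, |η n x| = 1) ∧
    ∀ w : Eu N → ℝ, Continuous w → ∀ x, Tendsto (fun n => mollify (η n) w x) atTop (𝓝 (w x)) := by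
  let f : ℕ → ContDiffBump (0 : Eu N) := fun n =>
    ⟨1 / ((n : ℝ) + 1) / 10, 1 / ((n : ℝ) + 1) / 5, by positivity, by
      have : (0 : ℝ) < 1 / ((n : ℝ) + 1) := by positivity
      linarith⟩
  have hr : ∀ n, (f n).rOut = 1 / ((n : ℝ) + 1) / 5 := fun n => rfl
  refine ⟨fun n => (f n).normed volume, fun n => (f n).contDiff_normed, fun n x =>
    (f n).nonneg_normed x, fun n x hx => ?_, fun n => ?_, fun w hw x => ?_⟩
  · by_contra h0
    have : x ∈ Function.support ((f n).normed volume) := h0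
    rw [(f n).support_normed_eq, hr, mem_ball_zero_iff] at this
    rw [mem_closedBall_zero_iff] at hx
    have h1 : 1 / ((n : ℝ) + 1) ≤ 1 := by
      rw [div_le_one (by positivity)]; linarith [n.cast_nonneg (α := ℝ)]
    linarith
  · simp_rw [abs_of_nonneg ((f n).nonneg_normed _)]
    exact (f n).integral_normed
  · have ht : Tendsto (fun n => (f n).rOut) atTop (𝓝 0) := by
      have := (tendsto_one_div_add_atTop_nhds_zero_nat (𝕜 := ℝ)).div_const 5
      simpa [hr] using this
    refine (ContDiffBump.convolution_tendsto_right_of_continuous (μ := volume) ht hw x).congr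
        fun n => ?_
    rw [mollify, ← integral_sub_left_eq_self _ _ x]
    simp [convolution, mul_comm]

variable {Λ : ℝ} {χ : Eu N → ℝ}

theorem Cutoff.norm_le (hχ : Cutoff Λ χ) {w : Eu N → ℝ} {D : ℝ}
    (hb : ∀ x ∈ closedBall 0 (3 / 4), |w x| ≤ D) (x : Eu N) :
    ‖χ x ^ 6 * w x‖ ≤ (closedBall (0 : Eu N) (3 / 4)).indicator (fun _ => D) x := by
  by_cases hx : x ∈ closedBall (0 : Eu N) (3 / 4)
  · have h2 : |χ x ^ 6| ≤ 1 := by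
      rw [abs_of_nonneg (by have := (hχ.mem x).1; positivity)]
      exact pow_le_one₀ (hχ.mem x).1 (hχ.mem x).2
    rw [indicator_of_mem hx, norm_mul, Real.norm_eq_abs, Real.norm_eq_abs]
    calc _ ≤ 1 * D := mul_le_mul h2 (hb x hx) (abs_nonneg _) zero_le_one
      _ = D := one_mul D
  · simp [hχ.supp x hx, hx]

theorem integrable_indicator_closedBall (D : ℝ) :
    Integrable ((closedBall (0 : Eu N) (3 / 4)).indicator fun _ => D) :=
  (integrable_indicator_iff isClosed_closedBall.measurableSet).2
    (integrableOn_const (hs := (isCompact_closedBall _ _).measure_lt_top.ne))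

theorem Cutoff.abs_integral_le (hχ : Cutoff Λ χ) {w : Eu N → ℝ} {D : ℝ}
    (hb : ∀ x ∈ closedBall 0 (3 / 4), |w x| ≤ D) :
    |∫ x, χ x ^ 6 * w x| ≤ ∫ x, (closedBall (0 : Eu N) (3 / 4)).indicator (fun _ => D) x :=
  norm_integral_le_of_norm_le (integrable_indicator_closedBall D)
    (Eventually.of_forall (hχ.norm_le hb))

theorem Cutoff.tendsto_integral (hχ : Cutoff Λ χ) {w : ℕ → Eu N → ℝ} {w' : Eu N → ℝ} {D : ℝ}
    (hc : ∀ n, Continuous (w n)) (hb : ∀ n, ∀ x ∈ closedBall 0 (3 / 4), |w n x| ≤ D)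
    (ht : ∀ x, Tendsto (fun n => w n x) atTop (𝓝 (w' x))) :
    Tendsto (fun n => ∫ x, χ x ^ 6 * w n x) atTop (𝓝 (∫ x, χ x ^ 6 * w' x)) :=
  tendsto_integral_of_dominated_convergence _
    (fun n => (hχ.contDiff.continuous.mul (hc n)).aestronglyMeasurable)
    (integrable_indicator_closedBall D) (fun n => Eventually.of_forall (hχ.norm_le (hb n)))
    (Eventually.of_forall fun x => (ht x).const_mul _)

/-- The localized sixth powers of bounded solutions have universally bounded space-time
integrals. -/
theorem exists_weighted_bound (hN : 0 < N) (hN3 : N ≤ 3) (hβ : ∀ i j, 0 ≤ β i j)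
    (hsym : ∀ i j, β i j = β j i) (hdiag : ∀ i, 0 < β i i) (hΛ : 0 ≤ Λ) (hχ : Cutoff Λ χ) :
    ∃ C : ℝ, ∀ (u : Fin m → Eu N → ℝ → ℝ) (M : ℝ), IsSol β u (Ioo (-1) 1) → 0 ≤ M →
      (∀ i, ∀ x ∈ ball 0 1, ∀ t ∈ Ioo (-1) 1, u i x t ≤ M) →
      ∫ t in (-(1 / 4) : ℝ)..(1 / 4), ∫ x, χ x ^ 6 * ∑ i, u i x t ^ 6 ≤ C := by
  obtain ⟨C, hC, H⟩ := exists_flow_bound (N := N) hN3 hβ hsym hdiag hΛ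
  obtain ⟨η, hη, hη0, hηs, hη1, hηt⟩ := exists_mollifier N
  refine ⟨C, fun u M h hM0 hM => ?_⟩
  have hc : ∀ n, HasCompactSupport (η n) := fun n => .intro (isCompact_closedBall _ _) (hηs n)
  set δ : ℕ → ℝ := fun n => 1 / ((n : ℝ) + 1) with hδ
  have hδ0 : ∀ n, 0 < δ n := fun n => by positivity
  have hδ1 : ∀ n, δ n ≤ 1 := fun n => by
    rw [hδ]; simp only; rw [div_le_one (by positivity)]; linarith [n.cast_nonneg (α := ℝ)]
  have hδt : Tendsto δ atTop (𝓝 0) := tendsto_one_div_add_atTop_nhds_zero_nat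
  choose A hA using fun n => h.flow hN hβ hM0 hM (hη n) (hη0 n) (hηs n) (by norm_num) (hδ0 n)
  set B := ∑ k, ∑ j, β k j with hB
  set v : ℕ → Fin m → Eu N → ℝ → ℝ := fun n => smooth (η n) (δ n) u with hv
  set ρ : ℕ → Fin m → Eu N → ℝ → ℝ := fun n i x t =>
      residual β (fun j y => smooth (η n) (δ n) u j y t)
    (fun j y => smoothDot β (η n) u j y t) i x with hρ
  have hball : ∀ x ∈ closedBall (0 : Eu N) (3 / 4), closedBall x (1 / 5) ⊆ ball 0 1 :=
      fun x hx y hy => by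
    rw [mem_closedBall] at hx hy
    rw [mem_ball]
    linarith [dist_triangle y x 0]
  have hvle : ∀ n i, ∀ t ∈ Ioo (-1 : ℝ) 1, ∀ x ∈ closedBall 0 (3 / 4), |v n i x t| ≤ M + 1 :=
    fun n i t ht x hx => by
      have := abs_mollify_le (w := fun y => u i y t) (M := M) (hη n).continuous (hηs n) (hball x hx)
        (fun y hy => by rw [abs_of_nonneg (h.nonneg i y t ht)]; exact hM i y hy t ht)
      rw [hη1, mul_one] at this
      exact (abs_add_le _ _).trans (add_le_add this ((abs_of_pos (hδ0 n)).trans_le (hδ1 n)))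
  set D := B * M ^ 3 + B * (M + 1) ^ 3 with hD
  have hρe : ∀ n i, ∀ t ∈ Ioo (-1 : ℝ) 1, ∀ x, ρ n i x t =
      mollify (η n) (fun y => source β u i y t) x - cubic β (fun j => v n j x t) i :=
    fun n i t ht x => residual_smooth h (hη n) (hc n) ht i x
  have hρle : ∀ n i, ∀ t ∈ Ioo (-1 : ℝ) 1, ∀ x ∈ closedBall 0 (3 / 4), |ρ n i x t| ≤ D :=
    fun n i t ht x hx => by
      rw [hρe n i t ht x]
      have := abs_mollify_le (w := fun y => source β u i y t) (hη n).continuous (hηs n) (hball x hx)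
        (fun y hy => h.abs_source_le hβ hM i y hy t ht)
      rw [hη1, mul_one] at this
      exact (abs_sub _ _).trans (add_le_add this (abs_cubic_le hβ (fun j => hvle n j t ht x hx) i))
  have hvt : ∀ i, ∀ t ∈ Ioo (-1 : ℝ) 1, ∀ x, Tendsto (fun n => v n i x t) atTop (𝓝 (u i x t)) :=
    fun i t ht x => by
      have := (hηt _ (h.continuous ht i) x).add hδt
      rw [add_zero] at this
      exact this
  have hρt : ∀ i, ∀ t ∈ Ioo (-1 : ℝ) 1, ∀ x, Tendsto (fun n => ρ n i x t) atTop (𝓝 0) :=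
    fun i t ht x => by
      have h1 := hηt _ (h.continuous_source ht i) x
      have h2 : Tendsto (fun n => cubic β (fun j => v n j x t) i) atTop (𝓝 (source β u i x t)) := by
        unfold cubic source
        exact tendsto_finsetSum _ fun j _ => (tendsto_const_nhds.mul (hvt i t ht x)).mul
            ((hvt j t ht x).pow 2)
      have := h1.sub h2
      rw [sub_self] at this
      exact this.congr fun n => (hρe n i t ht x).symm
  have hI : ∀ {c : ℝ}, 0 < c → c ≤ 1 / 2 → ∀ t ∈ uIoc (-c) c, t ∈ Ioo (-1 : ℝ) 1 :=
      fun h0 h1 t ht => by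
    rw [uIoc_of_le (by linarith)] at ht
    exact ⟨by linarith [ht.1], by linarith [ht.2]⟩
  have lim1 : Tendsto (fun n => ∫ t in (-(1 / 4) : ℝ)..(1 / 4), ∫ x, χ x ^ 6 * ∑ i, v n i x t ^ 6)
      atTop
      (𝓝 (∫ t in (-(1 / 4) : ℝ)..(1 / 4), ∫ x, χ x ^ 6 * ∑ i, u i x t ^ 6)) := by
    have hb : ∀ n, ∀ t ∈ Ioo (-1 : ℝ) 1, ∀ x ∈ closedBall (0 : Eu N) (3 / 4),
        |∑ i, v n i x t ^ 6| ≤ m * (M + 1) ^ 6 := fun n t ht x hx => abs_sum_le fun i => by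
      rw [abs_pow]; exact pow_le_pow_left₀ (abs_nonneg _) (hvle n i t ht x hx) 6
    refine intervalIntegral.tendsto_integral_filter_of_dominated_convergence (fun _ => _)
      (Eventually.of_forall fun n => (((hA n).continuousOn_density hχ).mono
        (hI (by norm_num) (by norm_num))).aestronglyMeasurable measurableSet_uIoc)
      (Eventually.of_forall fun n => Eventually.of_forall fun t ht =>
        hχ.abs_integral_le (hb n t (hI (by norm_num) (by norm_num) t ht)))
      intervalIntegrable_const (Eventually.of_forall fun t ht => ?_)
    have ht' := hI (by norm_num) (by norm_num) t ht
    refine hχ.tendsto_integral (fun n => ?_) (fun n => hb n t ht') fun x =>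
      tendsto_finsetSum _ fun i _ => (hvt i t ht' x).pow 6
    exact continuous_finsetSum _ fun i _ => ((hA n).c3 i t ht').continuous.pow 6
  have lim2 : Tendsto (fun n => ∫ t in (-(1 / 2) : ℝ)..(1 / 2),
      ((∫ x, χ x ^ 6 * ∑ i, ρ n i x t ^ 2) + 1))
      atTop (𝓝 (∫ t in (-(1 / 2) : ℝ)..(1 / 2), (0 + 1 : ℝ))) := by
    have hb : ∀ n, ∀ t ∈ Ioo (-1 : ℝ) 1, ∀ x ∈ closedBall (0 : Eu N) (3 / 4),
        |∑ i, ρ n i x t ^ 2| ≤ m * D ^ 2 := fun n t ht x hx => abs_sum_le fun i => by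
      rw [abs_pow]; exact pow_le_pow_left₀ (abs_nonneg _) (hρle n i t ht x hx) 2
    refine intervalIntegral.tendsto_integral_filter_of_dominated_convergence (fun _ => _ + 1)
      (Eventually.of_forall fun n => ((((hA n).continuousOn_residual hχ).add
          continuousOn_const).mono
        (hI (by norm_num) (by norm_num))).aestronglyMeasurable measurableSet_uIoc)
      (Eventually.of_forall fun n => Eventually.of_forall fun t ht =>
        (abs_add_le _ _).trans (add_le_add (hχ.abs_integral_le
          (hb n t (hI (by norm_num) (by norm_num) t ht))) abs_one.le))
      intervalIntegrable_const (Eventually.of_forall fun t ht => ?_)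
    have ht' := hI (by norm_num) (by norm_num) t ht
    have k := hχ.tendsto_integral (w := fun n x => ∑ i, ρ n i x t ^ 2) (w' := fun _ => 0)
        (fun n => ?_)
      (fun n => hb n t ht') fun x => ?_
    · simp only [mul_zero, integral_zero] at k
      exact k.add_const 1
    · exact continuous_finsetSum _ fun i _ =>
        (continuous_residual (fun i => (hA n).c3 i t ht') (fun i => (hA n).c1 i t ht') i).pow 2
    · have := tendsto_finsetSum Finset.univ fun i _ => (hρt i t ht' x).pow 2
      simpa using this
  have key := le_of_tendsto_of_tendsto' lim1 (lim2.const_mul C) fun n => H χ hχ _ _ _ (hA n)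
  refine key.trans (le_of_eq ?_)
  rw [intervalIntegral.integral_const]
  norm_num

/-- Universal space-time bound for the sixth powers of bounded solutions. -/
theorem exists_sixth_bound (hN : 0 < N) (hN3 : N ≤ 3) (hβ : ∀ i j, 0 ≤ β i j)
    (hsym : ∀ i j, β i j = β j i) (hdiag : ∀ i, 0 < β i i) :
    ∃ C : ℝ, ∀ (u : Fin m → Eu N → ℝ → ℝ) (M : ℝ), IsSol β u (Ioo (-1) 1) → 0 ≤ M →
      (∀ i, ∀ x ∈ ball 0 1, ∀ t ∈ Ioo (-1) 1, u i x t ≤ M) → ∀ i,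
      ∫ t in (-(1 / 4) : ℝ)..(1 / 4), ∫ x in closedBall 0 (1 / 2), u i x t ^ 6 ≤ C := by
  obtain ⟨χ, Λ, hΛ, hχ, hχ1⟩ := exists_cutoff_pow N
  obtain ⟨C, hC⟩ := exists_weighted_bound hN hN3 hβ hsym hdiag hΛ hχ
  refine ⟨C, fun u M h hM0 hM i => le_trans ?_ (hC u M h hM0 hM)⟩
  have hsub : closedBall (0 : Eu N) (3 / 4) ⊆ ball 0 1 := closedBall_subset_ball (by norm_num)
  have hsub' : closedBall (0 : Eu N) (1 / 2) ⊆ closedBall 0 (3 / 4) :=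
    closedBall_subset_closedBall (by norm_num)
  have hI : Icc (-(1 / 4) : ℝ) (1 / 4) ⊆ Ioo (-1) 1 := fun t ht =>
      ⟨by linarith [ht.1], by linarith [ht.2]⟩
  have hMa : ∀ i, ∀ t ∈ Ioo (-1 : ℝ) 1, ∀ x ∈ closedBall 0 (3 / 4), |u i x t| ≤ M :=
      fun i t ht x hx => by
    rw [abs_of_nonneg (h.nonneg i x t ht)]; exact hM i x (hsub hx) t ht
  have c1 : ContinuousOn (fun t => ∫ x in closedBall 0 (1 / 2), u i x t ^ 6)
      (Icc (-(1 / 4)) (1 / 4)) :=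
    continuousOn_setIntegral (M := M ^ 6) (fun t ht => (h.continuous (hI ht) i).pow 6)
      (fun x t ht => ((h.continuousAt (hI ht) i x).pow 6).continuousWithinAt)
      (fun x hx t ht => by
        rw [abs_pow]
        exact pow_le_pow_left₀ (abs_nonneg _) (hMa i t (hI ht) x (hsub' hx)) 6)
  have hb : ∀ t ∈ Icc (-(1 / 4) : ℝ) (1 / 4), ∀ x ∈ closedBall (0 : Eu N) (3 / 4),
      |∑ i, u i x t ^ 6| ≤ m * M ^ 6 := fun t ht x hx => abs_sum_le fun i => by
    rw [abs_pow]; exact pow_le_pow_left₀ (abs_nonneg _) (hMa i t (hI ht) x hx) 6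
  have hcs : ∀ t ∈ Icc (-(1 / 4) : ℝ) (1 / 4), Continuous fun x => χ x ^ 6 * ∑ i, u i x t ^ 6 :=
    fun t ht => hχ.contDiff.continuous.mul
      (continuous_finsetSum _ fun i _ => (h.continuous (hI ht) i).pow 6)
  have c2 : ContinuousOn (fun t => ∫ x, χ x ^ 6 * ∑ i, u i x t ^ 6) (Icc (-(1 / 4)) (1 / 4)) :=
    continuousOn_integral_of_support (isCompact_closedBall (0 : Eu N) (3 / 4)) (M := m * M ^ 6)
      (fun t ht => (hcs t ht).aestronglyMeasurable)
      (fun x t ht => (continuousAt_const.mul (tendsto_finsetSum _ fun i _ =>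
        (h.continuousAt (hI ht) i x).pow 6)).continuousWithinAt)
      (fun x t ht => (hχ.norm_le (hb t ht) x).trans
        (indicator_le_self' (fun _ _ => by positivity) x))
      (fun x hx t ht => by simp [hχ.supp x hx])
  refine intervalIntegral.integral_mono_on (by norm_num)
    (c1.intervalIntegrable_of_Icc (by norm_num)) (c2.intervalIntegrable_of_Icc (by norm_num))
    fun t ht => ?_
  have hn : ∀ j x, 0 ≤ u j x t ^ 6 := fun j x => pow_nonneg (h.nonneg j x t (hI ht)) 6
  have hint : Integrable fun x => χ x ^ 6 * ∑ i, u i x t ^ 6 :=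
    integrable_of_support (x₀ := 0) (r := 3 / 4) (hcs t ht) fun x hx => by simp [hχ.supp x hx]
  refine le_trans (setIntegral_mono_on (((h.continuous (hI ht) i).pow
      6).continuousOn.integrableOn_compact
    (isCompact_closedBall _ _)) hint.integrableOn isClosed_closedBall.measurableSet fun x hx => ?_)
    (setIntegral_le_integral hint (Eventually.of_forall fun x =>
      mul_nonneg (pow_nonneg (hχ.mem x).1 6) (Finset.sum_nonneg fun j _ => hn j x)))
  rw [hχ1 x hx, one_pow, one_mul]
  exact Finset.single_le_sum (f := fun j => u j x t ^ 6) (fun j _ => hn j x) (Finset.mem_univ i)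

end limit

variable {N m : ℕ} {β : Fin m → Fin m → ℝ} {u : Fin m → Eu N → ℝ → ℝ}

/-- The parabolic rescaling of `u` by the factor `r` around `(x₀, t₀)`. -/
def rescale (r : ℝ) (x₀ : Eu N) (t₀ : ℝ) (u : Fin m → Eu N → ℝ → ℝ) (i : Fin m) (x : Eu N) (t : ℝ) :
    ℝ :=
  r * u i (x₀ + r • x) (t₀ + r ^ 2 * t)

theorem cubic_const_mul (r : ℝ) (a : Fin m → ℝ) (i : Fin m) :
    cubic β (fun j => r * a j) i = r ^ 3 * cubic β a i := by
  unfold cubic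
  rw [Finset.mul_sum]
  exact Finset.sum_congr rfl fun j _ => by ring

theorem IsSol.isSol_rescale {S : Set ℝ} (h : IsSol β u S) {r : ℝ} (hr : 0 ≤ r) (x₀ : Eu N)
    (t₀ : ℝ) :
    IsSol β (rescale r x₀ t₀ u) {t | t₀ + r ^ 2 * t ∈ S} := by
  have haff : ∀ t : ℝ, HasDerivAt (fun t : ℝ => t₀ + r ^ 2 * t) (r ^ 2) t := fun t =>
    (((hasDerivAt_id t).const_mul (r ^ 2)).const_add t₀).congr_deriv (by ring)
  have hd : ∀ i x t, t₀ + r ^ 2 * t ∈ S → HasDerivAt (rescale r x₀ t₀ u i x)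
      (r * (deriv (u i (x₀ + r • x)) (t₀ + r ^ 2 * t) * r ^ 2)) t := fun i x t ht =>
    ((h.dt i (x₀ + r • x) _ ht).hasDerivAt.comp t (haff t)).const_mul r
  have hx : ∀ i, ∀ t, t₀ + r ^ 2 * t ∈ S → ContDiff ℝ 2 fun x : Eu N =>
      u i (x₀ + r • x) (t₀ + r ^ 2 * t) := fun i t ht =>
    (h.c2 i _ ht).comp (by fun_prop)
  refine ⟨fun i t ht => contDiff_const.mul (hx i t ht), fun i x t ht =>
      (hd i x t ht).differentiableAt,
    fun i x t ht => mul_nonneg hr (h.nonneg i _ _ ht), fun i x t ht => ?_⟩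
  have e := lap_comp_affine x₀ r (h.c2 i _ ht) (x := x)
  unfold rescale at hd ⊢
  rw [(hd i x t ht).deriv, lap_const_mul _ (hx i t ht), cubic_const_mul, e, h.eq i _ _ ht]
  ring

theorem le_add_pow_six {η s : ℝ} (hη : 0 < η) (hs : 0 ≤ s) : s ≤ η + (η ^ 5)⁻¹ * s ^ 6 := by
  rcases le_total s η with h | h
  · have : 0 ≤ (η ^ 5)⁻¹ * s ^ 6 := by positivity
    linarith
  · have : s * η ^ 5 ≤ s ^ 6 := by
      calc s * η ^ 5 ≤ s * s ^ 5 := by gcongr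
        _ = s ^ 6 := by ring
    have h2 : s ≤ (η ^ 5)⁻¹ * s ^ 6 := by
      rw [inv_mul_eq_div, le_div_iff₀ (by positivity)]; exact this
    linarith

theorem IsSol.continuousOn_setIntegral {S : Set ℝ} (h : IsSol β u S) {y : Eu N} {ρ M : ℝ}
    (hM : ∀ i, ∀ x ∈ closedBall y ρ, ∀ t ∈ S, u i x t ≤ M) (i : Fin m) (k : ℕ) :
    ContinuousOn (fun t => ∫ z in closedBall y ρ, u i z t ^ k) S :=
  AncientCubic.continuousOn_setIntegral (w := fun x t => u i x t ^ k) (M := M ^ k)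
    (fun t ht => (h.continuous ht i).pow k)
    (fun x t ht => ((h.continuousAt ht i x).pow k).continuousWithinAt) fun x hx t ht => by
      rw [abs_of_nonneg (pow_nonneg (h.nonneg i x t ht) k)]
      exact pow_le_pow_left₀ (h.nonneg i x t ht) (hM i x hx t ht) k

theorem exists_concentration (hN : 0 < N) (hβ : ∀ i j, 0 ≤ β i j) :
    ∃ κ > 0, ∃ c > 0, ∀ u : Fin m → Eu N → ℝ → ℝ, IsSol β u (Ioo (-1) 1) →
      (∀ i, ∀ x ∈ ball 0 1, ∀ t ∈ Ioo (-1 : ℝ) 1, u i x t ≤ 4 * κ) → ∀ i, u i 0 0 = κ →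
      c ≤ ∫ t in (-(1 / 2) : ℝ)..0, ∫ x in closedBall 0 (1 / 2), u i x t ^ 6 := by
  obtain ⟨Γ, hΓ, hub⟩ := exists_upper_bound hN (ρ := 1 / 2) (by norm_num)
  set B := ∑ k, ∑ j, β k j with hB
  have hB0 : 0 ≤ B := Finset.sum_nonneg fun k _ => Finset.sum_nonneg fun j _ => hβ k j
  obtain ⟨κ, hκ, hκB⟩ : ∃ κ > 0, 64 * B * κ ^ 2 ≤ 1 := by
    refine ⟨1 / (8 * (B + 1)), by positivity, ?_⟩
    rw [div_pow, mul_div_assoc', div_le_one (by positivity)]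
    nlinarith
  set V := (volume : Measure (Eu N)).real (closedBall 0 (1 / 2)) with hV
  have hV0 : 0 ≤ V := measureReal_nonneg
  set η := κ / (20 * Γ * (V + 1)) with hη
  have hΓ0 : 0 < Γ := by linarith
  have hη0 : 0 < η := by positivity
  refine ⟨κ, hκ, η ^ 5 * (κ / (20 * Γ)), by positivity, fun u h hM i hi => ?_⟩
  have hcb : closedBall (0 : Eu N) (1 / 2) ⊆ ball 0 1 := closedBall_subset_ball (by norm_num)
  have hS : Icc (-(1 / 2) : ℝ) 0 ⊆ Ioo (-1) 1 := fun t ht =>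
      ⟨by linarith [ht.1], by linarith [ht.2]⟩
  have hJc : ∀ k, ContinuousOn (fun t => ∫ z in closedBall (0 : Eu N) (1 / 2), u i z t ^ k)
      (Icc (-(1 / 2)) 0) := fun k =>
    ((h.mono hS).continuousOn_setIntegral (fun i x hx t ht => hM i x (hcb hx) t (hS ht)) i k)
  set J := fun t => ∫ z in closedBall (0 : Eu N) (1 / 2), u i z t with hJ
  have hJ1 : ContinuousOn J (Icc (-(1 / 2)) 0) := by simpa only [pow_one] using hJc 1
  have hint : ∀ {f : ℝ → ℝ}, ContinuousOn f (Icc (-(1 / 2)) 0) → ∀ a ∈ Icc (-(1 / 2) : ℝ) 0,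
      ∀ b ∈ Icc (-(1 / 2) : ℝ) 0, IntervalIntegrable f volume a b := fun hf a ha b hb =>
    (hf.mono (uIcc_subset_Icc ha hb)).intervalIntegrable
  have hJ0 : ∀ t ∈ Icc (-(1 / 2) : ℝ) 0, 0 ≤ J t := fun t ht =>
    setIntegral_nonneg measurableSet_closedBall fun z _ => h.nonneg i z t (hS ht)
  have m0 : (0 : ℝ) ∈ Icc (-(1 / 2) : ℝ) 0 := by norm_num
  have m1 : (-(1 / 2) : ℝ) ∈ Icc (-(1 / 2) : ℝ) 0 := by norm_num
  have m2 : (-(1 / 4) : ℝ) ∈ Icc (-(1 / 2) : ℝ) 0 := by norm_num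
  set I := ∫ t in (-(1 / 2) : ℝ)..0, J t with hI
  have hIle : ∀ a b, -(1 / 2) ≤ a → a ≤ b → b ≤ 0 → ∫ t in a..b, J t ≤ I := fun a b h1 h2 h3 => by
    refine intervalIntegral.integral_mono_interval h1 h2 h3 ?_ (hint hJ1 _ m1 _ m0)
    exact (ae_restrict_iff' measurableSet_Ioc).2 (Eventually.of_forall fun t ht =>
      hJ0 t ⟨ht.1.le, ht.2⟩)
  have hslice : ∀ t ∈ Icc (-(1 / 2) : ℝ) (-(1 / 4)), κ / 2 - Γ * I ≤ Γ * J t := fun t ht => by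
    have hS' : Icc t 0 ⊆ Icc (-(1 / 2) : ℝ) 0 := Icc_subset_Icc_left ht.1
    have hsup : SuperOn (fun x t => -u i x t) (fun _ _ => -(B * (4 * κ) ^ 3)) 0 1 (Icc t 0) := by
      have h1 := (h.mono (hS'.trans hS)).superOn_neg i 0 1
      refine ⟨h1.c2, h1.dt, fun x hx s hs => le_trans ?_ (h1.ineq x hx s hs)⟩
      have := (abs_le.1 (h.abs_source_le hβ hM i x hx s (hS (hS' hs)))).2
      linarith
    have := hub (u i) 0 1 (B * (4 * κ) ^ 3) (4 * κ) t 0 hsup (by linarith [ht.2])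
      (fun x hx s hs => ⟨h.nonneg i x s (hS (hS' hs)), hM i x hx s (hS (hS' hs))⟩)
      (fun x hx s hs => (h.rlsc hN hβ hM i x hx s (hS (hS' (Ico_subset_Icc_self hs)))).2)
      (by norm_num) (by positivity)
    have h2 := mul_le_mul_of_nonneg_left (hIle t 0 ht.1 (by linarith [ht.2]) le_rfl) hΓ0.le
    have h3 : B * (4 * κ) ^ 3 * (0 - t) ≤ κ / 2 := by
      have : B * (4 * κ) ^ 3 * (0 - t) ≤ B * (4 * κ) ^ 3 * (1 / 2) := by
        gcongr; linarith [ht.1]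
      nlinarith
    rw [hi] at this
    change κ ≤ Γ * J t + Γ * (∫ s in t..0, J s) + _ at this
    linarith
  have hIlow : κ / (10 * Γ) ≤ I := by
    have := intervalIntegral.integral_mono_on (a := -(1 / 2)) (b := -(1 / 4)) (by norm_num)
      intervalIntegrable_const ((hint hJ1 _ m1 _ m2).const_mul Γ) hslice
    rw [intervalIntegral.integral_const, intervalIntegral.integral_const_mul, smul_eq_mul] at this
    have h2 := mul_le_mul_of_nonneg_left (hIle (-(1 / 2)) (-(1 / 4)) le_rfl (by norm_num)
        (by norm_num)) hΓ0.le
    rw [div_le_iff₀ (by positivity)]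
    linarith
  have hIup : I ≤ η * V / 2 + (η ^ 5)⁻¹ *
      ∫ t in (-(1 / 2) : ℝ)..0, ∫ x in closedBall 0 (1 / 2), u i x t ^ 6 := by
    have h1 : ∀ t ∈ Icc (-(1 / 2) : ℝ) 0, J t ≤ η * V + (η ^ 5)⁻¹ *
        ∫ x in closedBall 0 (1 / 2), u i x t ^ 6 := fun t ht => by
      have hc := h.continuous (hS ht) i
      have hi6 : IntegrableOn (fun x => u i x t ^ 6) (closedBall 0 (1 / 2)) :=
        (hc.pow 6).continuousOn.integrableOn_compact (isCompact_closedBall _ _)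
      have hic : IntegrableOn (fun _ : Eu N => η) (closedBall 0 (1 / 2)) :=
        continuousOn_const.integrableOn_compact (isCompact_closedBall _ _)
      have := setIntegral_mono_on (hc.continuousOn.integrableOn_compact
          (isCompact_closedBall 0 (1 / 2)))
        (hic.add (hi6.const_mul (η ^ 5)⁻¹)) measurableSet_closedBall
        fun x _ => le_add_pow_six hη0 (h.nonneg i x t (hS ht))
      refine this.trans (le_of_eq ?_)
      change ∫ x in closedBall 0 (1 / 2), (η + (η ^ 5)⁻¹ * u i x t ^ 6) = _
      rw [integral_add hic (hi6.const_mul _), integral_const_mul, setIntegral_const, smul_eq_mul,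
          mul_comm η]
    have := intervalIntegral.integral_mono_on (by norm_num) (hint hJ1 _ m1 _ m0)
      (intervalIntegrable_const.add ((hint (hJc 6) _ m1 _ m0).const_mul _)) h1
    refine this.trans (le_of_eq ?_)
    rw [intervalIntegral.integral_add intervalIntegrable_const
        ((hint (hJc 6) _ m1 _ m0).const_mul _),
      intervalIntegral.integral_const, intervalIntegral.integral_const_mul, smul_eq_mul]
    ring
  have hηV : η * V / 2 ≤ κ / (20 * Γ) := by
    have : η * V ≤ η * (V + 1) := by gcongr; linarith
    have e : η * (V + 1) = κ / (20 * Γ) := by rw [hη]; field_simp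
    have : 0 ≤ η * V := by positivity
    linarith
  have e : κ / (10 * Γ) = 2 * (κ / (20 * Γ)) := by field_simp; norm_num
  have : κ / (20 * Γ) ≤ (η ^ 5)⁻¹ * ∫ t in (-(1 / 2) : ℝ)..0, ∫ x in closedBall 0 (1 / 2),
      u i x t ^ 6 := by
    linarith
  rwa [inv_mul_eq_div, le_div_iff₀' (by positivity)] at this

theorem setIntegral_comp_affine_le {f : Eu N → ℝ} (hf : Continuous f) {K : Set (Eu N)}
    (hK : IsCompact K) (hf0 : ∀ x ∈ K, 0 ≤ f x) {r : ℝ} (hr : 0 < r) {x₀ : Eu N}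
    (hmaps : ∀ x ∈ K, x₀ + r • x ∈ K) :
    ∫ x in K, f (x₀ + r • x) ≤ (r ^ N)⁻¹ * ∫ x in K, f x := by
  have hm := hK.measurableSet
  have hi : Integrable (K.indicator f) :=
    (integrable_indicator_iff hm).2 (hf.continuousOn.integrableOn_compact hK)
  have hi' : Integrable fun x => K.indicator f (x₀ + r • x) :=
    (hi.comp_add_left x₀).comp_smul hr.ne'
  have hg : Continuous fun x => f (x₀ + r • x) := hf.comp (by fun_prop)
  calc ∫ x in K, f (x₀ + r • x) = ∫ x, K.indicator (fun x => f (x₀ + r • x)) x :=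
        (integral_indicator hm).symm
    _ ≤ ∫ x, K.indicator f (x₀ + r • x) := by
        refine integral_mono ((integrable_indicator_iff hm).2
          (hg.continuousOn.integrableOn_compact hK)) hi' fun x => ?_
        by_cases hx : x ∈ K
        · simp [hx, hmaps x hx]
        · simp only [hx, not_false_eq_true, indicator_of_notMem]
          exact indicator_nonneg hf0 _
    _ = (r ^ N)⁻¹ * ∫ x in K, f x := by
        rw [Measure.integral_comp_smul volume (fun x => K.indicator f (x₀ + x)),
          integral_add_left_eq_self (fun x => K.indicator f x), integral_indicator hm, smul_eq_mul,
          finrank_euclideanSpace_fin, abs_of_pos (by positivity)]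

theorem IsSol.rescale_sixth_le (h : IsSol β u (Ioo (-1) 1)) (hN3 : N ≤ 3) {M : ℝ}
    (hM : ∀ i, ∀ x ∈ ball 0 1, ∀ t ∈ Ioo (-1 : ℝ) 1, u i x t ≤ M) {r : ℝ} (hr : 0 < r) (hr1 : r ≤ 1)
    {x₀ : Eu N} {t₀ : ℝ} (hx : ∀ x ∈ closedBall (0 : Eu N) (1 / 2),
        x₀ + r • x ∈ closedBall (0 : Eu N) (1 / 2))
    (ht₀ : -(1 / 4) ≤ t₀ - r ^ 2 / 2) (ht₁ : t₀ ≤ 1 / 4) (i : Fin m) :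
    ∫ t in (-(1 / 2) : ℝ)..0, ∫ x in closedBall 0 (1 / 2), rescale r x₀ t₀ u i x t ^ 6 ≤
      r * ∫ t in (-(1 / 4) : ℝ)..(1 / 4), ∫ x in closedBall 0 (1 / 2), u i x t ^ 6 := by
  have hcb : closedBall (0 : Eu N) (1 / 2) ⊆ ball 0 1 := closedBall_subset_ball (by norm_num)
  have hS : Icc (-(1 / 4) : ℝ) (1 / 4) ⊆ Ioo (-1) 1 := fun t ht =>
    ⟨by linarith [ht.1], by linarith [ht.2]⟩
  have hr2 : 0 < r ^ 2 := by positivity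
  set H := fun t => ∫ x in closedBall (0 : Eu N) (1 / 2), u i x t ^ 6 with hH
  have hHc : ContinuousOn H (Icc (-(1 / 4)) (1 / 4)) :=
    (h.mono hS).continuousOn_setIntegral (fun i x hx t ht => hM i x (hcb hx) t (hS ht)) i 6
  have hH0 : ∀ t, 0 ≤ H t := fun t => setIntegral_nonneg measurableSet_closedBall fun x _ => by
      positivity
  have hmem : ∀ t ∈ Icc (-(1 / 2) : ℝ) 0, t₀ + r ^ 2 * t ∈ Icc (-(1 / 4) : ℝ) (1 / 4) :=
    fun t ht => ⟨by nlinarith [ht.1, ht.2], by nlinarith [ht.1, ht.2]⟩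
  have hHr : ContinuousOn (fun t => H (t₀ + r ^ 2 * t)) (Icc (-(1 / 2)) 0) :=
    hHc.comp (by fun_prop) hmem
  have hL : IntervalIntegrable (fun t => ∫ x in closedBall (0 : Eu N) (1 / 2),
      rescale r x₀ t₀ u i x t ^ 6)
      volume (-(1 / 2)) 0 := by
    refine ContinuousOn.intervalIntegrable_of_Icc (by norm_num) ?_
    refine ((h.isSol_rescale hr.le x₀ t₀).mono
        (fun t ht => hS (hmem t ht))).continuousOn_setIntegral
      (M := r * M) (fun i x hx' t ht => ?_) i 6
    exact mul_le_mul_of_nonneg_left (hM i _ (hcb (hx x hx')) _ (hS (hmem t ht))) hr.le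
  have hslice : ∀ t ∈ Icc (-(1 / 2) : ℝ) 0,
      ∫ x in closedBall (0 : Eu N) (1 / 2), rescale r x₀ t₀ u i x t ^ 6 ≤
        r ^ 3 * H (t₀ + r ^ 2 * t) := fun t ht => by
    have h1 := setIntegral_comp_affine_le (f := fun x => u i x (t₀ + r ^ 2 * t) ^ 6)
      ((h.continuous (hS (hmem t ht)) i).pow 6) (isCompact_closedBall 0 (1 / 2))
      (fun x _ => by positivity) hr hx
    have h2 : ∫ x in closedBall (0 : Eu N) (1 / 2), rescale r x₀ t₀ u i x t ^ 6 =
        r ^ 6 * ∫ x in closedBall (0 : Eu N) (1 / 2), u i (x₀ + r • x) (t₀ + r ^ 2 * t) ^ 6 := by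
      rw [← integral_const_mul]
      refine integral_congr_ae (Eventually.of_forall fun x => ?_)
      simp only [rescale, mul_pow]
    have h3 : r ^ 6 * (r ^ N)⁻¹ ≤ r ^ 3 := by
      rw [← div_eq_mul_inv, div_le_iff₀ (by positivity)]
      calc r ^ 6 = r ^ 3 * r ^ 3 := by ring
        _ ≤ r ^ 3 * r ^ N := by
          gcongr r ^ 3 * ?_
          exact pow_le_pow_of_le_one hr.le hr1 hN3
    rw [h2]
    calc _ ≤ r ^ 6 * ((r ^ N)⁻¹ * H (t₀ + r ^ 2 * t)) := by gcongr
      _ = r ^ 6 * (r ^ N)⁻¹ * H (t₀ + r ^ 2 * t) := by ring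
      _ ≤ _ := by gcongr
  calc _ ≤ ∫ t in (-(1 / 2) : ℝ)..0, r ^ 3 * H (t₀ + r ^ 2 * t) :=
        intervalIntegral.integral_mono_on (by norm_num) hL
          ((hHr.intervalIntegrable_of_Icc (by norm_num)).const_mul _) hslice
    _ = r * ∫ t in (t₀ + r ^ 2 * -(1 / 2))..(t₀ + r ^ 2 * 0), H t := by
        rw [intervalIntegral.integral_const_mul, intervalIntegral.integral_comp_add_mul _ hr2.ne',
          smul_eq_mul]
        field_simp
    _ ≤ _ := by
        gcongr
        refine intervalIntegral.integral_mono_interval (by linarith) (by nlinarith) (by linarith)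
          (Eventually.of_forall hH0) (hHc.intervalIntegrable_of_Icc (by norm_num))

theorem exists_bounded_at_center (hN : 0 < N) (hN3 : N ≤ 3) (hβ : ∀ i j, 0 ≤ β i j)
    (hsym : ∀ i j, β i j = β j i) (hdiag : ∀ i, 0 < β i i) :
    ∃ C : ℝ, 0 < C ∧ ∀ (u : Fin m → Eu N → ℝ → ℝ) (M : ℝ), IsSol β u (Ioo (-1) 1) →
      (∀ i, ∀ x ∈ ball 0 1, ∀ t ∈ Ioo (-1 : ℝ) 1, u i x t ≤ M) → ∀ i, u i 0 0 ≤ C := by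
  obtain ⟨C, hC⟩ := exists_sixth_bound (N := N) hN hN3 hβ hsym hdiag
  obtain ⟨κ, hκ, c, hc, hcon⟩ := exists_concentration (N := N) hN hβ
  refine ⟨8 * κ + 4 * κ * (|C| + 1) / c, by positivity, fun u M h hM i₀ => ?_⟩
  have hK : 0 ≤ 4 * κ * (|C| + 1) / c := by positivity
  rcases (h.nonneg i₀ 0 0 (by norm_num)).eq_or_lt with h0 | h0
  · rw [← h0]; positivity
  have hM0 : 0 ≤ M := h0.le.trans (hM i₀ 0 (mem_ball_self one_pos) 0 (by norm_num))
  set d : Eu N → ℝ → ℝ := fun x t => 1 / 2 - max ‖x‖ (√|t|) with hd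
  set A : Set ℝ := {a | ∃ i x t, 0 ≤ d x t ∧ a = d x t * u i x t} with hA
  have hd' : ∀ {x t}, 0 ≤ d x t → ‖x‖ ≤ 1 / 2 ∧ |t| ≤ 1 / 4 := fun {x t} h0 => by
    have h1 := (le_max_left ‖x‖ (√|t|)).trans (sub_nonneg.1 h0)
    have h2 := (le_max_right ‖x‖ (√|t|)).trans (sub_nonneg.1 h0)
    rw [Real.sqrt_le_left (by norm_num)] at h2
    exact ⟨h1, h2.trans (by norm_num)⟩
  have hdle : ∀ x t, d x t ≤ 1 / 2 := fun x t => by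
    have := (norm_nonneg x).trans (le_max_left ‖x‖ (√|t|))
    simp only [hd]; linarith
  have hin : ∀ {x : Eu N} {t : ℝ}, ‖x‖ ≤ 1 / 2 → |t| ≤ 1 / 4 → x ∈ ball (0 : Eu N) 1 ∧
      t ∈ Ioo (-1 : ℝ) 1 :=
    fun {x t} hx ht => by
      have := abs_le.1 ht
      exact ⟨mem_ball_zero_iff.2 (by linarith), by linarith, by linarith⟩
  have hAb : BddAbove A := ⟨1 / 2 * M, by
    rintro _ ⟨i, x, t, h0, rfl⟩
    obtain ⟨hx, ht⟩ := hin (hd' h0).1 (hd' h0).2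
    exact mul_le_mul (hdle x t) (hM i x hx t ht) (h.nonneg i x t ht) (by norm_num)⟩
  have hd00 : d 0 0 = 1 / 2 := by simp [hd]
  have hmem : d 0 0 * u i₀ 0 0 ∈ A := ⟨i₀, 0, 0, by rw [hd00]; norm_num, rfl⟩
  have hle := le_csSup hAb hmem
  rw [hd00] at hle
  have hpos : 0 < sSup A := by linarith
  obtain ⟨_, ⟨i, x₀, t₀, hd0, rfl⟩, hlt⟩ := exists_lt_of_lt_csSup ⟨_, hmem⟩ (half_lt_self hpos)
  suffices hs : d x₀ t₀ * u i x₀ t₀ ≤ 2 * κ ∨ d x₀ t₀ * u i x₀ t₀ ≤ κ * (|C| + 1) / c by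
    have hK' : 4 * κ * (|C| + 1) / c = 4 * (κ * (|C| + 1) / c) := by ring
    rcases hs with hs | hs <;> linarith
  set l := u i x₀ t₀ with hl
  have hl0 : 0 < l := by
    by_contra hcon
    have := mul_nonpos_of_nonneg_of_nonpos hd0 (not_lt.1 hcon)
    linarith
  by_cases hsm : d x₀ t₀ * l ≤ 2 * κ
  · exact Or.inl hsm
  refine Or.inr ?_
  set r := κ / l with hr
  have hr0 : 0 < r := by positivity
  have hrl : r * l = κ := by rw [hr]; field_simp
  have hrd : r ≤ d x₀ t₀ / 2 := by
    rw [hr, div_le_iff₀ hl0]; linarith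
  have hdr : ∀ (x : Eu N) (t : ℝ), ‖x‖ ≤ 1 → |t| ≤ 1 → d x₀ t₀ / 2 ≤
      d (x₀ + r • x) (t₀ + r ^ 2 * t) := by
    intro x t hx ht
    have h1 : ‖x₀ + r • x‖ ≤ ‖x₀‖ + r := by
      refine (norm_add_le _ _).trans ?_
      rw [norm_smul, Real.norm_eq_abs, abs_of_pos hr0]
      gcongr; nlinarith
    have h2 : √|t₀ + r ^ 2 * t| ≤ √|t₀| + r := by
      refine Real.sqrt_le_iff.2 ⟨by positivity, ?_⟩
      have := abs_add_le t₀ (r ^ 2 * t)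
      rw [abs_mul, abs_of_pos (by positivity : 0 < r ^ 2)] at this
      have hs := Real.sq_sqrt (abs_nonneg t₀)
      have : r ^ 2 * |t| ≤ r ^ 2 := by nlinarith [sq_nonneg r]
      nlinarith [mul_nonneg (Real.sqrt_nonneg |t₀|) hr0.le]
    have h3 : max ‖x₀ + r • x‖ (√|t₀ + r ^ 2 * t|) ≤ max ‖x₀‖ (√|t₀|) + r :=
      max_le (h1.trans (by gcongr; exact le_max_left _ _))
          (h2.trans (by gcongr; exact le_max_right _ _))
    simp only [hd] at hrd ⊢
    linarith
  have hrin : ∀ (x : Eu N) (t : ℝ), ‖x‖ ≤ 1 → |t| ≤ 1 →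
      ‖x₀ + r • x‖ ≤ 1 / 2 ∧ |t₀ + r ^ 2 * t| ≤ 1 / 4 := fun x t hx ht =>
    hd' ((half_pos (by linarith)).le.trans (hdr x t hx ht))
  have hsol : IsSol β (rescale r x₀ t₀ u) (Ioo (-1) 1) :=
    (h.isSol_rescale hr0.le x₀ t₀).mono fun t ht =>
      (hin (hrin 0 t (by simp) (abs_le.2 ⟨ht.1.le, ht.2.le⟩)).1
        (hrin 0 t (by simp) (abs_le.2 ⟨ht.1.le, ht.2.le⟩)).2).2
  have hbd : ∀ j, ∀ x ∈ ball 0 1, ∀ t ∈ Ioo (-1 : ℝ) 1, rescale r x₀ t₀ u j x t ≤ 4 * κ := by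
    intro j x hx t ht
    have hx' := (mem_ball_zero_iff.1 hx).le
    have ht' := abs_le.2 ⟨ht.1.le, ht.2.le⟩
    have h1 := hdr x t hx' ht'
    have h2 := le_csSup hAb (show _ ∈ A from ⟨j, x₀ + r • x, t₀ + r ^ 2 * t, by linarith, rfl⟩)
    have h3 := hin (hrin x t hx' ht').1 (hrin x t hx' ht').2
    have h4 : d x₀ t₀ / 2 * u j (x₀ + r • x) (t₀ + r ^ 2 * t) ≤ sSup A :=
      (mul_le_mul_of_nonneg_right h1 (h.nonneg j _ _ h3.2)).trans h2
    have h5 : u j (x₀ + r • x) (t₀ + r ^ 2 * t) ≤ 4 * l := by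
      have hd1 : 0 < d x₀ t₀ := by linarith
      by_contra! hlt'
      nlinarith
    unfold rescale
    nlinarith
  have h1 := hcon _ hsol hbd i (by simp [rescale, ← hl, hrl])
  have hr1 : r ≤ 1 := by linarith [hdle x₀ t₀]
  have ht₀ := abs_le.1 (hd' hd0).2
  have h2 := h.rescale_sixth_le hN3 hM hr0 hr1 (x₀ := x₀) (t₀ := t₀)
    (fun x hx => mem_closedBall_zero_iff.2
      (hrin x 0 ((mem_closedBall_zero_iff.1 hx).trans (by norm_num)) (by simp)).1)
    (by
      have := (abs_le.1 (hrin 0 (-(1 / 2)) (by simp) (by norm_num [abs_le])).2).1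
      linarith) ht₀.2 i
  have h3 : c ≤ r * (|C| + 1) :=
    h1.trans (h2.trans (by gcongr; linarith [hC u M h hM0 hM i, le_abs_self C]))
  have h4 : l ≤ κ * (|C| + 1) / c := by
    rw [le_div_iff₀ hc]
    calc l * c ≤ l * (r * (|C| + 1)) := by gcongr
      _ = r * l * (|C| + 1) := by ring
      _ = _ := by rw [hrl]
  have := hdle x₀ t₀
  nlinarith

theorem exists_heat_small (hN : 0 < N) {κ : ℝ} (hκ : 0 < κ) :
    ∃ R : ℝ, 1 ≤ R ∧ ∀ τ > 0, ∀ z : Eu N, R ≤ ‖z‖ → heat τ z ≤ κ := by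
  obtain ⟨C, hC, hb⟩ := exists_heat_bound N (ρ := 1) one_pos
  refine ⟨max 1 (C / κ), le_max_left _ _, fun τ hτ z hz => ?_⟩
  set R := max 1 (C / κ) with hR
  have hR1 : 1 ≤ R := le_max_left _ _
  have hR0 : 0 < R := by linarith
  have h1 : heat τ z = R⁻¹ ^ N * heat (τ / R ^ 2) (R⁻¹ • z) := by
    rw [heat_eq_scale hτ, heat_eq_scale (τ := τ / R ^ 2) (by positivity), Real.sqrt_div hτ.le,
      Real.sqrt_sq hR0.le, smul_smul, ← mul_assoc, ← mul_pow]
    have e : R⁻¹ * (√τ / R)⁻¹ = (√τ)⁻¹ := by field_simp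
    have e' : (√τ / R)⁻¹ * R⁻¹ = (√τ)⁻¹ := by field_simp
    rw [e, e']
  have hτ' : 0 < τ / R ^ 2 := by positivity
  have h2 : heat (τ / R ^ 2) (R⁻¹ • z) ≤ C := by
    have := hb (τ / R ^ 2) hτ' (R⁻¹ • z) (by
      rw [norm_smul, norm_inv, Real.norm_eq_abs, abs_of_pos hR0, inv_mul_eq_div, le_div_iff₀ hR0]
      linarith)
    have h3 : 0 ≤ heat (τ / R ^ 2) (R⁻¹ • z) * (1 / (τ / R ^ 2)) :=
      mul_nonneg (heat_pos hτ').le (by positivity)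
    linarith
  have h3 : R⁻¹ ^ N ≤ R⁻¹ := pow_le_of_le_one (by positivity) (inv_le_one_of_one_le₀ hR1) hN.ne'
  calc heat τ z ≤ R⁻¹ * C := by
        rw [h1]; exact mul_le_mul h3 h2 (heat_pos hτ').le (by positivity)
    _ ≤ κ := by
        rw [inv_mul_eq_div, div_le_iff₀ hR0, ← div_le_iff₀' hκ]; exact le_max_right _ _

theorem exists_le_heat (N : ℕ) : ∃ c : ℝ, 0 < c ∧ ∀ τ ∈ Icc (1 : ℝ) 9, ∀ z : Eu N, ‖z‖ ≤ 5 →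
    c ≤ heat τ z := by
  refine ⟨(4 * π * 9) ^ (-(N : ℝ) / 2) * rexp (-(25 / 4)), by positivity, fun τ hτ z hz => ?_⟩
  have hτ0 : 0 < τ := by linarith [hτ.1]
  unfold heat
  refine mul_le_mul ?_ (Real.exp_le_exp.2 ?_) (by positivity) (by positivity)
  · refine Real.rpow_le_rpow_of_nonpos (by positivity) (by gcongr; exact hτ.2) ?_
    have : (0 : ℝ) ≤ N := Nat.cast_nonneg N
    linarith
  · have h1 : 1 / (4 * τ) ≤ 1 / 4 := one_div_le_one_div_of_le (by norm_num) (by linarith [hτ.1])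
    have h2 : ‖z‖ ^ 2 ≤ 25 := by nlinarith [norm_nonneg z]
    have : 1 / (4 * τ) * ‖z‖ ^ 2 ≤ 1 / 4 * 25 := by gcongr
    linarith

theorem IsSol.superOn_one_sub_exp (hβ : ∀ i j, 0 ≤ β i j) {S : Set ℝ} (h : IsSol β u S) (i : Fin m)
    (x₀ : Eu N) (R : ℝ) :
    SuperOn (fun x t => 1 - rexp (-u i x t)) (fun _ _ => 0) x₀ R S := by
  have hΦ : ∀ s : ℝ, HasDerivAt (fun s => 1 - rexp (-s)) (rexp (-s)) s := fun s =>
    (((hasDerivAt_neg s).exp).const_sub 1).congr_deriv (by ring)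
  have hΦ' : ∀ s : ℝ, HasDerivAt (fun s => rexp (-s)) (-rexp (-s)) s := fun s =>
    ((hasDerivAt_neg s).exp).congr_deriv (by ring)
  have hΦc : ContDiff ℝ 2 fun s => 1 - rexp (-s) := by fun_prop
  have hd1 : deriv (fun s => 1 - rexp (-s)) = fun s => rexp (-s) := funext fun s => (hΦ s).deriv
  refine ⟨fun t ht => hΦc.comp (h.c2 i t ht),
    fun x t ht => ((hΦ _).comp t (h.dt i x t ht).hasDerivAt).differentiableAt, fun x _ t ht => ?_⟩
  have e : deriv (fun s => 1 - rexp (-u i x s)) t = rexp (-u i x t) * deriv (u i x) t :=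
    ((hΦ _).comp t (h.dt i x t ht).hasDerivAt).deriv
  have hs : 0 ≤ ∑ k, pd k (fun y => u i y t) x ^ 2 := Finset.sum_nonneg fun k _ => sq_nonneg _
  have hp := Real.exp_pos (-u i x t)
  rw [e, lap_comp (Φ := fun s => 1 - rexp (-s)) hΦc (h.c2 i t ht), hd1, (hΦ' _).deriv,
      h.eq i x t ht]
  have := mul_nonneg hp.le (cubic_nonneg hβ (fun j => h.nonneg j x t ht) i)
  have := mul_nonneg hp.le hs
  linarith

theorem mul_exp_neg_le_one_sub_exp {K s : ℝ} (h0 : 0 ≤ s) (hK : s ≤ K) :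
    rexp (-K) * s ≤ 1 - rexp (-s) := by
  have h1 : rexp (-K) ≤ rexp (-s) := Real.exp_le_exp.2 (by linarith)
  have h2 : rexp (-s) * (s + 1) ≤ 1 := by
    calc rexp (-s) * (s + 1) ≤ rexp (-s) * rexp s := by gcongr; exact Real.add_one_le_exp s
      _ = 1 := by rw [← Real.exp_add]; simp
  nlinarith

theorem exists_setIntegral_le (hN : 0 < N) (hβ : ∀ i j, 0 ≤ β i j) {K : ℝ} :
    ∃ L : ℝ, 0 < L ∧ ∀ u : Fin m → Eu N → ℝ → ℝ, IsSol β u (Ioo (-1) 9) →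
      ∀ t ∈ Icc (-(1 / 2) : ℝ) 0, ∀ i, (∀ x ∈ closedBall 0 (1 / 4), u i x t ≤ K) →
      ∀ y : Eu N, ‖y‖ ≤ 4 → ∫ x in closedBall 0 (1 / 4), u i x t ≤ L * u i y 8 := by
  obtain ⟨c, hc, hheat⟩ := exists_le_heat N
  obtain ⟨ρ, hρ, hsmall⟩ := exists_heat_small hN (κ := c / 4) (by positivity)
  refine ⟨2 * rexp K / c, by positivity, fun u h t ht i hK y hy => ?_⟩
  have hsup := h.superOn_one_sub_exp hβ i y (ρ + 1)
  have hb : ∀ x, ∀ s ∈ Ioo (-1 : ℝ) 9, 1 - rexp (-u i x s) ∈ Icc (0 : ℝ) 1 := fun x s hs => by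
    have h1 : rexp (-u i x s) ≤ 1 := Real.exp_le_one_iff.2 (by linarith [h.nonneg i x s hs])
    have h2 := Real.exp_pos (-u i x s)
    constructor <;> linarith
  have hS : Icc t 8 ⊆ Ioo (-1) 9 := fun s hs => ⟨by linarith [hs.1, ht.1], by linarith [hs.2]⟩
  have hr := rlsc_of_bounded (M := 1) hN hsup fun x _ s hs => by
    rw [abs_of_nonneg (hb x s hs).1]; exact (hb x s hs).2
  have key := lower_bound (w := fun x t => 1 - rexp (-u i x t)) (y := y) (t₁ := t) (t₂ := 8)
    (R := ρ + 1) (M := 1) (ρ := ρ) (κ := c / 4) hN (hsup.mono Subset.rfl hS) (by linarith [ht.2])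
    (fun x _ s hs => hb x s (hS hs))
    (fun x hx s hs => hr x hx s (hS (Ico_subset_Icc_self hs)))
    (by linarith) (by linarith) (by positivity) hsmall
  have htm : t ∈ Ioo (-1 : ℝ) 9 := ⟨by linarith [ht.1], by linarith [ht.2]⟩
  have hτ : 0 < 8 - t := by linarith [ht.2]
  have hcu := h.continuous htm i
  have hcw : Continuous fun z => (1 - rexp (-u i z t)) * ramp (c / 4) (heat (8 - t) (z - y)) :=
    (by fun_prop : Continuous fun z => 1 - rexp (-u i z t)).mul
      (contDiff_ramp.continuous.comp (contDiff_heat_sub (n := 0) (8 - t) y).continuous)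
  have hw0 : ∀ z, 0 ≤ (1 - rexp (-u i z t)) * ramp (c / 4) (heat (8 - t) (z - y)) := fun z =>
    mul_nonneg (hb z t htm).1 (ramp_nonneg (heat_pos hτ).le)
  have hint : Integrable fun z => (1 - rexp (-u i z t)) * ramp (c / 4) (heat (8 - t) (z - y)) := by
    refine integrable_of_support (x₀ := y) (r := ρ) hcw fun z hz => ?_
    rw [mem_closedBall, dist_eq_norm, not_le] at hz
    rw [ramp_eq_zero (by positivity) (hsmall _ hτ _ hz.le), mul_zero]
  have hpt : ∀ z ∈ closedBall (0 : Eu N) (1 / 4), rexp (-K) * (c / 2) * u i z t ≤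
      (1 - rexp (-u i z t)) * ramp (c / 4) (heat (8 - t) (z - y)) := fun z hz => by
    have hzy : ‖z - y‖ ≤ 5 := by
      have := norm_sub_le z y
      rw [mem_closedBall_zero_iff] at hz
      linarith
    have h1 := hheat (8 - t) ⟨by linarith [ht.2], by linarith [ht.1]⟩ (z - y) hzy
    have h2 := le_ramp (κ := c / 4) (by positivity) (heat_pos (z := z - y) hτ).le
    have h3 := mul_exp_neg_le_one_sub_exp (h.nonneg i z t htm) (hK z hz)
    calc _ = rexp (-K) * u i z t * (c / 2) := by ring
      _ ≤ _ := mul_le_mul h3 (by linarith) (by positivity) (hb z t htm).1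
  have h1 : rexp (-K) * (c / 2) * ∫ x in closedBall 0 (1 / 4), u i x t ≤ 1 - rexp (-u i y 8) := by
    rw [← integral_const_mul]
    refine le_trans (setIntegral_mono_on ?_ hint.integrableOn measurableSet_closedBall hpt)
      ((setIntegral_le_integral hint (Eventually.of_forall hw0)).trans key)
    exact (continuous_const.mul hcu).continuousOn.integrableOn_compact (isCompact_closedBall _ _)
  have h2 : 1 - rexp (-u i y 8) ≤ u i y 8 := by linarith [Real.add_one_le_exp (-u i y 8)]
  have h3 : (∫ x in closedBall 0 (1 / 4), u i x t) * (rexp (-K) * c / 2) ≤ u i y 8 := by linarith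
  have e : 2 * rexp K / c * u i y 8 = u i y 8 / (rexp (-K) * c / 2) := by
    rw [Real.exp_neg]; field_simp
  rw [e, le_div_iff₀ (by positivity)]
  exact h3

theorem exists_harnack (hN : 0 < N) (hN3 : N ≤ 3) (hβ : ∀ i j, 0 ≤ β i j)
    (hsym : ∀ i j, β i j = β j i) (hdiag : ∀ i, 0 < β i i) :
    ∃ C : ℝ, 0 < C ∧ ∀ (u : Fin m → Eu N → ℝ → ℝ) (M : ℝ), IsSol β u (Ioo (-1) 9) →
      (∀ i, ∀ x ∈ ball 0 1, ∀ t ∈ Ioo (-1 : ℝ) 1, u i x t ≤ M) →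
      ∀ i, ∀ y : Eu N, ‖y‖ ≤ 4 → u i 0 0 ≤ C * u i y 8 := by
  obtain ⟨C, hC, hU⟩ := exists_bounded_at_center (N := N) hN hN3 hβ hsym hdiag
  obtain ⟨L, hL, hlow⟩ := exists_setIntegral_le (N := N) (K := 2 * C) hN hβ
  obtain ⟨Γ, hΓ, hub⟩ := exists_upper_bound hN (ρ := 1 / 4) (by norm_num)
  set B := ∑ k, ∑ j, β k j with hB
  have hB0 : 0 ≤ B := Finset.sum_nonneg fun k _ => Finset.sum_nonneg fun j _ => hβ k j
  set a := B * (2 * C) ^ 2 with ha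
  have ha0 : 0 ≤ a := by positivity
  have hΓ0 : 0 < Γ := by linarith
  refine ⟨2 * Γ * rexp a * L, by positivity, fun u M h hM i y hy => ?_⟩
  have hK : ∀ j, ∀ x ∈ ball (0 : Eu N) (1 / 2), ∀ t ∈ Ioo (-(3 / 4) : ℝ) (3 / 4), u j x t ≤
      2 * C := by
    intro j x hx t ht
    have hsol : IsSol β (rescale (1 / 2) x t u) (Ioo (-1) 1) :=
      (h.isSol_rescale (by norm_num) x t).mono fun s hs =>
        ⟨by linarith [hs.1, ht.1], by linarith [hs.2, ht.2]⟩
    have := hU _ (1 / 2 * M) hsol (fun k z hz s hs => by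
      refine mul_le_mul_of_nonneg_left (hM k _ ?_ _ ?_) (by norm_num)
      · rw [mem_ball_zero_iff] at hx hz ⊢
        refine (norm_add_le _ _).trans_lt ?_
        rw [norm_smul, Real.norm_eq_abs, abs_of_pos (by norm_num)]
        linarith
      · exact ⟨by linarith [hs.1, ht.1], by linarith [hs.2, ht.2]⟩) j
    simp only [rescale, smul_zero, add_zero, mul_zero] at this
    linarith
  have hS : Ioo (-(3 / 4) : ℝ) (3 / 4) ⊆ Ioo (-1) 9 := fun s hs =>
    ⟨by linarith [hs.1], by linarith [hs.2]⟩
  have hI : Icc (-(1 / 2) : ℝ) 0 ⊆ Ioo (-(3 / 4)) (3 / 4) := fun s hs =>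
    ⟨by linarith [hs.1], by linarith [hs.2]⟩
  set v : Eu N → ℝ → ℝ := fun x t => rexp (-(a * t)) * u i x t with hv
  have hsub : SuperOn (fun x t => -v x t) (fun _ _ => 0) 0 (1 / 2) (Ioo (-(3 / 4)) (3 / 4)) := by
    have hd : ∀ x, ∀ t ∈ Ioo (-(3 / 4) : ℝ) (3 / 4), HasDerivAt (fun s => -v x s)
        (rexp (-(a * t)) * (a * u i x t - deriv (u i x) t)) t := fun x t ht => by
      have h1 : HasDerivAt (fun s => rexp (-(a * s))) (rexp (-(a * t)) * -(a * 1)) t :=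
        ((hasDerivAt_id t).const_mul a).neg.exp
      exact (h1.mul (h.dt i x t (hS ht)).hasDerivAt).neg.congr_deriv (by ring)
    refine ⟨fun t ht => (contDiff_const.mul (h.c2 i t (hS ht))).neg,
      fun x t ht => (hd x t ht).differentiableAt, fun x hx t ht => ?_⟩
    have hcub : cubic β (fun j => u j x t) i ≤ a * u i x t := by
      have h1 : ∀ j, β i j * u i x t * u j x t ^ 2 ≤ β i j * u i x t * (2 * C) ^ 2 := fun j => by
        refine mul_le_mul_of_nonneg_left
          (pow_le_pow_left₀ (h.nonneg j x t (hS ht)) (hK j x hx t ht) 2)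
          (mul_nonneg (hβ i j) (h.nonneg i x t (hS ht)))
      have h2 : ∑ j, β i j ≤ B :=
        Finset.single_le_sum (f := fun k => ∑ j, β k j)
          (fun k _ => Finset.sum_nonneg fun j _ => hβ k j) (Finset.mem_univ i)
      calc cubic β (fun j => u j x t) i ≤ ∑ j, β i j * u i x t * (2 * C) ^ 2 :=
            Finset.sum_le_sum fun j _ => h1 j
        _ = (∑ j, β i j) * (2 * C) ^ 2 * u i x t := by
            rw [Finset.sum_mul, Finset.sum_mul]
            exact Finset.sum_congr rfl fun j _ => by ring
        _ ≤ a * u i x t := mul_le_mul_of_nonneg_right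
            (mul_le_mul_of_nonneg_right h2 (sq_nonneg _)) (h.nonneg i x t (hS ht))
    rw [(hd x t ht).deriv, lap_neg (contDiff_const.mul (h.c2 i t (hS ht))),
      lap_const_mul _ (h.c2 i t (hS ht)), h.eq i x t (hS ht)]
    have := mul_le_mul_of_nonneg_left hcub (Real.exp_pos (-(a * t))).le
    linarith
  have hv0 : ∀ x, ∀ t ∈ Ioo (-(3 / 4) : ℝ) (3 / 4), 0 ≤ v x t := fun x t ht =>
    mul_nonneg (Real.exp_pos _).le (h.nonneg i x t (hS ht))
  have hea : ∀ t ∈ Ioo (-(3 / 4) : ℝ) (3 / 4), rexp (-(a * t)) ≤ rexp a := fun t ht =>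
    Real.exp_le_exp.2 (by nlinarith [ht.1])
  have hvM : ∀ x ∈ ball (0 : Eu N) (1 / 2), ∀ t ∈ Ioo (-(3 / 4) : ℝ) (3 / 4), v x t ≤
      rexp a * (2 * C) :=
    fun x hx t ht => mul_le_mul (hea t ht) (hK i x hx t ht) (h.nonneg i x t (hS ht))
        (Real.exp_pos a).le
  have hr := rlsc_of_bounded (M := rexp a * (2 * C)) hN hsub fun x hx t ht => by
    rw [abs_neg, abs_of_nonneg (hv0 x t ht)]; exact hvM x hx t ht
  have key := hub v 0 (1 / 2) 0 (rexp a * (2 * C)) (-(1 / 2)) 0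
    (by simpa only [neg_zero] using hsub.mono Subset.rfl hI) (by norm_num)
    (fun x hx t ht => ⟨hv0 x t (hI ht), hvM x hx t (hI ht)⟩)
    (fun x hx t ht => hr x hx t (hI (Ico_subset_Icc_self ht))) (by norm_num) le_rfl
  have hcb : closedBall (0 : Eu N) (1 / 4) ⊆ ball 0 (1 / 2) := closedBall_subset_ball (by norm_num)
  have hslice : ∀ t ∈ Icc (-(1 / 2) : ℝ) 0, ∫ z in closedBall 0 (1 / 4), v z t ≤
      rexp a * (L * u i y 8) :=
    fun t ht => by
      have h1 := hlow u h t ht i (fun x hx => hK i x (hcb hx) t (hI ht)) y hy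
      have h2 : ∫ z in closedBall 0 (1 / 4), v z t =
          rexp (-(a * t)) * ∫ z in closedBall 0 (1 / 4), u i z t := integral_const_mul _ _
      rw [h2]
      exact mul_le_mul (hea t (hI ht)) h1 (setIntegral_nonneg measurableSet_closedBall
        fun z _ => h.nonneg i z t (hS (hI ht))) (Real.exp_pos a).le
  have hJ : ContinuousOn (fun t => ∫ z in closedBall (0 : Eu N) (1 / 4), v z t)
      (Icc (-(1 / 2)) 0) :=
    continuousOn_setIntegral (M := rexp a * (2 * C))
      (fun t ht => continuous_const.mul (h.continuous (hS (hI ht)) i))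
      (fun x t ht => ((Continuous.continuousAt (by fun_prop)).mul
        (h.continuousAt (hS (hI ht)) i x)).continuousWithinAt)
      (fun x hx t ht => by rw [abs_of_nonneg (hv0 x t (hI ht))]; exact hvM x (hcb hx) t (hI ht))
  have hint := intervalIntegral.integral_mono_on (a := -(1 / 2)) (b := 0) (by norm_num)
    (hJ.intervalIntegrable_of_Icc (by norm_num)) (intervalIntegrable_const (μ := volume)) hslice
  rw [intervalIntegral.integral_const, smul_eq_mul] at hint
  have h0 := hslice (-(1 / 2)) (by norm_num)
  have hu8 : 0 ≤ rexp a * (L * u i y 8) :=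
    mul_nonneg (Real.exp_pos a).le (mul_nonneg hL.le (h.nonneg i y 8 (by norm_num)))
  have e0 : v 0 0 = u i 0 0 := by simp [hv]
  rw [e0] at key
  have k1 := mul_le_mul_of_nonneg_left h0 hΓ0.le
  have k2 := mul_le_mul_of_nonneg_left hint hΓ0.le
  have k3 := mul_nonneg hΓ0.le hu8
  linarith

/-- All components of `u` are bounded above near the space-time point `p`. -/
def BddNear (u : Fin m → Eu N → ℝ → ℝ) (p : Eu N × ℝ) : Prop :=
  ∃ K, ∀ᶠ q in 𝓝 p, ∀ i, u i q.1 q.2 ≤ K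

theorem BddNear.eventually {p : Eu N × ℝ} (h : BddNear u p) : ∀ᶠ q in 𝓝 p, BddNear u q := by
  obtain ⟨K, hK⟩ := h
  filter_upwards [eventually_eventually_nhds.2 hK] with q hq using ⟨K, hq⟩

theorem exists_bound_of_bddNear {K : Set (Eu N × ℝ)} (hK : IsCompact K) (h : ∀ p ∈ K, BddNear u p) :
    ∃ M, ∀ p ∈ K, ∀ i, u i p.1 p.2 ≤ M := by
  refine hK.induction_on (p := fun s => ∃ M, ∀ p ∈ s, ∀ i, u i p.1 p.2 ≤ M) ⟨0, by simp⟩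
    (fun s t hst ⟨M, hM⟩ => ⟨M, fun p hp => hM p (hst hp)⟩)
    (fun s t ⟨M, hM⟩ ⟨M', hM'⟩ => ⟨max M M', fun p hp i => ?_⟩) fun p hp => ?_
  · exact hp.elim (fun hp => (hM p hp i).trans (le_max_left _ _))
      fun hp => (hM' p hp i).trans (le_max_right _ _)
  · obtain ⟨M, hM⟩ := h p hp
    exact ⟨_, mem_nhdsWithin_of_mem_nhds hM, M, fun q hq => hq⟩

/-- Local boundedness turns into a bound for the rescaled solution on the unit cylinder. -/
theorem exists_bound_rescale {r : ℝ} (hr : 0 < r) {y : Eu N} {s : ℝ}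
    (h : ∀ x, dist x y ≤ r → ∀ t, |t - s| ≤ r ^ 2 → BddNear u (x, t)) :
    ∃ M, ∀ i, ∀ x ∈ ball 0 1, ∀ t ∈ Ioo (-1 : ℝ) 1, rescale r y s u i x t ≤ M := by
  obtain ⟨M, hM⟩ := exists_bound_of_bddNear (u := u)
    ((isCompact_closedBall y r).prod (isCompact_closedBall s (r ^ 2)))
    fun p hp => h p.1 hp.1 p.2 (by simpa [Real.dist_eq] using hp.2)
  refine ⟨r * M, fun i x hx t ht => mul_le_mul_of_nonneg_left (hM (_, _) ⟨?_, ?_⟩ i) hr.le⟩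
  · rw [mem_ball_zero_iff] at hx
    rw [mem_closedBall, dist_eq_norm, add_sub_cancel_left, norm_smul, Real.norm_eq_abs,
        abs_of_pos hr]
    nlinarith
  · rw [mem_closedBall, Real.dist_eq, add_sub_cancel_left, abs_mul, abs_of_pos (by positivity)]
    have := abs_lt.2 ht
    nlinarith [sq_nonneg r]

theorem IsSol.bddNear (hN : 0 < N) (hN3 : N ≤ 3) (hβ : ∀ i j, 0 ≤ β i j)
    (hsym : ∀ i j, β i j = β j i) (hdiag : ∀ i, 0 < β i i) {T : ℝ} (h : IsSol β u (Iio T)) :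
    ∀ p : Eu N × ℝ, p.2 < T → BddNear u p := by
  obtain ⟨C, hC, hH⟩ := exists_harnack (N := N) hN hN3 hβ hsym hdiag
  by_contra! hcon
  obtain ⟨p₁, hp₁, hbad⟩ := hcon
  set ρ := (T - p₁.2) / 2 with hρ
  have hρ0 : 0 < ρ := by rw [hρ]; linarith
  set B : Set (Eu N × ℝ) := {p | p ∈ ball p₁ ρ ∧ ¬ BddNear u p} with hB
  have hBT : ∀ p ∈ closure B, p.2 < T := fun p hp => by
    have h1 : p ∈ closedBall p₁ ρ :=
      closure_ball_subset_closedBall (closure_mono (fun p hp => hp.1) hp)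
    have h2 : dist p.2 p₁.2 ≤ ρ := (le_max_right _ _).trans h1
    rw [Real.dist_eq] at h2
    have := (abs_le.1 h2).2
    linarith
  set E : ℕ → Set (Eu N × ℝ) := fun n =>
    {p | ∀ s < T, |s - p.2| < 1 / ((n : ℝ) + 1) → ∀ i, u i p.1 s ≤ n} with hE
  obtain ⟨n, O, hO, ⟨p₀, hp₀O, hp₀B⟩, hOE⟩ : ∃ n, ∃ O : Set (Eu N × ℝ), IsOpen O ∧
      (O ∩ B).Nonempty ∧
      O ∩ closure B ⊆ E n := by
    refine exists_portion (B := B) ⟨p₁, mem_ball_self hρ0, hbad⟩ (fun n => ?_) fun p hp => ?_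
    · refine IsSeqClosed.isClosed fun q p hq hqp => ?_
      refine ⟨fun s hs hsp i => ?_, isClosed_closure.mem_of_tendsto hqp
        (Eventually.of_forall fun k => (hq k).2)⟩
      have h1 : Tendsto (fun k => u i (q k).1 s) atTop (𝓝 (u i p.1 s)) :=
        ((h.continuous hs i).tendsto p.1).comp ((continuous_fst.tendsto p).comp hqp)
      have h2 : Tendsto (fun k => |s - (q k).2|) atTop (𝓝 |s - p.2|) :=
        (tendsto_const_nhds.sub ((continuous_snd.tendsto p).comp hqp)).abs
      refine le_of_tendsto h1 ?_
      filter_upwards [h2.eventually (gt_mem_nhds hsp)] with k hk using (hq k).1 s hs hk i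
    · have hev : ∀ᶠ s in 𝓝 p.2, ∀ i, u i p.1 s ≤ u i p.1 p.2 + 1 :=
        eventually_all.2 fun i => ((h.continuousAt (hBT p hp) i p.1).eventually
          (gt_mem_nhds (lt_add_one _))).mono fun s hs => hs.le
      obtain ⟨δ, hδ, hδu⟩ := Metric.eventually_nhds_iff.1 hev
      obtain ⟨n₁, hn₁⟩ := exists_nat_one_div_lt hδ
      obtain ⟨n₂, hn₂⟩ := exists_nat_ge (∑ i, (u i p.1 p.2 + 1))
      refine mem_iUnion.2 ⟨max n₁ n₂, fun s _ hs i => ?_⟩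
      have h1 : 1 / (((max n₁ n₂ : ℕ) : ℝ) + 1) ≤ 1 / ((n₁ : ℝ) + 1) := by
        gcongr; exact le_max_left _ _
      have h2 := hδu (y := s) (by rw [Real.dist_eq]; linarith) i
      have h3 : u i p.1 p.2 + 1 ≤ ∑ i, (u i p.1 p.2 + 1) :=
        Finset.single_le_sum (f := fun i => u i p.1 p.2 + 1)
          (fun j _ => by have := h.nonneg j p.1 p.2 (hBT p hp); linarith) (Finset.mem_univ i)
      have h4 : (n₂ : ℝ) ≤ ((max n₁ n₂ : ℕ) : ℝ) := by exact_mod_cast le_max_right _ _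
      linarith
  obtain ⟨ε, hε, hεO⟩ := Metric.isOpen_iff.1 (hO.inter isOpen_ball) p₀ ⟨hp₀O, hp₀B.1⟩
  have hEn : ∀ p ∈ ball p₀ ε, ¬ BddNear u p → p ∈ E n := fun p hp hb =>
    hOE ⟨(hεO hp).1, subset_closure ⟨(hεO hp).2, hb⟩⟩
  have hT₀ : 0 < T - p₀.2 := sub_pos.2 (hBT p₀ (subset_closure hp₀B))
  have hn0 : (0 : ℝ) < 1 / ((n : ℝ) + 1) := by positivity
  set d₀ := min (min 1 ε) (min (1 / ((n : ℝ) + 1)) (T - p₀.2)) / 100 with hd₀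
  have hmin : 0 < min (min 1 ε) (min (1 / ((n : ℝ) + 1)) (T - p₀.2)) :=
    lt_min (lt_min one_pos hε) (lt_min hn0 hT₀)
  have hd₀0 : 0 < d₀ := by positivity
  have hd1 : 100 * d₀ ≤ 1 := by
    rw [hd₀]; linarith [(min_le_left (min 1 ε) (min (1 / ((n : ℝ) + 1)) (T - p₀.2))).trans
        (min_le_left _ _)]
  have hd2 : 100 * d₀ ≤ ε := by
    rw [hd₀]; linarith [(min_le_left (min 1 ε) (min (1 / ((n : ℝ) + 1)) (T - p₀.2))).trans
        (min_le_right _ _)]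
  have hd3 : 100 * d₀ ≤ 1 / ((n : ℝ) + 1) := by
    rw [hd₀]; linarith [(min_le_right (min 1 ε) (min (1 / ((n : ℝ) + 1)) (T - p₀.2))).trans
        (min_le_left _ _)]
  have hd4 : 100 * d₀ ≤ T - p₀.2 := by
    rw [hd₀]; linarith [(min_le_right (min 1 ε) (min (1 / ((n : ℝ) + 1)) (T - p₀.2))).trans
        (min_le_right _ _)]
  have hsq : ∀ {d : ℝ}, 0 ≤ d → d ≤ 1 → d ^ 2 ≤ d := fun h0 h1 => by nlinarith
  refine hp₀B.2 ⟨(C + 1) * n, ?_⟩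
  filter_upwards [ball_mem_nhds p₀ (by positivity : 0 < d₀ ^ 2)] with q hq i
  have hq1 : dist q.1 p₀.1 < d₀ ^ 2 := (le_max_left _ _).trans_lt hq
  have hq2 : |q.2 - p₀.2| < d₀ ^ 2 := (le_max_right _ _).trans_lt hq
  have hd₀s := hsq hd₀0.le (by linarith)
  have hnn : (0 : ℝ) ≤ n := Nat.cast_nonneg n
  have hq2' := abs_lt.1 hq2
  by_cases hqb : BddNear u q
  swap
  · have hqE := hEn q (ball_subset_ball (by linarith) hq) hqb
    have := hqE q.2 (by linarith) (by rw [sub_self, abs_zero]; exact hn0) i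
    nlinarith
  have hex : ∃ k : ℕ, ∀ x t, dist x q.1 < d₀ / 2 ^ k → |t - q.2| < (d₀ / 2 ^ k) ^ 2 →
      BddNear u (x, t) := by
    obtain ⟨ε', hε', hb⟩ := Metric.eventually_nhds_iff.1 hqb.eventually
    obtain ⟨k, hk⟩ := exists_pow_lt_of_lt_one hε' (show (1 / 2 : ℝ) < 1 by norm_num)
    refine ⟨k, fun x t hx ht => hb ?_⟩
    have e : d₀ / 2 ^ k ≤ (1 / 2) ^ k := by
      rw [div_pow, one_pow]; gcongr; linarith
    have e2 : (d₀ / 2 ^ k) ^ 2 ≤ d₀ / 2 ^ k :=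
      hsq (by positivity) (e.trans (pow_le_one₀ (by norm_num) (by norm_num)))
    refine max_lt (by linarith) ?_
    rw [Real.dist_eq]; linarith
  classical
  obtain ⟨k, hk, hmink⟩ : ∃ k : ℕ, (∀ x t, dist x q.1 < d₀ / 2 ^ (k + 1) →
      |t - q.2| < (d₀ / 2 ^ (k + 1)) ^ 2 → BddNear u (x, t)) ∧
      ¬ ∀ x t, dist x q.1 < d₀ / 2 ^ k → |t - q.2| < (d₀ / 2 ^ k) ^ 2 → BddNear u (x, t) := by
    have hne : Nat.find hex ≠ 0 := fun h0 => by
      have := Nat.find_spec hex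
      rw [h0] at this
      refine hp₀B.2 (this p₀.1 p₀.2 ?_ ?_)
      · rw [dist_comm, pow_zero, div_one]; linarith
      · rw [abs_sub_comm, pow_zero, div_one]; exact hq2
    obtain ⟨k, hk⟩ := Nat.exists_eq_succ_of_ne_zero hne
    exact ⟨k, by have := Nat.find_spec hex; rw [hk] at this; exact this,
      Nat.find_min hex (by rw [hk]; exact Nat.lt_succ_self k)⟩
  push Not at hmink
  obtain ⟨x, t, hx, ht, hxt⟩ := hmink
  set r := d₀ / 2 ^ (k + 1) / 2 with hr
  have hr0 : 0 < r := by positivity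
  have hd4r : d₀ / 2 ^ k = 4 * r := by rw [hr, pow_succ]; field_simp; norm_num
  have hd2r : d₀ / 2 ^ (k + 1) = 2 * r := by rw [hr]; ring
  have hrd : 4 * r ≤ d₀ := by
    rw [← hd4r]; exact div_le_self hd₀0.le (one_le_pow₀ (by norm_num))
  have hrs := hsq hr0.le (by linarith)
  rw [hd4r] at hx ht
  rw [hd2r] at hk
  have ht' := abs_lt.1 ht
  have hsol : IsSol β (rescale r q.1 q.2 u) (Ioo (-1) 9) :=
    (h.isSol_rescale hr0.le q.1 q.2).mono fun s hs => by
      have : r ^ 2 * s ≤ r ^ 2 * 9 := by gcongr; exact hs.2.le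
      change q.2 + r ^ 2 * s < T
      linarith
  obtain ⟨M, hM⟩ := exists_bound_rescale (u := u) hr0 (y := q.1) (s := q.2) fun x hx t ht =>
    hk x t (by linarith) (by linarith [pow_pos hr0 2])
  have key := hH _ M hsol hM i (r⁻¹ • (x - q.1)) (by
    rw [norm_smul, norm_inv, Real.norm_eq_abs, abs_of_pos hr0, ← dist_eq_norm, inv_mul_le_iff₀ hr0]
    linarith)
  simp only [rescale, smul_zero, add_zero, mul_zero, smul_smul, mul_inv_cancel₀ hr0.ne', one_smul,
    add_sub_cancel] at key
  have hxE : (x, t) ∈ E n := by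
    refine hEn _ (show max (dist x p₀.1) (dist t p₀.2) < ε from max_lt ?_ ?_) hxt
    · have := dist_triangle x q.1 p₀.1
      change dist x p₀.1 < ε
      linarith
    · change |t - p₀.2| < ε
      exact abs_lt.2 ⟨by nlinarith, by nlinarith⟩
  have hle := hxE (q.2 + r ^ 2 * 8) (by linarith) (abs_lt.2 ⟨by
    change -(1 / ((n : ℝ) + 1)) < q.2 + r ^ 2 * 8 - t
    nlinarith, by
    change q.2 + r ^ 2 * 8 - t < 1 / ((n : ℝ) + 1)
    nlinarith⟩) i
  change u i x (q.2 + r ^ 2 * 8) ≤ n at hle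
  have h1 : u i q.1 q.2 ≤ C * u i x (q.2 + r ^ 2 * 8) := by
    refine le_of_mul_le_mul_left ?_ hr0
    linarith
  have := mul_le_mul_of_nonneg_left hle hC.le
  linarith

end AncientCubic

/-- universal estimate for nonnegative ancient solutions of the cubic
(Gross-Pitaevskii, `r = 1`) system on `ℝ^N × (−∞,T)` in dimension `N ≤ 3`:
`u_i(x,t) ≤ C (T−t)^{−1/2}`. -/
theorem universal_estimate_ancient_cubic
    (N m : ℕ) (hN : 1 ≤ N) (hN3 : N ≤ 3) (hm : 2 ≤ m)
    (β : Fin m → Fin m → ℝ)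
    (hsym : ∀ i j, β i j = β j i)
    (hoff : ∀ i j, i ≠ j → 0 ≤ β i j)
    (hdiag : ∀ i, 0 < β i i) :
    ∃ C : ℝ, 0 < C ∧
      ∀ (T : ℝ) (u : Fin m → EuclideanSpace ℝ (Fin N) → ℝ → ℝ),
        (∀ i, ∀ t ∈ Iio T, ContDiff ℝ 2 (fun x => u i x t)) →
        (∀ i (x : EuclideanSpace ℝ (Fin N)),
          ContDiffOn ℝ 1 (fun s => u i x s) (Iio T)) →
        (∀ i (x : EuclideanSpace ℝ (Fin N)), ∀ t ∈ Iio T, 0 ≤ u i x t) →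
        (∀ i (x : EuclideanSpace ℝ (Fin N)), ∀ t ∈ Iio T,
          deriv (fun s => u i x s) t - lap (fun y => u i y t) x
            = ∑ j, β i j * u i x t * u j x t ^ 2) →
        ∀ i (x : EuclideanSpace ℝ (Fin N)), ∀ t ∈ Iio T,
          u i x t ≤ C * (T - t) ^ (-(1 / 2) : ℝ) := by
  have hβ : ∀ i j, 0 ≤ β i j := fun i j => by
    rcases eq_or_ne i j with rfl | hij
    · exact (hdiag i).le
    · exact hoff i j hij
  obtain ⟨C, hC, hU⟩ := AncientCubic.exists_bounded_at_center (N := N) hN hN3 hβ hsym hdiag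
  refine ⟨C * √2, by positivity, fun T u hc2 hdt hnn heq i x t ht => ?_⟩
  have h : AncientCubic.IsSol β u (Iio T) :=
    ⟨hc2, fun i x t ht => ((hdt i x).differentiableOn (by norm_num)).differentiableAt (Iio_mem_nhds ht),
      hnn, fun i x t ht => by
        have := heq i x t ht
        unfold AncientCubic.cubic
        linarith⟩
  have hTt : 0 < T - t := sub_pos.2 ht
  set r := √((T - t) / 2) with hr
  have hr0 : 0 < r := Real.sqrt_pos.2 (by positivity)
  have hr2 : r ^ 2 = (T - t) / 2 := Real.sq_sqrt (by positivity)
  obtain ⟨M, hM⟩ := AncientCubic.exists_bound_rescale (u := u) hr0 (y := x) (s := t) fun y _ s hs =>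
    h.bddNear hN hN3 hβ hsym hdiag (y, s) (by
      have := (abs_le.1 hs).2
      change s < T
      linarith)
  have hsol : AncientCubic.IsSol β (AncientCubic.rescale r x t u) (Ioo (-1) 1) :=
    (h.isSol_rescale hr0.le x t).mono fun s hs => by
      change t + r ^ 2 * s < T
      rw [hr2]
      nlinarith [hs.2]
  have key := hU _ M hsol hM i
  simp only [AncientCubic.rescale, smul_zero, add_zero, mul_zero] at key
  have e : (T - t) ^ (-(1 / 2) : ℝ) = (√(T - t))⁻¹ := by
    rw [Real.rpow_neg hTt.le, Real.sqrt_eq_rpow]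
  have e2 : r = √(T - t) / √2 := by rw [hr, Real.sqrt_div hTt.le]
  rw [e, ← div_eq_mul_inv, le_div_iff₀ (Real.sqrt_pos.2 hTt)]
  have e3 : √(T - t) = r * √2 := by rw [e2]; field_simp
  rw [e3]
  calc u i x t * (r * √2) = r * u i x t * √2 := by ring
    _ ≤ C * √2 := by gcongr
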